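/- Assume additionally that each λ_{ij} (j ≠ i) is differentiable on (0,∞) and that the k×k stochastic matrix p̃ with entries p̃_{ij} := ∫_0^∞ p_{ij}(y)·f(y|i) dy is irreducible. Then the terminal value problem (P) has exactly one classical solution in the class of functions on D̄ of at most linear growth in s uniformly in (t,i,y). -/

import Mathlib

open MeasureTheory Real Filter Set

noncomputable def sumLam {k : ℕ} (lam : Fin k → Fin k → ℝ → ℝ) (i : Fin k) (y : ℝ) : ℝ :=
  ∑ j ∈ Finset.univ.filter (fun j => j ≠ i), lam i j y

noncomputable def Lambda {k : ℕ} (lam : Fin k → Fin k → ℝ → ℝ) (i : Fin k) (y : ℝ) : ℝ :=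
  ∫ v in (0:ℝ)..y, sumLam lam i v

noncomputable def Fcdf {k : ℕ} (lam : Fin k → Fin k → ℝ → ℝ) (i : Fin k) (y : ℝ) : ℝ :=
  1 - Real.exp (-(Lambda lam i y))

noncomputable def fdens {k : ℕ} (lam : Fin k → Fin k → ℝ → ℝ) (i : Fin k) (y : ℝ) : ℝ :=
  sumLam lam i y * Real.exp (-(Lambda lam i y))

noncomputable def pMat {k : ℕ} (lam : Fin k → Fin k → ℝ → ℝ) (i j : Fin k) (y : ℝ) : ℝ :=
  if j = i then (if sumLam lam i y = 0 then 1 else 0)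
  else (if sumLam lam i y = 0 then 0 else lam i j y / sumLam lam i y)

def memDbar (T t s y : ℝ) : Prop :=
  t ∈ Set.Icc 0 T ∧ s ∈ Set.Ici (0:ℝ) ∧ y ∈ Set.Icc 0 t

def memD (T t s y : ℝ) : Prop :=
  t ∈ Set.Ioo 0 T ∧ s ∈ Set.Ioi (0:ℝ) ∧ y ∈ Set.Ioo 0 t

noncomputable def ptilde {k : ℕ} (lam : Fin k → Fin k → ℝ → ℝ) :
    Matrix (Fin k) (Fin k) ℝ :=
  Matrix.of fun i j => ∫ y in Set.Ioi (0:ℝ), pMat lam i j y * fdens lam i y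

/-- `φ` is a classical solution of the non-local degenerate parabolic terminal
value problem (P). -/
def isPSolution {k : ℕ} (lam : Fin k → Fin k → ℝ → ℝ) (r : Fin k → ℝ)
    (σ : ℝ → Fin k → ℝ) (K : ℝ → ℝ) (T : ℝ)
    (φ : ℝ → ℝ → Fin k → ℝ → ℝ) : Prop :=
  (∀ i : Fin k, ContinuousOn (fun p : ℝ × ℝ × ℝ => φ p.1 p.2.1 i p.2.2)
    {p : ℝ × ℝ × ℝ | memDbar T p.1 p.2.1 p.2.2}) ∧
  (∀ i : Fin k, ∀ t s y : ℝ, memD T t s y →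
    DifferentiableAt ℝ (fun u => φ u s i y) t ∧
    DifferentiableAt ℝ (fun x => φ t x i y) s ∧
    DifferentiableAt ℝ (deriv (fun x => φ t x i y)) s ∧
    DifferentiableAt ℝ (fun w => φ t s i w) y) ∧
  (∀ i : Fin k, ∀ t s y : ℝ, memD T t s y →
    deriv (fun u => φ u s i y) t + deriv (fun w => φ t s i w) y
      + r i * s * deriv (fun x => φ t x i y) s
      + (1/2) * (σ t i)^2 * s^2 * deriv (deriv (fun x => φ t x i y)) s
      + ∑ j ∈ Finset.univ.filter (fun j => j ≠ i),
          lam i j y * (φ t s j 0 - φ t s i y)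
      = r i * φ t s i y) ∧
  (∀ i : Fin k, ∀ s : ℝ, 0 < s → ∀ y ∈ Set.Icc (0:ℝ) T, φ T s i y = K s)

/-- `φ` is of at most linear growth in `s`, uniformly in `(t,i,y)`. -/
def linGrowth {k : ℕ} (T : ℝ) (φ : ℝ → ℝ → Fin k → ℝ → ℝ) : Prop :=
  ∃ M : ℝ, ∀ t s y : ℝ, memDbar T t s y → ∀ i : Fin k, |φ t s i y| ≤ M * (1 + s)

section

open scoped NNReal Topology Interval

theorem IsLocalMax.deriv_deriv_nonpos {f : ℝ → ℝ} {a : ℝ} (h : IsLocalMax f a)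
    (hc : ContinuousAt f a) : deriv (deriv f) a ≤ 0 := by
  by_contra! hpos
  have hmin := isLocalMin_of_deriv_deriv_pos hpos h.deriv_eq_zero hc
  have hconst : f =ᶠ[nhds a] fun _ => f a := by
    filter_upwards [h, hmin] with x h1 h2 using le_antisymm h1 h2
  have h1 : deriv f =ᶠ[nhds a] deriv (fun _ => f a) := hconst.deriv
  have h2 := h1.deriv_eq
  simp at h2
  linarith

/-- Partial derivatives at an interior maximum of `w - ε ρ`. -/
theorem deriv_eq_of_isLocalMax_sub {f g : ℝ → ℝ} {g' a : ℝ}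
    (h : IsLocalMax (fun x => f x - g x) a) (hf : DifferentiableAt ℝ f a)
    (hg : HasDerivAt g g' a) : deriv f a = g' := by
  have h1 := h.deriv_eq_zero
  have h2 := (hf.hasDerivAt.sub hg).deriv
  have h3 : deriv (fun x => f x - g x) a = deriv f a - g' := h2
  linarith

theorem deriv_deriv_le_of_isLocalMax_sub {f g g₁ : ℝ → ℝ} {g₂ a : ℝ}
    (h : IsLocalMax (fun x => f x - g x) a)
    (hf : ∀ᶠ x in nhds a, DifferentiableAt ℝ f x)
    (hf2 : DifferentiableAt ℝ (deriv f) a)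
    (hg : ∀ᶠ x in nhds a, HasDerivAt g (g₁ x) x) (hg2 : HasDerivAt g₁ g₂ a) :
    deriv (deriv f) a ≤ g₂ := by
  have h1 := h.deriv_deriv_nonpos (hf.self_of_nhds.sub hg.self_of_nhds.differentiableAt).continuousAt
  have h2 : deriv (fun x => f x - g x) =ᶠ[nhds a] fun x => deriv f x - g₁ x := by
    filter_upwards [hf, hg] with x h1 h2 using (h1.hasDerivAt.sub h2).deriv
  rw [h2.deriv_eq] at h1
  have h3 : deriv (fun x => deriv f x - g₁ x) a = deriv (deriv f) a - g₂ :=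
    (hf2.hasDerivAt.sub hg2).deriv
  linarith

theorem exists_isMax_of_isCompact {ι X : Type*} [Fintype ι] [TopologicalSpace X]
    {C : Set X} (hC : IsCompact C) (f : ι → X → ℝ) (hf : ∀ i, ContinuousOn (f i) C)
    (hne : C.Nonempty) (i₀ : ι) :
    ∃ i, ∃ P ∈ C, ∀ j, ∀ P' ∈ C, f j P' ≤ f i P := by
  choose p hp hmax using fun i => hC.exists_isMaxOn hne (hf i)
  obtain ⟨i, -, hi⟩ := Finset.exists_max_image Finset.univ (fun i => f i (p i)) ⟨i₀, Finset.mem_univ _⟩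
  exact ⟨i, p i, hp i, fun j P' hP' => (hmax j hP').trans (hi j (Finset.mem_univ _))⟩

theorem barrier_hasDerivAt {s : ℝ} (hs : 0 < s) (a : ℝ) :
    HasDerivAt (fun x : ℝ => a * (x ^ 2 + x⁻¹)) (a * (2 * s - (s ^ 2)⁻¹)) s := by
  have := ((hasDerivAt_pow 2 s).add (hasDerivAt_inv hs.ne')).const_mul a
  refine this.congr_deriv ?_
  simp [sub_eq_add_neg]

theorem barrier_hasDerivAt' {s : ℝ} (hs : 0 < s) (a : ℝ) :
    HasDerivAt (fun x : ℝ => a * (2 * x - (x ^ 2)⁻¹)) (a * (2 + 2 * (s ^ 3)⁻¹)) s := by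
  have h1 : HasDerivAt (fun x : ℝ => x ^ 2) (2 * s) s := by simpa using hasDerivAt_pow 2 s
  have h0 : s ^ 2 ≠ 0 := by positivity
  have := (((hasDerivAt_id s).const_mul 2).sub (h1.inv h0)).const_mul a
  refine this.congr_deriv ?_
  field_simp
  ring

theorem one_le_sq_add_inv {s : ℝ} (hs : 0 < s) : 1 ≤ s ^ 2 + s⁻¹ := by
  rcases le_total 1 s with h | h
  · have : 0 < s⁻¹ := by positivity
    nlinarith
  · have : 1 ≤ s⁻¹ := (one_le_inv₀ hs).2 h
    nlinarith [sq_nonneg s]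

/-- The degenerate parabolic operator is strictly negative on the barrier at an interior maximum. -/
theorem no_interior_max {k : ℕ} {lam : Fin k → Fin k → ℝ → ℝ} {r : Fin k → ℝ}
    {σ : ℝ → Fin k → ℝ} {w : ℝ → ℝ → Fin k → ℝ → ℝ} {i : Fin k} {t s y T c B R ε δ κ m : ℝ}
    (hnn : ∀ j : Fin k, i ≠ j → 0 ≤ lam i j y)
    (hbound : sumLam lam i y ≤ c) (hr : 0 ≤ r i) (hrR : r i ≤ R) (hσ : (σ t i) ^ 2 ≤ B)
    (hε : 0 < ε) (hδ : 0 < δ) (hκ : 0 ≤ κ)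
    (htT : t < T) (hs : 0 < s) (hy : 0 < y) (hyt : y < t)
    (hdt : DifferentiableAt ℝ (fun u => w u s i y) t)
    (hds : ∀ᶠ x in nhds s, DifferentiableAt ℝ (fun x => w t x i y) x)
    (hdss : DifferentiableAt ℝ (deriv (fun x => w t x i y)) s)
    (hdy : DifferentiableAt ℝ (fun v => w t s i v) y)
    (hpde : deriv (fun u => w u s i y) t + deriv (fun v => w t s i v) y
      + r i * s * deriv (fun x => w t x i y) s
      + (1/2) * (σ t i)^2 * s^2 * deriv (deriv (fun x => w t x i y)) s
      + ∑ j ∈ Finset.univ.filter (fun j => j ≠ i),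
          lam i j y * (w t s j 0 - w t s i y)
      = r i * w t s i y)
    (hmt : IsLocalMax (fun u => w u s i y -
      (ε * exp (-(2 * R + B + 1) * u) * (s ^ 2 + s⁻¹) + δ * (y⁻¹ + (u - y)⁻¹))) t)
    (hms : IsLocalMax (fun x => w t x i y -
      (ε * exp (-(2 * R + B + 1) * t) * (x ^ 2 + x⁻¹) + δ * (y⁻¹ + (t - y)⁻¹))) s)
    (hmy : IsLocalMax (fun v => w t s i v -
      (ε * exp (-(2 * R + B + 1) * t) * (s ^ 2 + s⁻¹) + δ * (v⁻¹ + (t - v)⁻¹))) y)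
    (hm0 : ∀ j, w t s j 0 - ε * exp (-(2 * R + B + 1) * t) * (s ^ 2 + s⁻¹) ≤ m)
    (hm1 : m - 2 * κ ≤ w t s i y - ε * exp (-(2 * R + B + 1) * t) * (s ^ 2 + s⁻¹))
    (hκm : 2 * κ < m) (hκc : 2 * κ * c < ε * exp (-(2 * R + B + 1) * T)) : False := by
  set β := 2 * R + B + 1 with hβ
  set ρ := ε * exp (-β * t) * (s ^ 2 + s⁻¹) with hρ
  have hty : t - y ≠ 0 := by linarith
  have hexp : 0 < ε * exp (-β * t) := by positivity
  have hB : 0 ≤ B := (sq_nonneg _).trans hσ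
  have hR : 0 ≤ R := hr.trans hrR
  have e1 : deriv (fun u => w u s i y) t = -β * ρ + δ * (-((t - y) ^ 2)⁻¹) := by
    apply deriv_eq_of_isLocalMax_sub hmt hdt
    have h1 : HasDerivAt (fun u : ℝ => exp (-β * u)) (exp (-β * t) * (-β * 1)) t :=
      ((hasDerivAt_id t).const_mul (-β)).exp
    have h2 : HasDerivAt (fun u : ℝ => (u - y)⁻¹) (-1 / (t - y) ^ 2) t :=
      ((hasDerivAt_id t).sub_const y).inv hty
    refine (((h1.const_mul ε).mul_const (s ^ 2 + s⁻¹)).add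
      ((h2.const_add y⁻¹).const_mul δ)).congr_deriv ?_
    simp only [hρ]; ring
  have e2 : deriv (fun v => w t s i v) y = δ * (-(y ^ 2)⁻¹ + ((t - y) ^ 2)⁻¹) := by
    apply deriv_eq_of_isLocalMax_sub hmy hdy
    have h2 : HasDerivAt (fun v : ℝ => (t - v)⁻¹) (-(-1) / (t - y) ^ 2) y :=
      ((hasDerivAt_id y).const_sub t).inv hty
    refine ((((hasDerivAt_inv hy.ne').add h2).const_mul δ).const_add ρ).congr_deriv ?_
    ring
  have e3 : deriv (fun x => w t x i y) s = ε * exp (-β * t) * (2 * s - (s ^ 2)⁻¹) := by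
    apply deriv_eq_of_isLocalMax_sub hms hds.self_of_nhds
    exact (barrier_hasDerivAt hs _).add_const _
  have e4 : deriv (deriv (fun x => w t x i y)) s ≤ ε * exp (-β * t) * (2 + 2 * (s ^ 3)⁻¹) := by
    refine deriv_deriv_le_of_isLocalMax_sub hms hds hdss
      (g₁ := fun x => ε * exp (-β * t) * (2 * x - (x ^ 2)⁻¹)) ?_ (barrier_hasDerivAt' hs _)
    filter_upwards [lt_mem_nhds hs] with x hx
    exact (barrier_hasDerivAt hx _).add_const _
  have e5 : ∑ j ∈ Finset.univ.filter (fun j => j ≠ i), lam i j y * (w t s j 0 - w t s i y)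
      ≤ 2 * κ * c := by
    calc _ ≤ ∑ j ∈ Finset.univ.filter (fun j => j ≠ i), lam i j y * (2 * κ) := by
          apply Finset.sum_le_sum
          intro j hj
          have hj' : i ≠ j := fun h => (Finset.mem_filter.1 hj).2 h.symm
          apply mul_le_mul_of_nonneg_left _ (hnn j hj')
          linarith [hm0 j]
      _ = sumLam lam i y * (2 * κ) := by rw [sumLam, Finset.sum_mul]
      _ ≤ c * (2 * κ) := by gcongr
      _ = 2 * κ * c := by ring
  have hwpos : 0 ≤ w t s i y := by
    have : 0 ≤ ρ := by positivity
    linarith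
  have hrw : 0 ≤ r i * w t s i y := mul_nonneg hr hwpos
  have e6 : (1/2) * (σ t i)^2 * s^2 * deriv (deriv (fun x => w t x i y)) s ≤ B * ρ := by
    calc _ ≤ (1/2) * (σ t i)^2 * s^2 * (ε * exp (-β * t) * (2 + 2 * (s ^ 3)⁻¹)) := by gcongr
      _ = (σ t i)^2 * ρ := by rw [hρ]; field_simp
      _ ≤ B * ρ := by gcongr
  have e7 : r i * s * deriv (fun x => w t x i y) s ≤ 2 * R * ρ := by
    rw [e3]
    calc _ = ε * exp (-β * t) * (r i * (2 * s ^ 2 - s⁻¹)) := by field_simp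
      _ ≤ ε * exp (-β * t) * (R * (2 * (s ^ 2 + s⁻¹))) := by
        have h3 : 0 ≤ s⁻¹ := by positivity
        gcongr ε * exp (-β * t) * ?_
        have : r i * (2 * s ^ 2 - s⁻¹) ≤ r i * (2 * (s ^ 2 + s⁻¹)) := by
          apply mul_le_mul_of_nonneg_left _ hr; linarith
        exact this.trans (by gcongr)
      _ = 2 * R * ρ := by rw [hρ]; ring
  have e8 : ε * exp (-β * T) ≤ ρ := by
    calc ε * exp (-β * T) ≤ ε * exp (-β * t) * 1 := by
          rw [mul_one]
          gcongr ε * ?_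
          apply exp_le_exp.2
          have : 0 < β := by positivity
          nlinarith
      _ ≤ ρ := by
          rw [hρ]
          exact mul_le_mul_of_nonneg_left (one_le_sq_add_inv hs) hexp.le
  have e9 : 0 < δ * (y ^ 2)⁻¹ := by positivity
  rw [e1, e2] at hpde
  have : (2 * R + B + 1) * ρ = 2 * R * ρ + B * ρ + ρ := by ring
  rw [← hβ] at this
  linarith

theorem exists_memD_near {X : ℝ × ℝ × ℝ → ℝ} {T t s y m : ℝ} (hT : 0 < T)
    (hX : ContinuousOn X {p : ℝ × ℝ × ℝ | memDbar T p.1 p.2.1 p.2.2 ∧ 0 < p.2.1})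
    (hp : memDbar T t s y) (hs : 0 < s) (hm : m < X (t, s, y)) :
    ∃ t' y', memD T t' s y' ∧ m < X (t', s, y') := by
  obtain ⟨⟨ht0, htT⟩, -, hy0, hyt⟩ := hp
  have hmem : ∀ τ ∈ Icc (0:ℝ) 1, ((1 - τ) * t + τ * (T / 2), s, (1 - τ) * y + τ * (T / 4)) ∈
      {p : ℝ × ℝ × ℝ | memDbar T p.1 p.2.1 p.2.2 ∧ 0 < p.2.1} := by
    rintro τ ⟨h0, h1⟩
    have h1' : 0 ≤ 1 - τ := by linarith
    refine ⟨⟨⟨?_, ?_⟩, hs.le, ?_, ?_⟩, hs⟩ <;> dsimp only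
    · positivity
    · nlinarith [mul_le_mul_of_nonneg_left htT h1']
    · positivity
    · nlinarith [mul_le_mul_of_nonneg_left hyt h1']
  have hc : ContinuousOn (fun τ : ℝ =>
      X ((1 - τ) * t + τ * (T / 2), s, (1 - τ) * y + τ * (T / 4))) (Icc 0 1) :=
    hX.comp (by fun_prop) hmem
  have h0 := hc 0 (by simp)
  have h1 : ∀ᶠ τ in nhdsWithin (0:ℝ) (Icc 0 1),
      m < X ((1 - τ) * t + τ * (T / 2), s, (1 - τ) * y + τ * (T / 4)) := by
    apply h0.eventually_const_lt
    simpa using hm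
  have h2 : ∀ᶠ τ in nhdsWithin (0:ℝ) (Ioo 0 1),
      m < X ((1 - τ) * t + τ * (T / 2), s, (1 - τ) * y + τ * (T / 4)) :=
    h1.filter_mono (nhdsWithin_mono _ Ioo_subset_Icc_self)
  have : (nhdsWithin (0:ℝ) (Ioo 0 1)).NeBot := by
    rw [← mem_closure_iff_nhdsWithin_neBot, closure_Ioo (by norm_num)]; simp
  obtain ⟨τ, h3, h4, h5⟩ := (h2.and self_mem_nhdsWithin).exists
  have h5' : 0 < 1 - τ := by linarith
  refine ⟨_, _, ⟨⟨?_, ?_⟩, hs, ?_, ?_⟩, h3⟩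
  · positivity
  · nlinarith [mul_le_mul_of_nonneg_left htT h5'.le]
  · positivity
  · nlinarith [mul_le_mul_of_nonneg_left hyt h5'.le]

theorem maximum_principle {k : ℕ} {lam : Fin k → Fin k → ℝ → ℝ}
    (hnn : ∀ i j : Fin k, i ≠ j → ∀ y : ℝ, 0 < y → 0 ≤ lam i j y)
    {c : ℝ} (hc : 0 < c)
    (hbound : ∀ i : Fin k, ∀ y : ℝ, 0 < y → sumLam lam i y ≤ c)
    {r : Fin k → ℝ} (hr : ∀ i : Fin k, 0 ≤ r i)
    {σ : ℝ → Fin k → ℝ} (hσcont : ∀ i : Fin k, ContinuousOn (fun u => σ u i) (Set.Ici 0))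
    {T : ℝ} (hT : 0 < T) {w : ℝ → ℝ → Fin k → ℝ → ℝ}
    (hw : isPSolution lam r σ (fun _ => 0) T w) (hg : linGrowth T w)
    {t s y : ℝ} (hp : memDbar T t s y) (i : Fin k) : w t s i y ≤ 0 := by
  obtain ⟨hcont, hdiff, hpde, hterm⟩ := hw
  obtain ⟨M₀, hM₀⟩ := hg
  obtain ⟨R, hR⟩ : ∃ R, ∀ i, r i ≤ R := (Finite.bddAbove_range r).imp fun R h i => h ⟨i, rfl⟩
  obtain ⟨B, hB⟩ : ∃ B, ∀ i, ∀ t ∈ Icc 0 T, (σ t i) ^ 2 ≤ B := by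
    have h1 : ∀ i, ∃ B, ∀ t ∈ Icc 0 T, (σ t i) ^ 2 ≤ B := by
      intro i
      obtain ⟨B, hB⟩ := (isCompact_Icc (a := (0:ℝ)) (b := T)).bddAbove_image
        (f := fun t => (σ t i) ^ 2) (((hσcont i).mono Icc_subset_Ici_self).pow 2)
      exact ⟨B, fun t ht => hB ⟨t, ht, rfl⟩⟩
    choose B hB using h1
    obtain ⟨B', hB'⟩ := Finite.bddAbove_range B
    exact ⟨B', fun i t ht => (hB i t ht).trans (hB' ⟨i, rfl⟩)⟩
  set β := 2 * R + B + 1 with hβ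
  have hB0 : 0 ≤ B := (sq_nonneg _).trans (hB i 0 ⟨le_rfl, hT.le⟩)
  have hR0 : 0 ≤ R := (hr i).trans (hR i)
  have hβ0 : 0 < β := by positivity
  set M := |M₀| with hM
  have hMb : ∀ t s y, memDbar T t s y → ∀ i, w t s i y ≤ M * (1 + s) := by
    intro t s y h i
    have h1 : 0 ≤ s := h.2.1
    calc _ ≤ |w t s i y| := le_abs_self _
      _ ≤ M₀ * (1 + s) := hM₀ t s y h i
      _ ≤ M * (1 + s) := by gcongr; exact le_abs_self _
  -- the perturbed function is nonpositive
  have key : ∀ ε > 0, ∀ t s y, memDbar T t s y → 0 < s → ∀ i,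
      w t s i y - ε * exp (-β * t) * (s ^ 2 + s⁻¹) ≤ 0 := by
    intro ε hε t₀ s₀ y₀ hp₀ hs₀ i₀
    by_contra! hpos
    set v : Fin k → ℝ × ℝ × ℝ → ℝ := fun i p =>
      w p.1 p.2.1 i p.2.2 - ε * exp (-β * p.1) * (p.2.1 ^ 2 + p.2.1⁻¹) with hv
    have hvc : ∀ i, ContinuousOn (v i)
        {p : ℝ × ℝ × ℝ | memDbar T p.1 p.2.1 p.2.2 ∧ 0 < p.2.1} := by
      intro i
      apply ContinuousOn.sub ((hcont i).mono fun p hp => hp.1)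
      apply ContinuousOn.mul (by fun_prop)
      apply ContinuousOn.add (by fun_prop)
      exact ContinuousOn.inv₀ (by fun_prop) fun p hp => hp.2.ne'
    set c₀ := ε * exp (-β * T) with hc₀
    have hc₀pos : 0 < c₀ := by positivity
    set N := max 1 (2 * M / c₀) with hN
    have hN1 : 1 ≤ N := le_max_left _ _
    have hNM : 2 * M ≤ c₀ * N := by
      have : 2 * M / c₀ ≤ N := le_max_right _ _
      rwa [div_le_iff₀ hc₀pos, mul_comm N] at this
    have hM0 : 0 ≤ M := abs_nonneg _
    have hout : ∀ t s y, memDbar T t s y → 0 < s → s ∉ Icc N⁻¹ N → ∀ i, v i (t, s, y) ≤ 0 := by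
      intro t s y h hs hsN i
      have hinv : 0 < s⁻¹ := by positivity
      have h1 : c₀ * (s ^ 2 + s⁻¹) ≤ ε * exp (-β * t) * (s ^ 2 + s⁻¹) := by
        rw [hc₀]
        gcongr ε * exp ?_ * _
        have := h.1.2
        nlinarith
      have h2 : M * (1 + s) ≤ c₀ * (s ^ 2 + s⁻¹) := by
        rcases lt_or_ge N s with h3 | h3
        · have h4 : 1 ≤ s := hN1.trans h3.le
          calc M * (1 + s) ≤ 2 * M * s := by nlinarith
            _ ≤ c₀ * N * s := by gcongr
            _ ≤ c₀ * s * s := by gcongr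
            _ ≤ c₀ * (s ^ 2 + s⁻¹) := by nlinarith [mul_pos hc₀pos hinv]
        · have h4 : s < N⁻¹ := by
            by_contra! h5; exact hsN ⟨h5, h3⟩
          have h5 : N < s⁻¹ := by rwa [lt_inv_comm₀ (by positivity) hs]
          have h6 : s ≤ 1 := h4.le.trans (inv_le_one_of_one_le₀ hN1)
          calc M * (1 + s) ≤ 2 * M := by nlinarith
            _ ≤ c₀ * N := hNM
            _ ≤ c₀ * s⁻¹ := by gcongr
            _ ≤ c₀ * (s ^ 2 + s⁻¹) := by gcongr; nlinarith [sq_nonneg s]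
      have := hMb t s y h i
      simp only [hv]; linarith
    set C : Set (ℝ × ℝ × ℝ) := {p | memDbar T p.1 p.2.1 p.2.2 ∧ p.2.1 ∈ Icc N⁻¹ N} with hC
    have hNpos : 0 < N⁻¹ := by positivity
    have hCsub : C ⊆ {p : ℝ × ℝ × ℝ | memDbar T p.1 p.2.1 p.2.2 ∧ 0 < p.2.1} :=
      fun p hp => ⟨hp.1, hNpos.trans_le hp.2.1⟩
    have hCclosed : IsClosed C := by
      have : C = {p | 0 ≤ p.1} ∩ {p | p.1 ≤ T} ∩ {p | 0 ≤ p.2.1} ∩ {p | 0 ≤ p.2.2} ∩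
          {p | p.2.2 ≤ p.1} ∩ {p | N⁻¹ ≤ p.2.1} ∩ {p | p.2.1 ≤ N} := by
        ext p; simp only [hC, memDbar, mem_ofPred_eq, mem_Icc, mem_Ici, mem_inter_iff]; tauto
      rw [this]
      refine IsClosed.inter (IsClosed.inter (IsClosed.inter (IsClosed.inter (IsClosed.inter
        (IsClosed.inter ?_ ?_) ?_) ?_) ?_) ?_) ?_ <;>
      exact isClosed_le (by fun_prop) (by fun_prop)
    have hCcomp : IsCompact C := by
      apply (isCompact_Icc (a := ((0:ℝ), N⁻¹, (0:ℝ))) (b := (T, N, T))).of_isClosed_subset hCclosed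
      rintro ⟨a, b, d⟩ ⟨⟨⟨h1, h2⟩, h3, h4, h5⟩, h6, h7⟩
      exact ⟨⟨h1, h6, h4⟩, ⟨h2, h7, h5.trans h2⟩⟩
    have hs₀N : s₀ ∈ Icc N⁻¹ N := by
      by_contra h
      exact absurd (hout t₀ s₀ y₀ hp₀ hs₀ h i₀) (not_le.2 hpos)
    obtain ⟨i₁, ⟨t₁, s₁, y₁⟩, hP₁, hmax⟩ := exists_isMax_of_isCompact hCcomp v
      (fun i => (hvc i).mono hCsub) ⟨(t₀, s₀, y₀), hp₀, hs₀N⟩ i₀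
    set m := v i₁ (t₁, s₁, y₁) with hm
    have hm0 : 0 < m := lt_of_lt_of_le hpos (hmax i₀ (t₀, s₀, y₀) ⟨hp₀, hs₀N⟩)
    have hmall : ∀ t s y, memDbar T t s y → 0 < s → ∀ i, v i (t, s, y) ≤ m := by
      intro t s y h hs i
      by_cases hsN : s ∈ Icc N⁻¹ N
      · exact hmax i (t, s, y) ⟨h, hsN⟩
      · exact (hout t s y h hs hsN i).trans hm0.le
    set κ := min (m / 4) (c₀ / (4 * c)) with hκ
    have hκ0 : 0 < κ := by positivity
    have hκm : 2 * κ < m := by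
      have : κ ≤ m / 4 := min_le_left _ _
      linarith
    have hκc : 2 * κ * c < c₀ := by
      have : κ ≤ c₀ / (4 * c) := min_le_right _ _
      rw [le_div_iff₀ (by positivity)] at this
      linarith
    obtain ⟨t', y', hP', hX⟩ := exists_memD_near (m := m - κ) hT (hvc i₁) hP₁.1
      (hCsub hP₁).2 (by linarith)
    set ρ₂ : ℝ × ℝ × ℝ → ℝ := fun p => p.2.2⁻¹ + (p.1 - p.2.2)⁻¹ with hρ₂
    have hy' : 0 < y' := hP'.2.2.1
    have hty' : 0 < t' - y' := sub_pos.2 hP'.2.2.2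
    have hρpos : 0 < ρ₂ (t', s₁, y') := by simp only [hρ₂]; positivity
    set δ := κ / ρ₂ (t', s₁, y') with hδ
    have hδ0 : 0 < δ := by positivity
    set z : Fin k → ℝ × ℝ × ℝ → ℝ := fun i p => v i p - δ * ρ₂ p with hz
    have hz' : m - 2 * κ < z i₁ (t', s₁, y') := by
      have : δ * ρ₂ (t', s₁, y') = κ := by rw [hδ]; field_simp
      simp only [hz, this]; linarith
    set η := δ / m with hη
    have hη0 : 0 < η := by positivity
    have hzout : ∀ t s y, memDbar T t s y → 0 < s → 0 < y → y < t → ¬ (η ≤ y ∧ η ≤ t - y) →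
        ∀ i, z i (t, s, y) ≤ 0 := by
      intro t s y h hs hy hyt hne i
      have h1 := hmall t s y h hs i
      have h2 : m ≤ δ * ρ₂ (t, s, y) := by
        have hty : 0 < t - y := sub_pos.2 hyt
        have h4 : 0 < y⁻¹ := by positivity
        have h5 : 0 < (t - y)⁻¹ := by positivity
        have h6 : m = δ * η⁻¹ := by rw [hη]; field_simp
        rw [h6]
        gcongr
        simp only [hρ₂]
        by_cases h7 : η ≤ y
        · have h8 : t - y < η := by by_contra! h8; exact hne ⟨h7, h8⟩
          have := inv_anti₀ hty h8.le
          linarith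
        · have := inv_anti₀ hy (not_le.1 h7).le
          linarith
      simp only [hz]; linarith
    set C' : Set (ℝ × ℝ × ℝ) := C ∩ {p | η ≤ p.2.2} ∩ {p | η ≤ p.1 - p.2.2} with hC'
    have hC'comp : IsCompact C' := (hCcomp.inter_right
      (isClosed_le (by fun_prop) (by fun_prop))).inter_right
      (isClosed_le (by fun_prop) (by fun_prop))
    have hin : ∀ i t s y, memDbar T t s y → 0 < s → 0 < y → y < t → 0 < z i (t, s, y) →
        (t, s, y) ∈ C' := by
      intro i t s y h hs hy hyt hzp
      have h1 : η ≤ y ∧ η ≤ t - y := by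
        by_contra hne
        exact absurd (hzout t s y h hs hy hyt hne i) (not_le.2 hzp)
      refine ⟨⟨⟨h, ?_⟩, h1.1⟩, h1.2⟩
      by_contra hsN
      have h2 := hout t s y h hs hsN i
      have h3 : 0 < δ * ρ₂ (t, s, y) := by
        have : 0 < t - y := sub_pos.2 hyt
        simp only [hρ₂]; positivity
      simp only [hz] at hzp
      linarith
    have hzpos' : 0 < z i₁ (t', s₁, y') := by linarith
    have hP'bar : memDbar T t' s₁ y' := ⟨Ioo_subset_Icc_self hP'.1, mem_Ici.2 (mem_Ioi.1 hP'.2.1).le,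
      Ioo_subset_Icc_self hP'.2.2⟩
    obtain ⟨i₂, ⟨t₂, s₂, y₂⟩, hP₂, hmax₂⟩ := exists_isMax_of_isCompact hC'comp z
      (fun i => by
        apply ContinuousOn.sub ((hvc i).mono fun p hp => hCsub hp.1.1)
        apply ContinuousOn.mul (by fun_prop)
        apply ContinuousOn.add
        · exact ContinuousOn.inv₀ (by fun_prop) fun p hp => (hη0.trans_le hp.1.2).ne'
        · exact ContinuousOn.inv₀ (by fun_prop) fun p hp => (hη0.trans_le hp.2).ne')
      ⟨_, hin i₁ t' s₁ y' hP'bar hP'.2.1 hy' hP'.2.2.2 hzpos'⟩ i₁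
    have hz₂ : m - 2 * κ < z i₂ (t₂, s₂, y₂) := hz'.trans_le
      (hmax₂ i₁ _ (hin i₁ t' s₁ y' hP'bar hP'.2.1 hy' hP'.2.2.2 hzpos'))
    have hzpos₂ : 0 < z i₂ (t₂, s₂, y₂) := by linarith
    have hs₂ : 0 < s₂ := (hCsub hP₂.1.1).2
    have hy₂ : 0 < y₂ := hη0.trans_le hP₂.1.2
    have hyt₂ : y₂ < t₂ := by
      have : η ≤ t₂ - y₂ := hP₂.2
      linarith
    have hP₂bar : memDbar T t₂ s₂ y₂ := hP₂.1.1.1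
    have hρ₂2 : 0 < ρ₂ (t₂, s₂, y₂) := by
      have : 0 < t₂ - y₂ := sub_pos.2 hyt₂
      simp only [hρ₂]; positivity
    have hv₂ : z i₂ (t₂, s₂, y₂) ≤ v i₂ (t₂, s₂, y₂) := by
      have : 0 < δ * ρ₂ (t₂, s₂, y₂) := by positivity
      simp only [hz]; linarith
    have htT₂ : t₂ < T := by
      refine lt_of_le_of_ne hP₂bar.1.2 fun h => ?_
      subst h
      have h1 := hterm i₂ s₂ hs₂ y₂ ⟨hy₂.le, hyt₂.le⟩
      have h2 : 0 < v i₂ (t₂, s₂, y₂) := by linarith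
      simp only [hv, h1] at h2
      have h3 : 0 < ε * exp (-β * t₂) * (s₂ ^ 2 + s₂⁻¹) := by positivity
      linarith
    have hglob : ∀ t s y, 0 < s → 0 < y → y < t → t < T →
        z i₂ (t, s, y) ≤ z i₂ (t₂, s₂, y₂) := by
      intro t s y hs hy hyt htT
      have hmem : memDbar T t s y := ⟨⟨(hy.trans hyt).le, htT.le⟩, hs.le, hy.le, hyt.le⟩
      by_cases h : 0 < z i₂ (t, s, y)
      · exact hmax₂ i₂ _ (hin i₂ t s y hmem hs hy hyt h)
      · linarith
    have hD : ∀ s, 0 < s → memD T t₂ s y₂ := fun s hs =>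
      ⟨⟨hy₂.trans hyt₂, htT₂⟩, hs, hy₂, hyt₂⟩
    have hzeq : ∀ t s y, w t s i₂ y - (ε * exp (-β * t) * (s ^ 2 + s⁻¹) +
        δ * (y⁻¹ + (t - y)⁻¹)) = z i₂ (t, s, y) := by
      intro t s y; simp only [hz, hv, hρ₂]; ring
    have hdd := hdiff i₂ t₂ s₂ y₂ (hD s₂ hs₂)
    refine no_interior_max (m := m) (fun j hj => hnn i₂ j hj y₂ hy₂) (hbound i₂ y₂ hy₂) (hr i₂)
      (hR i₂) (hB i₂ t₂ hP₂bar.1) hε hδ0 hκ0.le htT₂ hs₂ hy₂ hyt₂ hdd.1 ?_ hdd.2.2.1 hdd.2.2.2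
      (hpde i₂ t₂ s₂ y₂ (hD s₂ hs₂)) ?_ ?_ ?_ ?_ ?_ hκm hκc
    · filter_upwards [lt_mem_nhds hs₂] with x hx using (hdiff i₂ t₂ x y₂ (hD x hx)).2.1
    · filter_upwards [lt_mem_nhds hyt₂, gt_mem_nhds htT₂] with u h1 h2
      rw [← hβ, hzeq, hzeq]; exact hglob _ _ _ hs₂ hy₂ h1 h2
    · filter_upwards [lt_mem_nhds hs₂] with x hx
      rw [← hβ, hzeq, hzeq]; exact hglob _ _ _ hx hy₂ hyt₂ htT₂
    · filter_upwards [lt_mem_nhds hy₂, gt_mem_nhds hyt₂] with u h1 h2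
      rw [← hβ, hzeq, hzeq]; exact hglob _ _ _ hs₂ h1 h2 htT₂
    · intro j
      exact hmall t₂ s₂ 0 ⟨hP₂bar.1, hP₂bar.2.1, le_rfl, hP₂bar.1.1⟩ hs₂ j
    · have : m - 2 * κ ≤ v i₂ (t₂, s₂, y₂) := by linarith
      exact this
  -- let the perturbation vanish, then `s` tend to zero
  have hposs : ∀ t s y, memDbar T t s y → 0 < s → ∀ i, w t s i y ≤ 0 := by
    intro t s y h hs i
    have h1 : Tendsto (fun ε : ℝ => w t s i y - ε * exp (-β * t) * (s ^ 2 + s⁻¹))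
        (nhdsWithin 0 (Ioi 0)) (nhds (w t s i y - 0 * exp (-β * t) * (s ^ 2 + s⁻¹))) := by
      apply tendsto_nhdsWithin_of_tendsto_nhds
      apply Continuous.tendsto (f := fun ε : ℝ => w t s i y - ε * exp (-β * t) * (s ^ 2 + s⁻¹))
      fun_prop
    have h2 := le_of_tendsto h1 (by
      filter_upwards [self_mem_nhdsWithin] with ε hε using key ε hε t s y h hs i)
    simpa using h2
  rcases eq_or_lt_of_le (show 0 ≤ s from hp.2.1) with h | h
  · subst h
    have h1 : ContinuousWithinAt (fun x : ℝ => w t x i y) (Ici 0) 0 := by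
      have : ContinuousOn (fun x : ℝ => w t x i y) (Ici 0) :=
        (hcont i).comp (f := fun x : ℝ => (t, x, y)) (by fun_prop) fun x hx => ⟨hp.1, hx, hp.2.2⟩
      exact this 0 (by simp)
    have h2 : Tendsto (fun x : ℝ => w t x i y) (nhdsWithin 0 (Ioi 0)) (nhds (w t 0 i y)) :=
      h1.mono_left (nhdsWithin_mono _ Ioi_subset_Ici_self)
    refine le_of_tendsto h2 ?_
    filter_upwards [self_mem_nhdsWithin] with x hx
    exact hposs t x y ⟨hp.1, (show (0:ℝ) < x from hx).le, hp.2.2⟩ hx i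
  · exact hposs t s y hp h i

theorem isPSolution.sub {k : ℕ} {lam : Fin k → Fin k → ℝ → ℝ} {r : Fin k → ℝ}
    {σ : ℝ → Fin k → ℝ} {K : ℝ → ℝ} {T : ℝ} {φ ψ : ℝ → ℝ → Fin k → ℝ → ℝ}
    (hφ : isPSolution lam r σ K T φ) (hψ : isPSolution lam r σ K T ψ) :
    isPSolution lam r σ (fun _ => 0) T (fun t s i y => φ t s i y - ψ t s i y) := by
  obtain ⟨a1, a2, a3, a4⟩ := hφ
  obtain ⟨b1, b2, b3, b4⟩ := hψ
  have hd : ∀ i t s y, memD T t s y → deriv (fun x => φ t x i y - ψ t x i y) =ᶠ[nhds s]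
      fun x => deriv (fun x => φ t x i y) x - deriv (fun x => ψ t x i y) x := by
    intro i t s y h
    filter_upwards [lt_mem_nhds (mem_Ioi.1 h.2.1)] with x hx
    exact ((a2 i t x y ⟨h.1, hx, h.2.2⟩).2.1.hasDerivAt.sub
      (b2 i t x y ⟨h.1, hx, h.2.2⟩).2.1.hasDerivAt).deriv
  refine ⟨fun i => (a1 i).sub (b1 i), fun i t s y h => ?_, fun i t s y h => ?_,
    fun i s hs y hy => by simp only [a4 i s hs y hy, b4 i s hs y hy, sub_self]⟩
  · obtain ⟨c1, c2, c3, c4⟩ := a2 i t s y h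
    obtain ⟨d1, d2, d3, d4⟩ := b2 i t s y h
    exact ⟨c1.sub d1, c2.sub d2, (c3.sub d3).congr_of_eventuallyEq (hd i t s y h), c4.sub d4⟩
  · obtain ⟨c1, c2, c3, c4⟩ := a2 i t s y h
    obtain ⟨d1, d2, d3, d4⟩ := b2 i t s y h
    have e1 : deriv (fun u => φ u s i y - ψ u s i y) t = _ := (c1.hasDerivAt.sub d1.hasDerivAt).deriv
    have e2 : deriv (fun v => φ t s i v - ψ t s i v) y = _ := (c4.hasDerivAt.sub d4.hasDerivAt).deriv
    have e3 : deriv (fun x => φ t x i y - ψ t x i y) s = _ := (c2.hasDerivAt.sub d2.hasDerivAt).deriv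
    have e4 : deriv (deriv (fun x => φ t x i y - ψ t x i y)) s = _ :=
      (hd i t s y h).deriv_eq.trans (c3.hasDerivAt.sub d3.hasDerivAt).deriv
    have e5 : ∑ j ∈ Finset.univ.filter (fun j => j ≠ i),
          lam i j y * ((φ t s j 0 - ψ t s j 0) - (φ t s i y - ψ t s i y)) =
        ∑ j ∈ Finset.univ.filter (fun j => j ≠ i), lam i j y * (φ t s j 0 - φ t s i y) -
        ∑ j ∈ Finset.univ.filter (fun j => j ≠ i), lam i j y * (ψ t s j 0 - ψ t s i y) := by
      rw [← Finset.sum_sub_distrib]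
      exact Finset.sum_congr rfl fun j _ => by ring
    rw [e1, e2, e3, e4, e5]
    linear_combination a3 i t s y h - b3 i t s y h

theorem linGrowth.sub {k : ℕ} {T : ℝ} {φ ψ : ℝ → ℝ → Fin k → ℝ → ℝ}
    (hφ : linGrowth T φ) (hψ : linGrowth T ψ) :
    linGrowth T (fun t s i y => φ t s i y - ψ t s i y) := by
  obtain ⟨M, hM⟩ := hφ
  obtain ⟨N, hN⟩ := hψ
  refine ⟨M + N, fun t s y h i => ?_⟩
  calc _ ≤ |φ t s i y| + |ψ t s i y| := abs_sub _ _
    _ ≤ M * (1 + s) + N * (1 + s) := add_le_add (hM t s y h i) (hN t s y h i)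
    _ = (M + N) * (1 + s) := by ring

/-- Jump and drift data of a semi-Markov switched transport equation on the time interval
`(-∞, T]`, together with a family of boxes containing the displacements still to come. -/
structure TransportData (k : ℕ) where
  T : ℝ
  T_pos : 0 < T
  c : ℝ
  c_pos : 0 < c
  n : Fin k → Fin k → ℝ → ℝ
  n_meas : ∀ i j, Measurable (n i j)
  n_nonneg : ∀ i j w, 0 ≤ n i j w
  n_sum_le : ∀ i w, ∑ j, n i j w ≤ c
  n_cont : ∀ i j y, 0 < y → ContinuousAt (n i j) y
  S : Fin k → ℝ → ℝ
  S_pos : ∀ i y, 0 < S i y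
  S_zero : ∀ i, S i 0 = 1
  S_cont : ∀ i, Continuous (S i)
  S_balance : ∀ i, ∀ y ∈ Icc 0 T, (∫ w in y..T, ∑ j, n i j w) = S i y - S i T
  S_deriv : ∀ i y, 0 < y → HasDerivAt (S i) (-∑ j, n i j y) y
  Q : Fin k → ℝ → ℝ × ℝ
  L : ℝ≥0
  Q_lip : ∀ i, LipschitzWith L (Q i)
  Q_const : ∀ i t, T ≤ t → Q i t = Q i T
  Q_diff : ∀ i t, t ≠ T → DifferentiableAt ℝ (Q i) t
  box : ℝ → Set (ℝ × ℝ)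
  box_zero : ∀ t, T ≤ t → 0 ∈ box t
  box_add : ∀ i t t' ζ, t ≤ t' → ζ ∈ box t' → Q i t' - Q i t + ζ ∈ box t

theorem abs_integral_le_of_exp_bound {g : ℝ → ℝ} {y T B μ : ℝ} (hyT : y ≤ T) (hμ : 0 < μ)
    (hg : ∀ w ∈ Ioc y T, |g w| ≤ B * exp (-μ * (w - y))) (hB : 0 ≤ B) :
    |∫ w in y..T, g w| ≤ B / μ := by
  have hd : ∀ w, HasDerivAt (fun w => -(B / μ) * exp (-μ * (w - y))) (B * exp (-μ * (w - y))) w := by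
    intro w
    have := ((((hasDerivAt_id w).sub_const y).const_mul (-μ)).exp).const_mul (-(B / μ))
    refine this.congr_deriv ?_
    simp only [id]; field_simp
  have hc : Continuous fun w => B * exp (-μ * (w - y)) := by fun_prop
  have h := intervalIntegral.norm_integral_le_of_norm_le (μ := volume) hyT
    (f := g) (g := fun w => B * exp (-μ * (w - y)))
    (ae_of_all _ fun w hw => hg w hw) (hc.intervalIntegrable _ _)
  rw [intervalIntegral.integral_eq_sub_of_hasDerivAt (fun w _ => hd w)
    (hc.intervalIntegrable _ _)] at h
  refine h.trans ?_
  have : 0 ≤ B / μ * exp (-μ * (T - y)) := by positivity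
  simp only [sub_self, mul_zero, exp_zero, mul_one]
  linarith

namespace TransportData

variable {k : ℕ} (d : TransportData k)

/-- The state reached from `p` by drifting in regime `i` during time `v`. -/
noncomputable def flow (i : Fin k) (v : ℝ) (p : ℝ × ℝ × ℝ) : ℝ × ℝ × ℝ :=
  (p.1 + v, p.2 + d.Q i (p.1 + v) - d.Q i p.1)

noncomputable def rate (f : Fin k → ℝ × ℝ × ℝ → ℝ) (i : Fin k) (w : ℝ) (p : ℝ × ℝ × ℝ) : ℝ :=
  ∑ j, d.n i j w * f j p

/-- Contribution of the paths which leave regime `i` at an age between `y` and `T`. -/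
noncomputable def jump (f : Fin k → ℝ × ℝ × ℝ → ℝ) (i : Fin k) (y : ℝ) (p : ℝ × ℝ × ℝ) : ℝ :=
  ∫ w in y..d.T, d.rate f i w (d.flow i (w - y) p)

/-- Contribution of the paths which stay in regime `i`. -/
noncomputable def stay (h : ℝ × ℝ → ℝ) (i : Fin k) (p : ℝ × ℝ × ℝ) : ℝ :=
  d.S i d.T * h (p.2 + d.Q i d.T - d.Q i p.1)

/-- Terms of the Neumann series of the renewal equation. -/
noncomputable def term (h : ℝ × ℝ → ℝ) : ℕ → Fin k → ℝ × ℝ × ℝ → ℝ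
  | 0 => fun i p => d.jump (fun _ p => h p.2) i 0 p + d.stay h i p - h p.2
  | m + 1 => fun i p => d.jump (term h m) i 0 p

/-- The solution of the renewal equation at age zero. -/
noncomputable def val (h : ℝ × ℝ → ℝ) (j : Fin k) (p : ℝ × ℝ × ℝ) : ℝ :=
  h p.2 + ∑' m, d.term h m j p

/-- The solution of the renewal equation. -/
noncomputable def sol (h : ℝ × ℝ → ℝ) (i : Fin k) (y : ℝ) (p : ℝ × ℝ × ℝ) : ℝ :=
  (d.jump (d.val h) i y p + d.stay h i p) / d.S i y

theorem Q_continuous (i : Fin k) : Continuous (d.Q i) := (d.Q_lip i).continuous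

@[fun_prop]
theorem Q_continuous_comp {X : Type*} [TopologicalSpace X] (i : Fin k) {g : X → ℝ}
    (hg : Continuous g) : Continuous fun x => d.Q i (g x) := (d.Q_continuous i).comp hg

@[fun_prop]
theorem flow_continuous {X : Type*} [TopologicalSpace X] (i : Fin k) {v : X → ℝ}
    {p : X → ℝ × ℝ × ℝ} (hv : Continuous v) (hp : Continuous p) :
    Continuous fun x => d.flow i (v x) (p x) := by
  unfold flow; fun_prop

theorem rate_measurable {f : Fin k → ℝ × ℝ × ℝ → ℝ} (hf : ∀ j, Continuous (f j)) (i : Fin k)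
    (y : ℝ) (p : ℝ × ℝ × ℝ) : Measurable fun w => d.rate f i w (d.flow i (w - y) p) := by
  unfold rate
  refine Finset.measurable_sum _ fun j _ => (d.n_meas i j).mul ?_
  have := hf j
  exact Continuous.measurable (by fun_prop)

theorem abs_rate_le {f : Fin k → ℝ × ℝ × ℝ → ℝ} {M : ℝ} {p : ℝ × ℝ × ℝ}
    (hf : ∀ j, |f j p| ≤ M) (i : Fin k) (w : ℝ) : |d.rate f i w p| ≤ M * ∑ j, d.n i j w := by
  unfold rate
  refine (Finset.abs_sum_le_sum_abs _ _).trans ?_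
  rw [Finset.mul_sum]
  refine Finset.sum_le_sum fun j _ => ?_
  rw [abs_mul, abs_of_nonneg (d.n_nonneg i j w), mul_comm]
  exact mul_le_mul_of_nonneg_right (hf j) (d.n_nonneg i j w)

theorem abs_rate_le' {f : Fin k → ℝ × ℝ × ℝ → ℝ} {M : ℝ} {p : ℝ × ℝ × ℝ}
    (hf : ∀ j, |f j p| ≤ M) (i : Fin k) (w : ℝ) : |d.rate f i w p| ≤ M * d.c :=
  (d.abs_rate_le hf i w).trans
    (mul_le_mul_of_nonneg_left (d.n_sum_le i w) ((abs_nonneg _).trans (hf i)))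

theorem n_sum_measurable (i : Fin k) : Measurable fun w => ∑ j, d.n i j w :=
  Finset.measurable_sum _ fun j _ => d.n_meas i j

theorem n_sum_nonneg (i : Fin k) (w : ℝ) : 0 ≤ ∑ j, d.n i j w :=
  Finset.sum_nonneg fun j _ => d.n_nonneg i j w

theorem n_sum_integrable (i : Fin k) (a b : ℝ) :
    IntervalIntegrable (fun w => ∑ j, d.n i j w) volume a b := by
  refine (intervalIntegrable_const (c := d.c)).mono_fun
    (d.n_sum_measurable i).aestronglyMeasurable (ae_of_all _ fun w => ?_)
  exact (norm_of_nonneg (d.n_sum_nonneg i w)).trans_le ((d.n_sum_le i w).trans (le_abs_self _))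

theorem rate_integrable {f : Fin k → ℝ × ℝ × ℝ → ℝ} (hf : ∀ j, Continuous (f j)) {M : ℝ}
    (hM : ∀ j p, |f j p| ≤ M) (i : Fin k) (y a b : ℝ) (p : ℝ × ℝ × ℝ) :
    IntervalIntegrable (fun w => d.rate f i w (d.flow i (w - y) p)) volume a b := by
  refine (intervalIntegrable_const (c := M * d.c)).mono_fun
    (d.rate_measurable hf i y p).aestronglyMeasurable (ae_of_all _ fun w => ?_)
  exact (d.abs_rate_le' (fun j => hM j _) i w).trans (le_abs_self _)

theorem zero_mem : (0:ℝ) ∈ Icc 0 d.T := ⟨le_rfl, d.T_pos.le⟩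

/-- A Lipschitz constant for the flow. -/
noncomputable def C : ℝ := 1 + 2 * d.L

theorem one_le_C : 1 ≤ d.C := by unfold C; have := d.L.2; linarith [show (0:ℝ) ≤ d.L from this]

noncomputable def mu : ℝ := 2 * d.c * d.C

theorem mu_pos : 0 < d.mu := by
  have := d.one_le_C; have := d.c_pos; unfold mu; positivity

/-- A time weight for which the jump operator at age zero is a contraction. -/
noncomputable def wt (t : ℝ) : ℝ := exp (d.mu * (d.T - t))

theorem wt_pos (t : ℝ) : 0 < d.wt t := exp_pos _

theorem wt_add (t v : ℝ) : d.wt (t + v) = d.wt t * exp (-d.mu * v) := by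
  unfold wt; rw [← exp_add]; congr 1; ring

theorem wt_anti {s t : ℝ} (h : s ≤ t) : d.wt t ≤ d.wt s := by
  unfold wt
  have := d.mu_pos
  gcongr

theorem jump_continuous {f : Fin k → ℝ × ℝ × ℝ → ℝ} (hf : ∀ j, Continuous (f j)) {M : ℝ}
    (hM : ∀ j p, |f j p| ≤ M) (i : Fin k) :
    Continuous fun q : ℝ × ℝ × ℝ × ℝ => d.jump f i q.1 q.2 := by
  have key : ∀ q₀ : ℝ × ℝ × ℝ × ℝ, ContinuousAt (fun q : (ℝ × ℝ × ℝ × ℝ) × ℝ =>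
      ∫ w in d.T..q.2, d.rate f i w (d.flow i (w - q.1.1) q.1.2)) (q₀, q₀.1) := by
    intro q₀
    refine intervalIntegral.continuousAt_parametric_primitive_of_dominated
      (F := fun (x : ℝ × ℝ × ℝ × ℝ) w => d.rate f i w (d.flow i (w - x.1) x.2))
      (fun _ => M * d.c) (min d.T q₀.1 - 1) (max d.T q₀.1 + 1)
      (fun x => (d.rate_measurable hf i _ _).aestronglyMeasurable)
      (Eventually.of_forall fun x => ae_of_all _ fun w => d.abs_rate_le' (fun j => hM j _) i w)
      intervalIntegrable_const (ae_of_all _ fun w => ?_) ?_ ?_ (by simp)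
    · unfold rate
      refine Continuous.continuousAt (continuous_finsetSum _ fun j _ => ?_)
      have := hf j
      fun_prop
    · exact ⟨by linarith [min_le_left d.T q₀.1], by linarith [le_max_left d.T q₀.1]⟩
    · exact ⟨by linarith [min_le_right d.T q₀.1], by linarith [le_max_right d.T q₀.1]⟩
  rw [continuous_iff_continuousAt]
  intro q₀
  have h2 : ContinuousAt (fun q : ℝ × ℝ × ℝ × ℝ => (q, q.1)) q₀ := by fun_prop
  have := (ContinuousAt.comp (f := fun q : ℝ × ℝ × ℝ × ℝ => (q, q.1)) (key q₀) h2).neg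
  refine this.congr (Eventually.of_forall fun q => ?_)
  simp only [jump]
  rw [intervalIntegral.integral_symm]; simp

theorem stay_continuous {h : ℝ × ℝ → ℝ} (hh : Continuous h) (i : Fin k) :
    Continuous (d.stay h i) := by
  unfold stay; fun_prop

theorem abs_stay_le {h : ℝ × ℝ → ℝ} {M : ℝ} (hM : ∀ z, |h z| ≤ M) (i : Fin k) (p : ℝ × ℝ × ℝ) :
    |d.stay h i p| ≤ M * d.S i d.T := by
  unfold stay
  rw [abs_mul, abs_of_pos (d.S_pos i _), mul_comm]
  exact mul_le_mul_of_nonneg_right (hM _) (d.S_pos i _).le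

end TransportData

namespace TransportData

variable {k : ℕ} (d : TransportData k)

theorem abs_integral_n_le {e : Fin k → ℝ → ℝ} {M N y t : ℝ} {i : Fin k} (hy : y ∈ Icc 0 d.T)
    (hN : 0 ≤ N) (he : ∀ w ∈ Icc y d.T, ∀ j, |e j w| ≤ M + N * d.wt (t + (w - y))) :
    |∫ w in y..d.T, ∑ j, d.n i j w * e j w| ≤ M * (d.S i y - d.S i d.T) + N / (2 * d.C) * d.wt t := by
  have hc := d.c_pos
  have hC := d.one_le_C
  have hw := d.wt_pos t
  have hi1 := (d.n_sum_integrable i y d.T).const_mul M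
  have hi2 : IntervalIntegrable (fun w => N * d.wt t * d.c * exp (-d.mu * (w - y))) volume y d.T :=
    Continuous.intervalIntegrable (by fun_prop) _ _
  have h1 : |∫ w in y..d.T, N * d.wt t * d.c * exp (-d.mu * (w - y))| ≤ N / (2 * d.C) * d.wt t := by
    refine (abs_integral_le_of_exp_bound (B := N * d.wt t * d.c) hy.2 d.mu_pos (fun w _ => ?_)
      (by positivity)).trans ?_
    · rw [abs_of_nonneg (by positivity)]
    · unfold mu
      rw [div_le_iff₀ (by positivity)]
      apply le_of_eq
      field_simp
  refine (intervalIntegral.norm_integral_le_of_norm_le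
    (f := fun w => ∑ j, d.n i j w * e j w) hy.2 (ae_of_all _ fun w hw => ?_) (hi1.add hi2)).trans ?_
  · refine (d.abs_rate_le (f := fun j _ => e j w) (p := 0) (he w (Ioc_subset_Icc_self hw)) i w).trans ?_
    rw [d.wt_add, add_mul]
    refine add_le_add_right ?_ _
    have : 0 ≤ N * (d.wt t * exp (-d.mu * (w - y))) := by positivity
    calc _ ≤ N * (d.wt t * exp (-d.mu * (w - y))) * d.c :=
        mul_le_mul_of_nonneg_left (d.n_sum_le i w) this
      _ = _ := by ring
  · rw [intervalIntegral.integral_add hi1 hi2, intervalIntegral.integral_const_mul,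
      d.S_balance i y hy]
    linarith [le_abs_self (∫ w in y..d.T, N * d.wt t * d.c * exp (-d.mu * (w - y)))]

theorem abs_jump_le_add {f : Fin k → ℝ × ℝ × ℝ → ℝ} {M N y : ℝ} {p : ℝ × ℝ × ℝ} {i : Fin k}
    (hy : y ∈ Icc 0 d.T) (hN : 0 ≤ N)
    (hf : ∀ w ∈ Icc y d.T, ∀ j, |f j (d.flow i (w - y) p)| ≤ M + N * d.wt (p.1 + (w - y))) :
    |d.jump f i y p| ≤ M * (d.S i y - d.S i d.T) + N / 2 * d.wt p.1 :=
by
  refine (d.abs_integral_n_le (e := fun j w => f j (d.flow i (w - y) p)) hy hN hf).trans ?_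
  have hw := d.wt_pos p.1
  have hC := d.one_le_C
  have : N / (2 * d.C) ≤ N / 2 := div_le_div_of_nonneg_left hN (by norm_num) (by linarith)
  nlinarith

theorem abs_jump_le {f : Fin k → ℝ × ℝ × ℝ → ℝ} {M y : ℝ} {p : ℝ × ℝ × ℝ} {i : Fin k}
    (hy : y ∈ Icc 0 d.T) (hf : ∀ w ∈ Icc y d.T, ∀ j, |f j (d.flow i (w - y) p)| ≤ M) :
    |d.jump f i y p| ≤ M * (d.S i y - d.S i d.T) := by
  simpa using d.abs_jump_le_add (N := 0) hy le_rfl (fun w hw j => by simpa using hf w hw j)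

theorem abs_jump_le_wt {f : Fin k → ℝ × ℝ × ℝ → ℝ} {M y : ℝ} (hM : 0 ≤ M) {p : ℝ × ℝ × ℝ}
    {i : Fin k} (hy : y ∈ Icc 0 d.T) (hf : ∀ j p, |f j p| ≤ M * d.wt p.1) :
    |d.jump f i y p| ≤ M / 2 * d.wt p.1 := by
  simpa using d.abs_jump_le_add (M := 0) hy hM (fun w _ j => by simpa [flow] using hf j (d.flow i (w - y) p))

theorem jump_add_mul {f g : Fin k → ℝ × ℝ × ℝ → ℝ} (hf : ∀ j, Continuous (f j))
    (hg : ∀ j, Continuous (g j)) {M N : ℝ} (hM : ∀ j p, |f j p| ≤ M) (hN : ∀ j p, |g j p| ≤ N)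
    (a : ℝ) (i : Fin k) (y : ℝ) (p : ℝ × ℝ × ℝ) :
    d.jump (fun j p => f j p + a * g j p) i y p = d.jump f i y p + a * d.jump g i y p := by
  unfold jump
  rw [← intervalIntegral.integral_const_mul, ← intervalIntegral.integral_add
    (d.rate_integrable hf hM i y _ _ p) ((d.rate_integrable hg hN i y _ _ p).const_mul a)]
  refine intervalIntegral.integral_congr fun w _ => ?_
  simp only [rate, Finset.mul_sum, ← Finset.sum_add_distrib]
  exact Finset.sum_congr rfl fun j _ => by ring

theorem flow_snd_of_ge {i : Fin k} {v : ℝ} {p : ℝ × ℝ × ℝ} (hp : d.T ≤ p.1) (hv : 0 ≤ v) :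
    (d.flow i v p).2 = p.2 := by
  simp only [flow]
  rw [d.Q_const i p.1 hp, d.Q_const i (p.1 + v) (by linarith)]; simp

theorem stay_of_ge (h : ℝ × ℝ → ℝ) {i : Fin k} {p : ℝ × ℝ × ℝ} (hp : d.T ≤ p.1) :
    d.stay h i p = d.S i d.T * h p.2 := by
  simp [stay, d.Q_const i p.1 hp]

theorem jump_of_ge {h : ℝ × ℝ → ℝ} {f : Fin k → ℝ × ℝ × ℝ → ℝ}
    (hf : ∀ j (q : ℝ × ℝ × ℝ), d.T ≤ q.1 → f j q = h q.2) {i : Fin k} {p : ℝ × ℝ × ℝ}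
    (hp : d.T ≤ p.1) {y : ℝ} (hy : y ∈ Icc 0 d.T) :
    d.jump f i y p = (d.S i y - d.S i d.T) * h p.2 := by
  rw [← d.S_balance i y hy, ← intervalIntegral.integral_mul_const]
  unfold jump
  refine intervalIntegral.integral_congr fun w hw => ?_
  rw [uIcc_of_le hy.2] at hw
  simp only [rate, Finset.sum_mul]
  refine Finset.sum_congr rfl fun j _ => ?_
  rw [hf j _ (by simp only [flow]; linarith [hw.1]), d.flow_snd_of_ge hp (by linarith [hw.1])]

theorem term_of_ge (h : ℝ × ℝ → ℝ) (m : ℕ) (i : Fin k) {p : ℝ × ℝ × ℝ} (hp : d.T ≤ p.1) :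
    d.term h m i p = 0 := by
  induction m generalizing i p with
  | zero =>
    simp only [term]
    rw [d.jump_of_ge (h := h) (fun _ _ _ => rfl) hp d.zero_mem, d.stay_of_ge h hp, d.S_zero]
    ring
  | succ m ih =>
    simp only [term]
    rw [d.jump_of_ge (h := 0) (fun j q hq => ih j hq) hp d.zero_mem]; simp

theorem val_of_ge (h : ℝ × ℝ → ℝ) (i : Fin k) {p : ℝ × ℝ × ℝ} (hp : d.T ≤ p.1) :
    d.val h i p = h p.2 := by
  simp [val, d.term_of_ge h _ i hp]

theorem sol_of_ge (h : ℝ × ℝ → ℝ) (i : Fin k) {p : ℝ × ℝ × ℝ} (hp : d.T ≤ p.1) {y : ℝ}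
    (hy : y ∈ Icc 0 d.T) : d.sol h i y p = h p.2 := by
  unfold sol
  rw [d.jump_of_ge (h := h) (fun j q hq => d.val_of_ge h j hq) hp hy, d.stay_of_ge h hp,
    div_eq_iff (d.S_pos i y).ne']
  ring

section Bounded

variable {h : ℝ × ℝ → ℝ} (hh : Continuous h) {H : ℝ} (hH : ∀ z, |h z| ≤ H)
include hh hH

theorem term_continuous_bounded (m : ℕ) (i : Fin k) :
    Continuous (d.term h m i) ∧ ∀ p, |d.term h m i p| ≤ 2 * H := by
  have hH0 : 0 ≤ H := (abs_nonneg _).trans (hH 0)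
  induction m generalizing i with
  | zero =>
    constructor
    · have h1 := d.jump_continuous (f := fun _ p => h p.2) (fun _ => by fun_prop)
        (fun _ p => hH p.2) i
      have h2 := d.stay_continuous hh i
      have h3 : Continuous fun p : ℝ × ℝ × ℝ => ((0:ℝ), p) := by fun_prop
      exact ((h1.comp h3).add h2).sub (by fun_prop)
    · intro p
      have h1 := d.abs_jump_le (f := fun _ p => h p.2) (i := i) (p := p) d.zero_mem
        (fun w _ j => hH _)
      rw [d.S_zero] at h1
      have h2 := d.abs_stay_le hH i p
      have h3 := hH p.2
      simp only [term]
      rw [abs_le] at *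
      constructor <;> linarith
  | succ m ih =>
    constructor
    · have h1 := d.jump_continuous (f := d.term h m) (fun j => (ih j).1) (fun j => (ih j).2) i
      exact h1.comp (by fun_prop : Continuous fun p : ℝ × ℝ × ℝ => ((0:ℝ), p))
    · intro p
      have h1 := d.abs_jump_le (f := d.term h m) (i := i) (p := p) d.zero_mem
        (fun w _ j => (ih j).2 _)
      rw [d.S_zero] at h1
      refine h1.trans ?_
      have := d.S_pos i d.T
      nlinarith

theorem term_abs_le (m : ℕ) (i : Fin k) (p : ℝ × ℝ × ℝ) :
    |d.term h m i p| ≤ 2 * H * (1 / 2) ^ m * d.wt p.1 := by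
  have hH0 : 0 ≤ H := (abs_nonneg _).trans (hH 0)
  induction m generalizing i p with
  | zero =>
    rcases le_or_gt d.T p.1 with ht | ht
    · rw [d.term_of_ge h 0 i ht]
      have := d.wt_pos p.1
      simp; positivity
    · refine ((d.term_continuous_bounded hh hH 0 i).2 p).trans ?_
      have : 1 ≤ d.wt p.1 := one_le_exp (by have := d.mu_pos; nlinarith)
      nlinarith
  | succ m ih =>
    refine (d.abs_jump_le_wt (by positivity) d.zero_mem fun j p => ih j p).trans (le_of_eq ?_)
    ring

theorem term_summable (i : Fin k) (p : ℝ × ℝ × ℝ) : Summable fun m => d.term h m i p := by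
  refine Summable.of_norm_bounded (g := fun m => 2 * H * (1 / 2) ^ m * d.wt p.1) ?_
    fun m => d.term_abs_le hh hH m i p
  exact ((summable_geometric_two).mul_left _).mul_right _

theorem val_continuous (i : Fin k) : Continuous (d.val h i) := by
  have hH0 : 0 ≤ H := (abs_nonneg _).trans (hH 0)
  refine Continuous.add (by fun_prop) (continuous_iff_continuousAt.2 fun p₀ => ?_)
  have ho : IsOpen {p : ℝ × ℝ × ℝ | p₀.1 - 1 < p.1} := isOpen_lt continuous_const continuous_fst
  refine ContinuousOn.continuousAt (s := {p : ℝ × ℝ × ℝ | p₀.1 - 1 < p.1})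
    (continuousOn_tsum (u := fun m => 2 * H * (1 / 2) ^ m * d.wt (p₀.1 - 1))
    (fun m => (d.term_continuous_bounded hh hH m i).1.continuousOn)
    (((summable_geometric_two).mul_left _).mul_right _) fun m p hp => ?_)
    (ho.mem_nhds (by simp))
  refine (d.term_abs_le hh hH m i p).trans ?_
  exact mul_le_mul_of_nonneg_left (d.wt_anti (le_of_lt hp)) (by positivity)

/-- Partial sums of the Neumann series are the Picard iterates. -/
theorem partial_succ (m : ℕ) (i : Fin k) (p : ℝ × ℝ × ℝ) :
    h p.2 + ∑ l ∈ Finset.range (m + 1), d.term h l i p =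
      d.jump (fun j p => h p.2 + ∑ l ∈ Finset.range m, d.term h l j p) i 0 p + d.stay h i p := by
  have hH0 : 0 ≤ H := (abs_nonneg _).trans (hH 0)
  induction m with
  | zero => simp [term]
  | succ m ih =>
    rw [Finset.sum_range_succ, ← add_assoc, ih]
    simp only [Finset.sum_range_succ _ m]
    have := d.jump_add_mul (f := fun j p => h p.2 + ∑ l ∈ Finset.range m, d.term h l j p)
      (g := d.term h m) (M := H + m * (2 * H)) (N := 2 * H)
      (fun j => Continuous.add (by fun_prop)
        (continuous_finsetSum _ fun l _ => (d.term_continuous_bounded hh hH l j).1))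
      (fun j => (d.term_continuous_bounded hh hH m j).1)
      (fun j p => (abs_add_le _ _).trans (add_le_add (hH _)
        ((Finset.abs_sum_le_sum_abs _ _).trans
          ((Finset.sum_le_sum fun l _ => (d.term_continuous_bounded hh hH l j).2 p).trans
            (by simp)))))
      (fun j => (d.term_continuous_bounded hh hH m j).2) 1 i 0 p
    simp only [one_mul] at this
    simp only [← add_assoc]
    rw [this]
    simp only [term]
    ring

theorem partial_abs_le (m : ℕ) (i : Fin k) (p : ℝ × ℝ × ℝ) {M : ℝ}
    (hM : ∀ ζ ∈ d.box p.1, |h (p.2 + ζ)| ≤ M) :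
    |h p.2 + ∑ l ∈ Finset.range m, d.term h l i p| ≤ M + H * (1 / 2) ^ m * d.wt p.1 := by
  have hH0 : 0 ≤ H := (abs_nonneg _).trans (hH 0)
  induction m generalizing i p with
  | zero =>
    simp only [Finset.range_zero, Finset.sum_empty, add_zero, pow_zero, mul_one]
    have hw := d.wt_pos p.1
    rcases le_or_gt d.T p.1 with ht | ht
    · have := hM 0 (d.box_zero _ ht)
      rw [add_zero] at this
      have : 0 ≤ H * d.wt p.1 := by positivity
      linarith
    · have h1 : 1 ≤ d.wt p.1 := one_le_exp (by have := d.mu_pos; nlinarith)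
      have h2 := (abs_nonneg _).trans (hM _ (d.box_add i p.1 d.T 0 ht.le (d.box_zero _ le_rfl)))
      nlinarith [hH p.2]
  | succ m ih =>
    rw [d.partial_succ hh hH]
    have h1 := d.abs_jump_le_add
      (f := fun j p => h p.2 + ∑ l ∈ Finset.range m, d.term h l j p) (i := i) (p := p)
      (M := M) (N := H * (1 / 2) ^ m) d.zero_mem (by positivity) (fun w hw j => by
        refine ih j (d.flow i (w - 0) p) fun ζ hζ => ?_
        have := hM _ (d.box_add i p.1 (p.1 + (w - 0)) ζ (by linarith [hw.1]) hζ)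
        convert! this using 3
        simp only [flow]; abel)
    have h2 : |d.stay h i p| ≤ M * d.S i d.T := by
      unfold stay
      rw [abs_mul, abs_of_pos (d.S_pos i _), mul_comm]
      refine mul_le_mul_of_nonneg_right ?_ (d.S_pos i _).le
      rcases le_or_gt d.T p.1 with ht | ht
      · have := hM 0 (d.box_zero _ ht)
        rwa [d.Q_const i _ ht, add_sub_cancel_right, ← add_zero p.2]
      · have := hM _ (d.box_add i p.1 d.T 0 ht.le (d.box_zero _ le_rfl))
        convert! this using 3
        abel
    rw [d.S_zero] at h1
    refine (abs_add_le _ _).trans ((add_le_add h1 h2).trans (le_of_eq ?_))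
    ring

theorem tendsto_partial (i : Fin k) (p : ℝ × ℝ × ℝ) :
    Tendsto (fun m : ℕ => h p.2 + ∑ l ∈ Finset.range m, d.term h l i p) atTop
      (𝓝 (d.val h i p)) :=
  ((d.term_summable hh hH i p).hasSum.tendsto_sum_nat).const_add _

theorem val_abs_le_box (i : Fin k) (p : ℝ × ℝ × ℝ) {M : ℝ}
    (hM : ∀ ζ ∈ d.box p.1, |h (p.2 + ζ)| ≤ M) : |d.val h i p| ≤ M := by
  have h1 := (d.tendsto_partial hh hH i p).abs
  have h2 : Tendsto (fun m : ℕ => M + H * (1 / 2 : ℝ) ^ m * d.wt p.1) atTop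
      (𝓝 (M + H * 0 * d.wt p.1)) :=
    (((tendsto_pow_atTop_nhds_zero_of_lt_one (by norm_num) (by norm_num)).const_mul H).mul_const
      _).const_add _
  have := le_of_tendsto_of_tendsto' h1 h2 fun m => d.partial_abs_le hh hH m i p hM
  simpa using this

theorem val_abs_le (i : Fin k) (p : ℝ × ℝ × ℝ) : |d.val h i p| ≤ H :=
  d.val_abs_le_box hh hH i p fun _ _ => hH _

/-- The renewal equation. -/
theorem val_eq (i : Fin k) (p : ℝ × ℝ × ℝ) :
    d.val h i p = d.jump (d.val h) i 0 p + d.stay h i p := by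
  have hH0 : 0 ≤ H := (abs_nonneg _).trans (hH 0)
  have h1 := (d.tendsto_partial hh hH i p).comp (tendsto_add_atTop_nat 1)
  refine tendsto_nhds_unique h1 ?_
  simp only [Function.comp_def, d.partial_succ hh hH]
  refine Tendsto.add_const _ ?_
  unfold jump
  refine intervalIntegral.tendsto_integral_filter_of_dominated_convergence
    (fun w => (H + H * d.wt p.1) * d.c)
    (Eventually.of_forall fun m => (d.rate_measurable (fun j => Continuous.add (by fun_prop)
        (continuous_finsetSum _ fun l _ => (d.term_continuous_bounded hh hH l j).1))
        i 0 p).aestronglyMeasurable)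
    (Eventually.of_forall fun m => ae_of_all _ fun w hw => ?_)
    intervalIntegrable_const (ae_of_all _ fun w hw => ?_)
  · rw [uIoc_of_le d.T_pos.le] at hw
    refine d.abs_rate_le' (fun j => (d.partial_abs_le hh hH m j _ fun _ _ => hH _).trans ?_) i w
    have h2 : d.wt (d.flow i (w - 0) p).1 ≤ d.wt p.1 := d.wt_anti (by simp [flow, hw.1.le])
    have h3 : (1 / 2 : ℝ) ^ m ≤ 1 := pow_le_one₀ (by norm_num) (by norm_num)
    have h4 := d.wt_pos (d.flow i (w - 0) p).1
    have : H * (1 / 2) ^ m ≤ H := by nlinarith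
    have := mul_le_mul this h2 h4.le hH0
    linarith
  · exact tendsto_finsetSum _ fun j _ => (d.tendsto_partial hh hH j _).const_mul _

theorem sol_zero (i : Fin k) (p : ℝ × ℝ × ℝ) : d.sol h i 0 p = d.val h i p := by
  rw [sol, d.S_zero, div_one, d.val_eq hh hH]

theorem sol_continuous (i : Fin k) : Continuous fun q : ℝ × ℝ × ℝ × ℝ => d.sol h i q.1 q.2 := by
  refine Continuous.div (((d.jump_continuous (fun j => d.val_continuous hh hH j)
    (fun j p => d.val_abs_le hh hH j p) i)).add ((d.stay_continuous hh i).comp continuous_snd))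
    ((d.S_cont i).comp continuous_fst) fun q => (d.S_pos i _).ne'

theorem sol_abs_le_box (i : Fin k) {y : ℝ} (hy : y ∈ Icc 0 d.T) (p : ℝ × ℝ × ℝ) {M : ℝ}
    (hM : ∀ ζ ∈ d.box p.1, |h (p.2 + ζ)| ≤ M) : |d.sol h i y p| ≤ M := by
  have h1 := d.abs_jump_le (f := d.val h) (i := i) (p := p) (M := M) hy (fun w hw j => by
    refine d.val_abs_le_box hh hH j _ fun ζ hζ => ?_
    have := hM _ (d.box_add i p.1 (p.1 + (w - y)) ζ (by linarith [hw.1]) hζ)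
    convert! this using 3
    simp only [flow]; abel)
  have h2 : |d.stay h i p| ≤ M * d.S i d.T := by
    unfold stay
    rw [abs_mul, abs_of_pos (d.S_pos i _), mul_comm]
    refine mul_le_mul_of_nonneg_right ?_ (d.S_pos i _).le
    rcases le_or_gt d.T p.1 with ht | ht
    · have := hM 0 (d.box_zero _ ht)
      rwa [d.Q_const i _ ht, add_sub_cancel_right, ← add_zero p.2]
    · have := hM _ (d.box_add i p.1 d.T 0 ht.le (d.box_zero _ le_rfl))
      convert! this using 3
      abel
  unfold sol
  rw [abs_div, abs_of_pos (d.S_pos i y), div_le_iff₀ (d.S_pos i y)]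
  refine (abs_add_le _ _).trans ((add_le_add h1 h2).trans (le_of_eq ?_))
  ring

end Bounded

theorem term_translate (h : ℝ × ℝ → ℝ) (z₀ : ℝ × ℝ) (m : ℕ) (i : Fin k) (p : ℝ × ℝ × ℝ) :
    d.term (fun z => h (z₀ + z)) m i p = d.term h m i (p.1, z₀ + p.2) := by
  induction m generalizing i p with
  | zero =>
    simp only [term, jump, rate, stay, flow]
    simp only [add_sub_assoc, add_assoc]
  | succ m ih =>
    simp only [term, jump, rate, ih]
    simp only [flow, add_sub_assoc, add_assoc]

theorem sol_translate (h : ℝ × ℝ → ℝ) (z₀ : ℝ × ℝ) (i : Fin k) (y : ℝ) (p : ℝ × ℝ × ℝ) :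
    d.sol (fun z => h (z₀ + z)) i y p = d.sol h i y (p.1, z₀ + p.2) := by
  simp only [sol, jump, rate, val, term_translate, stay]
  simp only [flow, add_sub_assoc, add_assoc]

theorem term_add_mul {h g : ℝ × ℝ → ℝ} (hh : Continuous h) (hg : Continuous g) {H G : ℝ}
    (hH : ∀ z, |h z| ≤ H) (hG : ∀ z, |g z| ≤ G) (a : ℝ) (m : ℕ) (i : Fin k) (p : ℝ × ℝ × ℝ) :
    d.term (fun z => h z + a * g z) m i p = d.term h m i p + a * d.term g m i p := by
  induction m generalizing i p with
  | zero =>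
    simp only [term]
    rw [d.jump_add_mul (f := fun _ p => h p.2) (g := fun _ p => g p.2) (fun _ => by fun_prop)
      (fun _ => by fun_prop) (fun _ p => hH p.2) (fun _ p => hG p.2)]
    simp only [stay]
    ring
  | succ m ih =>
    simp only [term]
    rw [← d.jump_add_mul (fun j => (d.term_continuous_bounded hh hH m j).1)
      (fun j => (d.term_continuous_bounded hg hG m j).1)
      (fun j => (d.term_continuous_bounded hh hH m j).2)
      (fun j => (d.term_continuous_bounded hg hG m j).2)]
    congr 1
    funext j p
    exact ih j p

theorem sol_add_mul {h g : ℝ × ℝ → ℝ} (hh : Continuous h) (hg : Continuous g) {H G : ℝ}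
    (hH : ∀ z, |h z| ≤ H) (hG : ∀ z, |g z| ≤ G) (a : ℝ) (i : Fin k) (y : ℝ) (p : ℝ × ℝ × ℝ) :
    d.sol (fun z => h z + a * g z) i y p = d.sol h i y p + a * d.sol g i y p := by
  have hv : d.val (fun z => h z + a * g z) = fun j p => d.val h j p + a * d.val g j p := by
    funext j p
    simp only [val, d.term_add_mul hh hg hH hG]
    rw [(d.term_summable hh hH j p).tsum_add ((d.term_summable hg hG j p).mul_left a),
      tsum_mul_left]
    ring
  simp only [sol, hv]
  rw [d.jump_add_mul (fun j => d.val_continuous hh hH j) (fun j => d.val_continuous hg hG j)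
    (fun j p => d.val_abs_le hh hH j p) (fun j p => d.val_abs_le hg hG j p)]
  simp only [stay]
  ring

end TransportData

/-- Fundamental theorem of calculus at a point for an integrand depending on the endpoint. -/
theorem hasDerivAt_integral_diag {g : ℝ → ℝ → ℝ} {y₀ : ℝ}
    (hg : ContinuousAt (Function.uncurry g) (y₀, y₀))
    (hi : ∀ y, IntervalIntegrable (g y) volume y₀ y) :
    HasDerivAt (fun y => ∫ w in y₀..y, g y w) (g y₀ y₀) y₀ := by
  rw [hasDerivAt_iff_isLittleO, Asymptotics.isLittleO_iff]
  intro ε hε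
  obtain ⟨δ, hδ, h⟩ := Metric.continuousAt_iff.1 hg ε hε
  filter_upwards [Metric.ball_mem_nhds y₀ hδ] with y hy
  have h1 : (∫ w in y₀..y, (g y w - g y₀ y₀)) = (∫ w in y₀..y, g y w) - (y - y₀) * g y₀ y₀ := by
    rw [intervalIntegral.integral_sub (hi y) intervalIntegrable_const]; simp
  simp only [intervalIntegral.integral_same, sub_zero, smul_eq_mul]
  rw [← h1]
  refine intervalIntegral.norm_integral_le_of_norm_le_const fun w hw => ?_
  have hw' : dist w y₀ < δ := by
    rw [Metric.mem_ball, Real.dist_eq] at hy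
    rw [Real.dist_eq]
    exact (abs_sub_left_of_mem_uIcc (uIoc_subset_uIcc hw)).trans_lt hy
  have := @h (y, w) (by rw [Prod.dist_eq]; exact max_lt hy hw')
  exact this.le

namespace TransportData

variable {k : ℕ} (d : TransportData k)

theorem flow_sub_norm_le (i : Fin k) (v : ℝ) (p q : ℝ × ℝ × ℝ) :
    ‖d.flow i v p - d.flow i v q‖ ≤ d.C * ‖p - q‖ := by
  have h1 : ‖d.flow i v p - d.flow i v q‖ = ‖((p - q) +
      (0, (d.Q i (p.1 + v) - d.Q i (q.1 + v)) - (d.Q i p.1 - d.Q i q.1)) : ℝ × ℝ × ℝ)‖ := by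
    congr 1
    refine Prod.ext ?_ ?_
    · simp [flow]
    · simp only [flow, Prod.snd_add, Prod.snd_sub]; abel
  have h2 : ‖d.Q i (p.1 + v) - d.Q i (q.1 + v)‖ ≤ d.L * ‖p - q‖ := by
    refine ((d.Q_lip i).norm_sub_le _ _).trans ?_
    rw [add_sub_add_right_eq_sub]
    exact mul_le_mul_of_nonneg_left (norm_fst_le (p - q)) d.L.2
  have h3 : ‖d.Q i p.1 - d.Q i q.1‖ ≤ d.L * ‖p - q‖ :=
    ((d.Q_lip i).norm_sub_le _ _).trans
      (mul_le_mul_of_nonneg_left (norm_fst_le (p - q)) d.L.2)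
  rw [h1]
  refine (norm_add_le _ _).trans ?_
  rw [show ‖((0, (d.Q i (p.1 + v) - d.Q i (q.1 + v)) - (d.Q i p.1 - d.Q i q.1)) : ℝ × ℝ × ℝ)‖ =
      ‖(d.Q i (p.1 + v) - d.Q i (q.1 + v)) - (d.Q i p.1 - d.Q i q.1)‖ by
    rw [Prod.norm_mk, norm_zero, max_eq_right (norm_nonneg _)] ]
  have := norm_sub_le (d.Q i (p.1 + v) - d.Q i (q.1 + v)) (d.Q i p.1 - d.Q i q.1)
  unfold C
  linarith

theorem jump_sub {f : Fin k → ℝ × ℝ × ℝ → ℝ} (hf : ∀ j, Continuous (f j)) {B : ℝ}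
    (hB : ∀ j p, |f j p| ≤ B) (i : Fin k) (y : ℝ) (p q : ℝ × ℝ × ℝ) :
    d.jump f i y p - d.jump f i y q = ∫ w in y..d.T, ∑ j, d.n i j w *
      (f j (d.flow i (w - y) p) - f j (d.flow i (w - y) q)) := by
  unfold jump
  rw [← intervalIntegral.integral_sub (d.rate_integrable hf hB i y _ _ p)
    (d.rate_integrable hf hB i y _ _ q)]
  refine intervalIntegral.integral_congr fun w _ => ?_
  simp only [rate, mul_sub, Finset.sum_sub_distrib]

section Lipschitz

variable {h : ℝ × ℝ → ℝ} {B : ℝ} (hB : ∀ z, |h z| ≤ B) {K : ℝ≥0} (hK : LipschitzWith K h)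
include hB hK

theorem term_lip (m : ℕ) (i : Fin k) (p q : ℝ × ℝ × ℝ) :
    |d.term h m i p - d.term h m i q| ≤
      2 * K * d.C * (1 / 2) ^ m * d.wt (min p.1 q.1) * ‖p - q‖ := by
  have hC := d.one_le_C
  have hK0 : (0:ℝ) ≤ K := K.2
  induction m generalizing i p q with
  | zero =>
    have hpq := norm_nonneg (p - q)
    rcases le_or_gt d.T (min p.1 q.1) with ht | ht
    · rw [d.term_of_ge h 0 i (ht.trans (min_le_left _ _)),
        d.term_of_ge h 0 i (ht.trans (min_le_right _ _))]
      have := d.wt_pos (min p.1 q.1)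
      simp only [sub_self, abs_zero]; positivity
    · have hw : 1 ≤ d.wt (min p.1 q.1) := one_le_exp (by have := d.mu_pos; nlinarith)
      have hsnd : ∀ v, |h (d.flow i v p).2 - h (d.flow i v q).2| ≤ K * d.C * ‖p - q‖ := by
        intro v
        refine (hK.norm_sub_le _ _).trans ?_
        rw [mul_assoc]
        exact mul_le_mul_of_nonneg_left ((norm_snd_le (d.flow i v p - d.flow i v q)).trans
          (d.flow_sub_norm_le i v p q)) hK0
      have h1 := d.abs_integral_n_le (i := i) (N := 0) (t := 0) d.zero_mem le_rfl
        (e := fun j w => h (d.flow i (w - 0) p).2 - h (d.flow i (w - 0) q).2)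
        (M := K * d.C * ‖p - q‖) (fun w _ j => by simpa using hsnd (w - 0))
      rw [← d.jump_sub (f := fun _ p => h p.2) (fun _ => hK.continuous.comp continuous_snd)
        (fun _ p => hB p.2), d.S_zero, zero_div, zero_mul, add_zero] at h1
      have h2 : |d.stay h i p - d.stay h i q| ≤ K * d.C * ‖p - q‖ * d.S i d.T := by
        have h3 : ‖(p.2 + d.Q i d.T - d.Q i p.1) - (q.2 + d.Q i d.T - d.Q i q.1)‖ ≤
            d.C * ‖p - q‖ := by
          have e : (p.2 + d.Q i d.T - d.Q i p.1) - (q.2 + d.Q i d.T - d.Q i q.1) =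
            (p - q).2 - (d.Q i p.1 - d.Q i q.1) := by simp only [Prod.snd_sub]; abel
          rw [e]
          have h4 : ‖d.Q i p.1 - d.Q i q.1‖ ≤ d.L * ‖p - q‖ :=
            ((d.Q_lip i).norm_sub_le _ _).trans
              (mul_le_mul_of_nonneg_left (norm_fst_le (p - q)) d.L.2)
          have h5 := norm_sub_le (p - q).2 (d.Q i p.1 - d.Q i q.1)
          have h6 := norm_snd_le (p - q)
          have h7 : (0:ℝ) ≤ d.L * ‖p - q‖ := mul_nonneg d.L.2 hpq
          unfold C
          linarith
        unfold stay
        rw [← mul_sub, abs_mul, abs_of_pos (d.S_pos i _), mul_comm]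
        refine mul_le_mul_of_nonneg_right ?_ (d.S_pos i _).le
        refine (hK.norm_sub_le _ _).trans ?_
        rw [mul_assoc]
        exact mul_le_mul_of_nonneg_left h3 hK0
      have h3 : |h p.2 - h q.2| ≤ K * d.C * ‖p - q‖ := by
        refine (hK.norm_sub_le _ _).trans ?_
        rw [mul_assoc]
        refine mul_le_mul_of_nonneg_left ((norm_snd_le (p - q)).trans ?_) hK0
        nlinarith
      have h4 : |d.term h 0 i p - d.term h 0 i q| ≤ 2 * (K * d.C * ‖p - q‖) := by
        simp only [term]
        rw [abs_le] at *
        constructor <;> linarith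
      refine h4.trans ?_
      have : 0 ≤ K * d.C * ‖p - q‖ := by positivity
      rw [pow_zero]
      nlinarith
  | succ m ih =>
    simp only [term]
    rw [d.jump_sub (fun j => (d.term_continuous_bounded hK.continuous hB m j).1)
      (fun j => (d.term_continuous_bounded hK.continuous hB m j).2)]
    have := d.abs_integral_n_le (i := i) (N := 2 * K * d.C * (1 / 2) ^ m * (d.C * ‖p - q‖))
      (t := min p.1 q.1) (M := 0) d.zero_mem (by positivity)
      (e := fun j w => d.term h m j (d.flow i (w - 0) p) - d.term h m j (d.flow i (w - 0) q))
      (fun w _ j => by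
        refine (ih j _ _).trans ?_
        have h1 : min (d.flow i (w - 0) p).1 (d.flow i (w - 0) q).1 = min p.1 q.1 + (w - 0) := by
          simp only [flow]; rw [min_add_add_right]
        rw [h1, zero_add]
        have h2 := d.flow_sub_norm_le i (w - 0) p q
        have h3 := d.wt_pos (min p.1 q.1 + (w - 0))
        calc _ ≤ 2 * K * d.C * (1 / 2) ^ m * d.wt (min p.1 q.1 + (w - 0)) * (d.C * ‖p - q‖) :=
            mul_le_mul_of_nonneg_left h2 (by positivity)
          _ = _ := by ring)
    refine this.trans (le_of_eq ?_)
    rw [zero_mul, zero_add, pow_succ]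
    field_simp

end Lipschitz
end TransportData

namespace TransportData

variable {k : ℕ} (d : TransportData k)

theorem flow_differentiableAt (i : Fin k) {v : ℝ} {p : ℝ × ℝ × ℝ} (h1 : p.1 ≠ d.T)
    (h2 : p.1 + v ≠ d.T) : DifferentiableAt ℝ (d.flow i v) p := by
  have e1 : DifferentiableAt ℝ (fun q : ℝ × ℝ × ℝ => q.1 + v) p := by fun_prop
  have e2 : DifferentiableAt ℝ (fun q : ℝ × ℝ × ℝ => d.Q i (q.1 + v)) p :=
    DifferentiableAt.comp (f := fun q : ℝ × ℝ × ℝ => q.1 + v) p (d.Q_diff i _ h2) e1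
  have e3 : DifferentiableAt ℝ (fun q : ℝ × ℝ × ℝ => d.Q i q.1) p :=
    DifferentiableAt.comp (f := fun q : ℝ × ℝ × ℝ => q.1) p (d.Q_diff i _ h1) differentiableAt_fst
  unfold flow
  fun_prop

theorem stay_differentiableAt {h : ℝ × ℝ → ℝ} (hh : Differentiable ℝ h) (i : Fin k)
    {p : ℝ × ℝ × ℝ} (h1 : p.1 ≠ d.T) : DifferentiableAt ℝ (d.stay h i) p := by
  have e3 : DifferentiableAt ℝ (fun q : ℝ × ℝ × ℝ => d.Q i q.1) p :=
    DifferentiableAt.comp (f := fun q : ℝ × ℝ × ℝ => q.1) p (d.Q_diff i _ h1) differentiableAt_fst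
  unfold stay
  fun_prop

theorem jump_differentiableAt {f : Fin k → ℝ × ℝ × ℝ → ℝ} (hf : ∀ j, Continuous (f j)) {B : ℝ}
    (hB : ∀ j p, |f j p| ≤ B)
    (hL : ∀ a, ∃ N : ℝ, ∀ j p q, a ≤ p.1 → a ≤ q.1 → |f j p - f j q| ≤ N * ‖p - q‖)
    (hd : ∀ j p, p.1 ≠ d.T → DifferentiableAt ℝ (f j) p) (i : Fin k) {y : ℝ} (hy : y ≤ d.T)
    {p : ℝ × ℝ × ℝ} (hp : p.1 ≠ d.T) : DifferentiableAt ℝ (d.jump f i y) p := by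
  obtain ⟨N, hN⟩ := hL (p.1 - 1)
  have hC := d.one_le_C
  let s : Set (ℝ × ℝ × ℝ) := {q | p.1 - 1 < q.1}
  have hs : s ∈ 𝓝 p := (isOpen_lt continuous_const continuous_fst).mem_nhds (by simp)
  have key : ∀ j w, w ∈ Ι y d.T → ∀ q ∈ s, ∀ q' ∈ s,
      |f j (d.flow i (w - y) q) - f j (d.flow i (w - y) q')| ≤ |N| * d.C * ‖q - q'‖ := by
    intro j w hw q hq q' hq'
    rw [uIoc_of_le hy] at hw
    have hw1 := hw.1
    have hq1 : p.1 - 1 < q.1 := hq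
    have hq1' : p.1 - 1 < q'.1 := hq'
    refine (hN j _ _ (by simp only [flow]; linarith) (by simp only [flow]; linarith)).trans ?_
    rw [mul_assoc]
    exact mul_le_mul (le_abs_self N) (d.flow_sub_norm_le i _ q q') (norm_nonneg _) (abs_nonneg _)
  refine (intervalIntegral.hasFDerivAt_integral_of_dominated_loc_of_lip (𝕜 := ℝ) (μ := volume)
    (F := fun q w => d.rate f i w (d.flow i (w - y) q))
    (F' := fun w => ∑ j, d.n i j w • fderiv ℝ (fun q => f j (d.flow i (w - y) q)) p)
    (s := s) (bound := fun _ => |N| * d.C * d.c) hs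
    (Eventually.of_forall fun q => (d.rate_measurable hf i y q).aestronglyMeasurable)
    (d.rate_integrable hf hB i y _ _ p) ?_ (ae_of_all _ fun w hw => ?_)
    intervalIntegrable_const ?_).2.differentiableAt
  · refine Measurable.aestronglyMeasurable (Finset.measurable_sum _ fun j _ => ?_)
    refine (d.n_meas i j).smul ?_
    have := hf j
    have hc : Continuous (Function.uncurry fun (w : ℝ) (q : ℝ × ℝ × ℝ) =>
        f j (d.flow i (w - y) q)) := by
      unfold Function.uncurry
      fun_prop
    exact (measurable_fderiv_with_param ℝ hc).comp (measurable_id.prodMk measurable_const)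
  · refine LipschitzOnWith.of_dist_le_mul fun q hq q' hq' => ?_
    have hpos : 0 ≤ |N| * d.C * d.c := by have := d.c_pos; positivity
    rw [Real.coe_nnabs, abs_of_nonneg hpos, dist_eq_norm, dist_eq_norm, Real.norm_eq_abs]
    have : d.rate f i w (d.flow i (w - y) q) - d.rate f i w (d.flow i (w - y) q') =
        d.rate (fun j _ => f j (d.flow i (w - y) q) - f j (d.flow i (w - y) q')) i w 0 := by
      simp only [rate, mul_sub, Finset.sum_sub_distrib]
    rw [this]
    refine (d.abs_rate_le' (fun j => key j w hw q hq q' hq') i w).trans (le_of_eq ?_)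
    ring
  · have : ∀ᵐ w ∂(volume : Measure ℝ), w ≠ d.T - p.1 + y := by
      simp [ae_iff]
    filter_upwards [this] with w hw _
    unfold rate
    refine HasFDerivAt.fun_sum fun j _ => ?_
    refine HasFDerivAt.const_mul (DifferentiableAt.hasFDerivAt ?_) _
    have h1 : (d.flow i (w - y) p).1 ≠ d.T := by
      simp only [flow]
      contrapose! hw
      linarith
    exact (hd j _ h1).comp p (d.flow_differentiableAt i hp h1)

section Lipschitz

variable {h : ℝ × ℝ → ℝ} (hd : Differentiable ℝ h) {B : ℝ} (hB : ∀ z, |h z| ≤ B) {K : ℝ≥0}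
  (hK : LipschitzWith K h)
include hB hK

theorem term_lip_above (m : ℕ) (a : ℝ) (j : Fin k) (p q : ℝ × ℝ × ℝ) (hp : a ≤ p.1)
    (hq : a ≤ q.1) :
    |d.term h m j p - d.term h m j q| ≤ 2 * K * d.C * (1 / 2) ^ m * d.wt a * ‖p - q‖ := by
  have := d.one_le_C
  refine (d.term_lip hB hK m j p q).trans ?_
  have := d.wt_anti (le_min hp hq)
  gcongr

theorem val_lip_above (a : ℝ) (j : Fin k) (p q : ℝ × ℝ × ℝ) (hp : a ≤ p.1) (hq : a ≤ q.1) :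
    |d.val h j p - d.val h j q| ≤ (K + 4 * K * d.C * d.wt a) * ‖p - q‖ := by
  have hc := hK.continuous
  unfold val
  have h1 : |h p.2 - h q.2| ≤ K * ‖p - q‖ := (hK.norm_sub_le _ _).trans
    (mul_le_mul_of_nonneg_left (norm_snd_le (p - q)) K.2)
  have hs : HasSum (fun m : ℕ => 2 * K * d.C * (1 / 2 : ℝ) ^ m * d.wt a * ‖p - q‖)
      (2 * K * d.C * 2 * d.wt a * ‖p - q‖) :=
    ((hasSum_geometric_two.mul_left _).mul_right _).mul_right _
  have h2 : |∑' m, d.term h m j p - ∑' m, d.term h m j q| ≤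
      2 * K * d.C * 2 * d.wt a * ‖p - q‖ := by
    rw [← (d.term_summable hc hB j p).tsum_sub (d.term_summable hc hB j q)]
    exact tsum_of_norm_bounded (f := fun m => d.term h m j p - d.term h m j q) hs fun m => d.term_lip_above hB hK m a j p q hp hq
  have e : h p.2 + ∑' m, d.term h m j p - (h q.2 + ∑' m, d.term h m j q) =
    (h p.2 - h q.2) + (∑' m, d.term h m j p - ∑' m, d.term h m j q) := by ring
  rw [e]
  refine (abs_add_le _ _).trans ((add_le_add h1 h2).trans (le_of_eq ?_))
  ring

include hd

theorem term_differentiableAt (m : ℕ) (i : Fin k) {p : ℝ × ℝ × ℝ} (hp : p.1 ≠ d.T) :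
    DifferentiableAt ℝ (d.term h m i) p := by
  have hc := hK.continuous
  induction m generalizing i p with
  | zero =>
    have h1 : DifferentiableAt ℝ (d.jump (fun _ p => h p.2) i 0) p := by
      refine d.jump_differentiableAt (fun _ => by fun_prop) (fun _ p => hB p.2)
        (fun a => ⟨K, fun j p q _ _ => ?_⟩) (fun _ p _ => by fun_prop) i d.T_pos.le hp
      exact (hK.norm_sub_le _ _).trans (mul_le_mul_of_nonneg_left (norm_snd_le (p - q)) K.2)
    exact (h1.add (d.stay_differentiableAt hd i hp)).sub (by fun_prop)
  | succ m ih =>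
    exact d.jump_differentiableAt (fun j => (d.term_continuous_bounded hc hB m j).1)
      (fun j => (d.term_continuous_bounded hc hB m j).2)
      (fun a => ⟨_, fun j p q => d.term_lip_above hB hK m a j p q⟩) (fun j p hp => ih j hp) i
      d.T_pos.le hp

theorem val_differentiableAt (i : Fin k) {p : ℝ × ℝ × ℝ} (hp : p.1 ≠ d.T) :
    DifferentiableAt ℝ (d.val h i) p := by
  have hc := hK.continuous
  have hC := d.one_le_C
  rcases lt_or_gt_of_ne hp with ht | ht
  · have ho : IsOpen {q : ℝ × ℝ × ℝ | p.1 - 1 < q.1 ∧ q.1 < d.T} :=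
      (isOpen_lt continuous_const continuous_fst).inter (isOpen_lt continuous_fst continuous_const)
    have hconv : Convex ℝ {q : ℝ × ℝ × ℝ | p.1 - 1 < q.1 ∧ q.1 < d.T} := by
      have : {q : ℝ × ℝ × ℝ | p.1 - 1 < q.1 ∧ q.1 < d.T} =
          (LinearMap.fst ℝ ℝ (ℝ × ℝ)) ⁻¹' (Ioo (p.1 - 1) d.T) := rfl
      rw [this]
      exact (convex_Ioo _ _).linear_preimage _
    have hmem : p ∈ {q : ℝ × ℝ × ℝ | p.1 - 1 < q.1 ∧ q.1 < d.T} := ⟨by linarith, ht⟩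
    refine DifferentiableAt.add (by fun_prop) (hasFDerivAt_tsum_of_isPreconnected (𝕜 := ℝ)
      (u := fun m : ℕ => 2 * K * d.C * (1 / 2 : ℝ) ^ m * d.wt (p.1 - 1))
      (((summable_geometric_two).mul_left _).mul_right _) ho hconv.isPreconnected
      (fun m q hq => (d.term_differentiableAt hd hB hK m i hq.2.ne).hasFDerivAt)
      (fun m q hq => ?_) hmem (d.term_summable hc hB i p) hmem).differentiableAt
    have hw := d.wt_pos (p.1 - 1)
    refine norm_fderiv_le_of_lip' ℝ (by positivity) ?_
    filter_upwards [ho.mem_nhds hq] with q' hq'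
    exact d.term_lip_above hB hK m _ i q' q hq'.1.le hq.1.le
  · have : d.val h i =ᶠ[𝓝 p] fun q => h q.2 := by
      filter_upwards [(isOpen_lt continuous_const continuous_fst).mem_nhds ht] with q hq
      exact d.val_of_ge h i (le_of_lt hq)
    exact DifferentiableAt.congr_of_eventuallyEq (by fun_prop) this

theorem jump_val_differentiableAt (i : Fin k) {y : ℝ} (hy : y ≤ d.T) {p : ℝ × ℝ × ℝ}
    (hp : p.1 ≠ d.T) : DifferentiableAt ℝ (d.jump (d.val h) i y) p :=
  d.jump_differentiableAt (fun j => d.val_continuous hK.continuous hB j)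
    (fun j p => d.val_abs_le hK.continuous hB j p)
    (fun a => ⟨_, fun j p q => d.val_lip_above hB hK a j p q⟩)
    (fun j _ hp => d.val_differentiableAt hd hB hK j hp) i hy hp

theorem sol_differentiableAt (i : Fin k) {y : ℝ} (hy : y ≤ d.T) {p : ℝ × ℝ × ℝ}
    (hp : p.1 ≠ d.T) : DifferentiableAt ℝ (d.sol h i y) p := by
  have h1 : DifferentiableAt ℝ (fun q => d.jump (d.val h) i y q + d.stay h i q) p :=
    (d.jump_val_differentiableAt hd hB hK i hy hp).add (d.stay_differentiableAt hd i hp)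
  have : d.sol h i y = fun q => (d.S i y)⁻¹ * (d.jump (d.val h) i y q + d.stay h i q) := by
    funext q; simp only [sol]; rw [div_eq_inv_mul]
  rw [this]
  exact h1.const_mul _

/-- The transport equation in the age variable. -/
theorem sol_hasDerivAt_age (i : Fin k) {y : ℝ} (hy : 0 < y) (hyT : y ≤ d.T) {p : ℝ × ℝ × ℝ}
    (hp : p.1 ≠ d.T) :
    HasDerivAt (fun y => d.sol h i y p) (-fderiv ℝ (d.sol h i y) p (1, deriv (d.Q i) p.1) -
      ∑ j, d.n i j y / d.S i y * (d.val h j p - d.sol h i y p)) y := by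
  have hc := hK.continuous
  have hvc := fun j => d.val_continuous hc hB j
  have hS := d.S_pos i y
  set W : ℝ × ℝ × ℝ → ℝ := fun q => d.jump (d.val h) i y q + d.stay h i q with hW
  have hWd : DifferentiableAt ℝ W p := (d.jump_val_differentiableAt hd hB hK i hyT hp).add
    (d.stay_differentiableAt hd i hp)
  have hγ : HasDerivAt (fun x => d.flow i (y - x) p) (-(1, deriv (d.Q i) p.1)) y := by
    have h1 : HasDerivAt (fun x => p.1 + (y - x)) (-1) y := by
      simpa using ((hasDerivAt_id y).const_sub y).const_add p.1
    have h2 : HasDerivAt (fun x => d.Q i (p.1 + (y - x))) ((-1 : ℝ) • deriv (d.Q i) p.1) y := by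
      refine HasDerivAt.scomp (h := fun x => p.1 + (y - x)) y ?_ h1
      simpa using (d.Q_diff i _ hp).hasDerivAt
    have h3 := h1.prodMk ((h2.const_add p.2).sub_const (d.Q i p.1))
    refine h3.congr_deriv ?_
    simp
  have hγ0 : d.flow i (y - y) p = p := by simp [flow]
  have hWγ : HasDerivAt (fun x => W (d.flow i (y - x) p))
      (-fderiv ℝ W p (1, deriv (d.Q i) p.1)) y := by
    have := HasFDerivAt.comp_hasDerivAt (f := fun x => d.flow i (y - x) p) (l := W) y
      (by rw [hγ0]; exact hWd.hasFDerivAt) hγ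
    refine this.congr_deriv ?_
    rw [map_neg]
  have hR : HasDerivAt (fun x => ∫ w in y..x, d.rate (d.val h) i w (d.flow i (w - x) p))
      (d.rate (d.val h) i y (d.flow i (y - y) p)) y := by
    refine hasDerivAt_integral_diag (g := fun x w => d.rate (d.val h) i w (d.flow i (w - x) p))
      ?_ fun x => d.rate_integrable hvc (fun j p => d.val_abs_le hc hB j p) i x _ _ p
    unfold Function.uncurry rate
    refine tendsto_finsetSum _ fun j _ => ?_
    refine ContinuousAt.mul ?_ ?_
    · exact ContinuousAt.comp (f := fun a : ℝ × ℝ => a.2) (d.n_cont i j y hy)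
        continuous_snd.continuousAt
    · have := hvc j
      exact Continuous.continuousAt (by fun_prop)
  have hflow : ∀ v x, d.flow i (v + x) p = d.flow i v (d.flow i x p) := by
    intro v x
    refine Prod.ext ?_ ?_
    · simp only [flow]; ring
    · simp only [flow]
      rw [show p.1 + (v + x) = p.1 + x + v by ring]; abel
  have hWeq : ∀ x, d.jump (d.val h) i x p + d.stay h i p = W (d.flow i (y - x) p) -
      ∫ w in y..x, d.rate (d.val h) i w (d.flow i (w - x) p) := by
    intro x
    have h1 : d.stay h i (d.flow i (y - x) p) = d.stay h i p := by
      simp only [stay, flow]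
      congr 2; abel
    have h2 : d.jump (d.val h) i y (d.flow i (y - x) p) =
        ∫ w in y..d.T, d.rate (d.val h) i w (d.flow i (w - x) p) := by
      unfold jump
      refine intervalIntegral.integral_congr fun w _ => ?_
      rw [← hflow, sub_add_sub_cancel]
    have h3 := fun a b => d.rate_integrable hvc (fun j p => d.val_abs_le hc hB j p) i x a b p
    have h4 := intervalIntegral.integral_add_adjacent_intervals (h3 y x) (h3 x d.T)
    simp only [hW]
    rw [h1, h2, ← h4]
    unfold jump
    ring
  have hnum := (hWγ.sub hR).div (d.S_deriv i y hy) hS.ne'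
  have hsol : (fun y => d.sol h i y p) = fun x => (W (d.flow i (y - x) p) -
      ∫ w in y..x, d.rate (d.val h) i w (d.flow i (w - x) p)) / d.S i x := by
    funext x
    rw [← hWeq x]; rfl
  rw [hsol]
  refine hnum.congr_deriv ?_
  have hfd : fderiv ℝ (d.sol h i y) p = (d.S i y)⁻¹ • fderiv ℝ W p := by
    have : d.sol h i y = fun q => (d.S i y)⁻¹ * W q := by
      funext q; simp only [sol, hW]; rw [div_eq_inv_mul]
    rw [this, fderiv_const_mul hWd]
  simp only [Pi.sub_apply]
  rw [hfd, ← hWeq y, hγ0]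
  simp only [_root_.smul_apply, smul_eq_mul, rate]
  have h5 : ∑ j, d.n i j y / d.S i y * (d.val h j p - d.sol h i y p) =
      (∑ j, d.n i j y * d.val h j p) / d.S i y -
        (∑ j, d.n i j y) / d.S i y * d.sol h i y p := by
    rw [Finset.sum_div, Finset.sum_div, Finset.sum_mul, ← Finset.sum_sub_distrib]
    exact Finset.sum_congr rfl fun j _ => by ring
  rw [h5]
  simp only [sol]
  field_simp
  ring

end Lipschitz
end TransportData

namespace TransportData

variable {k : ℕ} (d : TransportData k)

/-- If two terminal functions agree on the box, then so do the solutions. -/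
theorem sol_congr_box {h g : ℝ × ℝ → ℝ} (hh : Continuous h) (hg : Continuous g) {H G : ℝ}
    (hH : ∀ z, |h z| ≤ H) (hG : ∀ z, |g z| ≤ G) {i : Fin k} {y : ℝ} (hy : y ∈ Icc 0 d.T)
    {p : ℝ × ℝ × ℝ} (hhg : ∀ ζ ∈ d.box p.1, h (p.2 + ζ) = g (p.2 + ζ)) :
    d.sol h i y p = d.sol g i y p := by
  have h1 := d.sol_add_mul hh hg hH hG (-1) i y p
  have h2 := d.sol_abs_le_box (h := fun z => h z + -1 * g z) (H := H + G) (by fun_prop)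
    (fun z => by
      refine (abs_add_le _ _).trans (add_le_add (hH z) ?_)
      rw [abs_mul]; simpa using hG z) i hy p (M := 0)
    (fun ζ hζ => by rw [hhg ζ hζ]; simp)
  rw [h1] at h2
  have := abs_nonpos_iff.1 h2
  linarith

/-- Differences of solutions are controlled by the terminal functions on the box. -/
theorem sol_sub_abs_le {h g : ℝ × ℝ → ℝ} (hh : Continuous h) (hg : Continuous g) {H G : ℝ}
    (hH : ∀ z, |h z| ≤ H) (hG : ∀ z, |g z| ≤ G) {i : Fin k} {y : ℝ} (hy : y ∈ Icc 0 d.T)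
    {p : ℝ × ℝ × ℝ} {M : ℝ} (hM : ∀ ζ ∈ d.box p.1, |h (p.2 + ζ) - g (p.2 + ζ)| ≤ M) :
    |d.sol h i y p - d.sol g i y p| ≤ M := by
  have h1 := d.sol_add_mul hh hg hH hG (-1) i y p
  have h2 := d.sol_abs_le_box (h := fun z => h z + -1 * g z) (H := H + G) (by fun_prop)
    (fun z => by
      refine (abs_add_le _ _).trans (add_le_add (hH z) ?_)
      rw [abs_mul]; simpa using hG z) i hy p (M := M)
    (fun ζ hζ => by simpa [sub_eq_add_neg] using hM ζ hζ)
  rw [h1] at h2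
  simpa [sub_eq_add_neg] using h2

theorem sol_hasDerivAt_param {F F' : ℝ → ℝ × ℝ → ℝ} {τ₀ δ : ℝ} (hδ : 0 < δ)
    (hF : ∀ τ ∈ Metric.ball τ₀ δ, Continuous (F τ) ∧ ∃ H, ∀ z, |F τ z| ≤ H)
    (hF' : Continuous (F' τ₀) ∧ ∃ H, ∀ z, |F' τ₀ z| ≤ H)
    (hcont : ContinuousOn (Function.uncurry F') (Metric.ball τ₀ δ ×ˢ univ))
    (hd : ∀ τ ∈ Metric.ball τ₀ δ, ∀ z, HasDerivAt (fun τ => F τ z) (F' τ z) τ)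
    {i : Fin k} {y : ℝ} (hy : y ∈ Icc 0 d.T) {p : ℝ × ℝ × ℝ} {A : Set (ℝ × ℝ)}
    (hA : IsCompact A) (hbox : ∀ ζ ∈ d.box p.1, p.2 + ζ ∈ A) :
    HasDerivAt (fun τ => d.sol (F τ) i y p) (d.sol (F' τ₀) i y p) τ₀ := by
  have hτ₀ : τ₀ ∈ Metric.ball τ₀ δ := Metric.mem_ball_self hδ
  rw [hasDerivAt_iff_isLittleO, Asymptotics.isLittleO_iff]
  intro ε hε
  have hev : ∀ᶠ τ in 𝓝 τ₀, ∀ z ∈ A, |F' τ z - F' τ₀ z| < ε := by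
    refine hA.eventually_forall_of_forall_eventually fun z _ => ?_
    have h1 : ContinuousAt (Function.uncurry F') (τ₀, z) :=
      hcont.continuousAt (prod_mem_nhds (Metric.ball_mem_nhds _ hδ) univ_mem)
    have h2 : ContinuousAt (fun q : ℝ × ℝ × ℝ => |F' q.1 q.2 - F' τ₀ q.2|) (τ₀, z) := by
      refine ContinuousAt.abs (ContinuousAt.sub h1 ?_)
      exact (hF'.1.comp continuous_snd).continuousAt
    exact h2.eventually_lt_const (by simpa using hε)
  obtain ⟨η, hη, hball⟩ := Metric.eventually_nhds_iff_ball.1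
    (hev.and (Metric.ball_mem_nhds τ₀ hδ))
  filter_upwards [Metric.ball_mem_nhds τ₀ hη] with τ hτ
  obtain ⟨c1, H1, b1⟩ := hF τ (hball τ hτ).2
  obtain ⟨c2, H2, b2⟩ := hF τ₀ hτ₀
  obtain ⟨c3, H3, b3⟩ := hF'
  have b4 : ∀ z, |F τ₀ z + (τ - τ₀) * F' τ₀ z| ≤ H2 + |τ - τ₀| * H3 := fun z => by
    refine (abs_add_le _ _).trans (add_le_add (b2 z) ?_)
    rw [abs_mul]
    exact mul_le_mul_of_nonneg_left (b3 z) (abs_nonneg _)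
  have h1 := d.sol_sub_abs_le c1 (g := fun z => F τ₀ z + (τ - τ₀) * F' τ₀ z) (by fun_prop) b1 b4
    (i := i) hy (p := p) (M := ε * |τ - τ₀|) (fun ζ hζ => by
      set z := p.2 + ζ
      have hz := hbox ζ hζ
      have := (convex_ball τ₀ η).norm_image_sub_le_of_norm_hasDerivWithin_le
        (f := fun τ => F τ z - (τ - τ₀) * F' τ₀ z) (f' := fun τ => F' τ z - F' τ₀ z) (C := ε)
        (x := τ₀) (y := τ) (fun x hx => ?_) (fun x hx => ((hball x hx).1 z hz).le)
        (Metric.mem_ball_self hη) hτ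
      · simp only [sub_self, zero_mul, sub_zero, Real.norm_eq_abs] at this
        rwa [show F τ z - (F τ₀ z + (τ - τ₀) * F' τ₀ z) =
          F τ z - (τ - τ₀) * F' τ₀ z - F τ₀ z by ring]
      · have e1 := hd x (hball x hx).2 z
        have e2 := ((hasDerivAt_id x).sub_const τ₀).mul_const (F' τ₀ z)
        refine (HasDerivAt.congr_deriv (e1.sub e2) ?_).hasDerivWithinAt
        simp)
  rw [d.sol_add_mul c2 c3 b2 b3] at h1
  rw [smul_eq_mul, sub_sub]
  exact h1

section Equation

variable {h : ℝ × ℝ → ℝ} (hd : ContDiff ℝ 1 h) {B : ℝ} (hB : ∀ z, |h z| ≤ B) {K : ℝ≥0}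
  (hK : LipschitzWith K h)
include hd hB hK

/-- Translations of the terminal function translate the solution. -/
theorem fderiv_sol_space (i : Fin k) {y : ℝ} (hy : y ∈ Icc 0 d.T) {p : ℝ × ℝ × ℝ}
    (hp : p.1 ≠ d.T) {A : Set (ℝ × ℝ)} (hA : IsCompact A)
    (hbox : ∀ ζ ∈ d.box p.1, p.2 + ζ ∈ A) (e : ℝ × ℝ) :
    fderiv ℝ (d.sol h i y) p (0, e) = d.sol (fun z => fderiv ℝ h z e) i y p := by
  have hdiff : Differentiable ℝ h := hd.differentiable (by norm_num)
  have hc' : Continuous fun z => fderiv ℝ h z e :=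
    (hd.continuous_fderiv (by norm_num)).clm_apply continuous_const
  have h1 : HasDerivAt (fun τ : ℝ => d.sol (fun z => h (τ • e + z)) i y p)
      (d.sol (fun z => fderiv ℝ h ((0:ℝ) • e + z) e) i y p) 0 := by
    refine d.sol_hasDerivAt_param (F := fun τ z => h (τ • e + z))
      (F' := fun τ z => fderiv ℝ h (τ • e + z) e) one_pos (fun τ _ => ⟨?_, B, fun z => hB _⟩)
      ⟨?_, K * ‖e‖, fun z => ?_⟩ ?_ (fun τ _ z => ?_) hy hA hbox
    · exact hdiff.continuous.comp (by fun_prop)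
    · exact hc'.comp (by fun_prop)
    · exact (ContinuousLinearMap.le_opNorm _ _).trans
        (mul_le_mul_of_nonneg_right (norm_fderiv_le_of_lipschitz ℝ hK) (norm_nonneg _))
    · refine Continuous.continuousOn ?_
      exact hc'.comp (f := fun q : ℝ × ℝ × ℝ => q.1 • e + q.2) (by fun_prop)
    · have e1 : HasDerivAt (fun τ : ℝ => τ • e + z) e τ := by
        simpa using ((hasDerivAt_id τ).smul_const e).add_const z
      exact (hdiff _).hasFDerivAt.comp_hasDerivAt (f := fun τ : ℝ => τ • e + z) τ e1
  have h2 : HasDerivAt (fun τ : ℝ => d.sol h i y (p.1, τ • e + p.2))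
      (fderiv ℝ (d.sol h i y) p (0, e)) 0 := by
    have e1 : HasDerivAt (fun τ : ℝ => (p.1, τ • e + p.2)) ((0:ℝ), e) 0 := by
      refine (hasDerivAt_const _ _).prodMk ?_
      simpa using ((hasDerivAt_id (0:ℝ)).smul_const e).add_const p.2
    refine HasFDerivAt.comp_hasDerivAt (f := fun τ : ℝ => (p.1, τ • e + p.2)) (l := d.sol h i y) 0
      ?_ e1
    simpa using (d.sol_differentiableAt hdiff hB hK i hy.2 hp).hasFDerivAt
  simp only [sol_translate] at h1
  have := h2.unique h1
  simpa using this

/-- The solution of the renewal equation solves the transport equation. -/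
theorem sol_equation (i : Fin k) {y : ℝ} (hy : 0 < y) (hyT : y ≤ d.T) {p : ℝ × ℝ × ℝ}
    (hp : p.1 ≠ d.T) {A : Set (ℝ × ℝ)} (hA : IsCompact A)
    (hbox : ∀ ζ ∈ d.box p.1, p.2 + ζ ∈ A) :
    ∃ a b : ℝ, HasDerivAt (fun t => d.sol h i y (t, p.2)) a p.1 ∧
      HasDerivAt (fun y => d.sol h i y p) b y ∧
      a + b + d.sol (fun z => fderiv ℝ h z (deriv (d.Q i) p.1)) i y p +
        ∑ j, d.n i j y / d.S i y * (d.sol h j 0 p - d.sol h i y p) = 0 := by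
  have hdiff : Differentiable ℝ h := hd.differentiable (by norm_num)
  refine ⟨fderiv ℝ (d.sol h i y) p (1, 0), _, ?_,
    d.sol_hasDerivAt_age hdiff hB hK i hy hyT hp, ?_⟩
  · have e1 : HasDerivAt (fun t : ℝ => (t, p.2)) ((1:ℝ), (0 : ℝ × ℝ)) p.1 :=
      (hasDerivAt_id _).prodMk (hasDerivAt_const _ _)
    exact HasFDerivAt.comp_hasDerivAt (f := fun t : ℝ => (t, p.2)) (l := d.sol h i y) p.1
      (d.sol_differentiableAt hdiff hB hK i hyT hp).hasFDerivAt e1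
  · rw [← d.fderiv_sol_space hd hB hK i ⟨hy.le, hyT⟩ hp hA hbox,
      show ((1:ℝ), deriv (d.Q i) p.1) = (1, 0) + (0, deriv (d.Q i) p.1) by simp, map_add]
    simp only [d.sol_zero hdiff.continuous hB]
    ring

end Equation
end TransportData

/-- The exit rate, cut off to positive ages. -/
noncomputable def exitRate {k : ℕ} (lam : Fin k → Fin k → ℝ → ℝ) (i : Fin k) : ℝ → ℝ :=
  (Ioi 0).indicator (sumLam lam i)

/-- The cumulative exit rate. -/
noncomputable def cumRate {k : ℕ} (lam : Fin k → Fin k → ℝ → ℝ) (i : Fin k) (y : ℝ) : ℝ :=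
  ∫ v in (0:ℝ)..y, exitRate lam i v

/-- The density of a jump from `i` to `j` at a given age. -/
noncomputable def jumpDens {k : ℕ} (lam : Fin k → Fin k → ℝ → ℝ) (i j : Fin k) (w : ℝ) : ℝ :=
  if j ≠ i then (Ioi 0).indicator (lam i j) w * exp (-cumRate lam i w) else 0

section Rates

variable {k : ℕ} {lam : Fin k → Fin k → ℝ → ℝ}

theorem jumpDens_of_ne {i j : Fin k} (h : j ≠ i) :
    jumpDens lam i j = fun w => (Ioi 0).indicator (lam i j) w * exp (-cumRate lam i w) :=
  funext fun _ => if_pos h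

theorem jumpDens_of_not_ne {i j : Fin k} (h : ¬j ≠ i) : jumpDens lam i j = fun _ => 0 :=
  funext fun _ => if_neg h

theorem sum_jumpDens (i : Fin k) (w : ℝ) :
    ∑ j, jumpDens lam i j w = exitRate lam i w * exp (-cumRate lam i w) := by
  unfold jumpDens
  rw [← Finset.sum_filter, ← Finset.sum_mul]
  congr 1
  by_cases hw : 0 < w
  · simp [exitRate, sumLam, hw]
  · simp [exitRate, hw]

variable (hmeas : ∀ i j : Fin k, i ≠ j → Measurable (lam i j))
  (hnn : ∀ i j : Fin k, i ≠ j → ∀ y : ℝ, 0 < y → 0 ≤ lam i j y)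
  {c : ℝ} (hc : 0 < c) (hbound : ∀ i : Fin k, ∀ y : ℝ, 0 < y → sumLam lam i y ≤ c)
  (hdiff : ∀ i j : Fin k, i ≠ j → ∀ y : ℝ, 0 < y → DifferentiableAt ℝ (lam i j) y)

include hnn in
theorem exitRate_nonneg (i : Fin k) (w : ℝ) : 0 ≤ exitRate lam i w :=
  indicator_nonneg (fun y hy => Finset.sum_nonneg fun j hj =>
    hnn i j (Finset.mem_filter.1 hj).2.symm y hy) w

include hbound hc in
theorem exitRate_le (i : Fin k) (w : ℝ) : exitRate lam i w ≤ c :=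
  indicator_le' (fun y hy => hbound i y hy) (fun _ _ => hc.le) w

include hmeas in
theorem exitRate_measurable (i : Fin k) : Measurable (exitRate lam i) := by
  refine Measurable.indicator ?_ measurableSet_Ioi
  exact Finset.measurable_sum _ fun j hj => hmeas i j (Finset.mem_filter.1 hj).2.symm

include hmeas hnn hc hbound in
theorem exitRate_integrable (i : Fin k) (a b : ℝ) :
    IntervalIntegrable (exitRate lam i) volume a b := by
  refine (intervalIntegrable_const (c := c)).mono_fun
    (exitRate_measurable hmeas i).aestronglyMeasurable (ae_of_all _ fun w => ?_)
  beta_reduce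
  rw [Real.norm_eq_abs, Real.norm_eq_abs, abs_of_nonneg (exitRate_nonneg hnn i w),
    abs_of_pos hc]
  exact exitRate_le hc hbound i w

include hdiff in
theorem exitRate_continuousAt (i : Fin k) {y : ℝ} (hy : 0 < y) :
    ContinuousAt (exitRate lam i) y := by
  have h1 : ContinuousAt (sumLam lam i) y := by
    unfold sumLam
    exact tendsto_finsetSum _ fun j hj =>
      (hdiff i j (Finset.mem_filter.1 hj).2.symm y hy).continuousAt
  refine h1.congr ?_
  filter_upwards [Ioi_mem_nhds hy] with w hw
  exact (indicator_of_mem hw _).symm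

include hmeas hnn hc hbound in
theorem cumRate_continuous (i : Fin k) : Continuous (cumRate lam i) :=
  intervalIntegral.continuous_primitive (exitRate_integrable hmeas hnn hc hbound i) 0

include hnn in
theorem cumRate_nonneg (i : Fin k) {w : ℝ} (hw : 0 ≤ w) : 0 ≤ cumRate lam i w :=
  intervalIntegral.integral_nonneg hw fun v _ => exitRate_nonneg hnn i v

include hmeas hnn hc hbound hdiff in
theorem exp_neg_cumRate_hasDerivAt (i : Fin k) {y : ℝ} (hy : 0 < y) :
    HasDerivAt (fun y => exp (-cumRate lam i y)) (-∑ j, jumpDens lam i j y) y := by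
  have h1 : HasDerivAt (cumRate lam i) (exitRate lam i y) y :=
    intervalIntegral.integral_hasDerivAt_right (exitRate_integrable hmeas hnn hc hbound i _ _)
      (exitRate_measurable hmeas i).stronglyMeasurable.stronglyMeasurableAtFilter
      (exitRate_continuousAt hdiff i hy)
  refine h1.neg.exp.congr_deriv ?_
  rw [sum_jumpDens]
  simp only [Pi.neg_apply]
  ring

end Rates

/-- The set of possible displacements between a time `t` and the terminal time. -/
def displacementBox (T ρ m M t : ℝ) : Set (ℝ × ℝ) :=
  Icc 0 (ρ * (T - min t T)) ×ˢ Icc (m * (T - min t T)) (M * (T - min t T))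

theorem exists_pos_bounds {k : ℕ} {σ : ℝ → Fin k → ℝ}
    (hσpos : ∀ u : ℝ, 0 ≤ u → ∀ i : Fin k, 0 < σ u i)
    (hσcont : ∀ i : Fin k, ContinuousOn (fun u => σ u i) (Set.Ici 0)) {T : ℝ} (hT : 0 < T) :
    ∃ m M : ℝ, 0 < m ∧ 0 ≤ M ∧ ∀ i, ∀ τ ≤ T, σ (max τ 0) i ^ 2 ∈ Icc m M := by
  have h : ∀ i, ∃ m M : ℝ, 0 < m ∧ 0 ≤ M ∧ ∀ u ∈ Icc 0 T, σ u i ^ 2 ∈ Icc m M := by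
    intro i
    have hcont : ContinuousOn (fun u => σ u i ^ 2) (Icc 0 T) :=
      ((hσcont i).mono Icc_subset_Ici_self).pow 2
    have hne : (Icc 0 T).Nonempty := nonempty_Icc.2 hT.le
    obtain ⟨a, ha, ha'⟩ := isCompact_Icc.exists_isMinOn hne hcont
    obtain ⟨b, hb, hb'⟩ := isCompact_Icc.exists_isMaxOn hne hcont
    exact ⟨_, _, pow_pos (hσpos a ha.1 i) 2, sq_nonneg _, fun u hu => ⟨ha' hu, hb' hu⟩⟩
  choose m M hm hM hmM using h
  rcases isEmpty_or_nonempty (Fin k) with hk | hk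
  · exact ⟨1, 1, one_pos, zero_le_one, fun i => (hk.false i).elim⟩
  · obtain ⟨i₀, hi₀⟩ := Finite.exists_min m
    obtain ⟨i₁, hi₁⟩ := Finite.exists_max M
    refine ⟨m i₀, M i₁, hm _, hM _, fun i τ hτ => ?_⟩
    have := hmM i (max τ 0) ⟨le_max_right _ _, max_le hτ hT.le⟩
    exact ⟨(hi₀ i).trans this.1, this.2.trans (hi₁ i)⟩

theorem exists_transportData {k : ℕ} {lam : Fin k → Fin k → ℝ → ℝ}
    (hmeas : ∀ i j : Fin k, i ≠ j → Measurable (lam i j))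
    (hnn : ∀ i j : Fin k, i ≠ j → ∀ y : ℝ, 0 < y → 0 ≤ lam i j y)
    {c : ℝ} (hc : 0 < c) (hbound : ∀ i : Fin k, ∀ y : ℝ, 0 < y → sumLam lam i y ≤ c)
    (hdiff : ∀ i j : Fin k, i ≠ j → ∀ y : ℝ, 0 < y → DifferentiableAt ℝ (lam i j) y)
    {r : Fin k → ℝ} (hr : ∀ i : Fin k, 0 ≤ r i) {σ : ℝ → Fin k → ℝ}
    (hσpos : ∀ u : ℝ, 0 ≤ u → ∀ i : Fin k, 0 < σ u i)
    (hσcont : ∀ i : Fin k, ContinuousOn (fun u => σ u i) (Set.Ici 0)) {T : ℝ} (hT : 0 < T) :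
    ∃ d : TransportData k, d.T = T ∧
      (∀ i j y, 0 < y → d.n i j y / d.S i y = if j ≠ i then lam i j y else 0) ∧
      (∀ i, ∀ t ∈ Ioo 0 T, deriv (d.Q i) t = (r i, σ t i ^ 2)) ∧
      ∃ ρ m M : ℝ, 0 ≤ ρ ∧ 0 < m ∧ 0 ≤ M ∧ d.box = displacementBox T ρ m M := by
  obtain ⟨m, M, hm, hM, hmM⟩ := exists_pos_bounds hσpos hσcont hT
  set v : Fin k → ℝ → ℝ := fun i τ => σ (max τ 0) i ^ 2 with hv
  have hvc : ∀ i, Continuous (v i) := fun i =>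
    ((hσcont i).comp_continuous (by fun_prop) fun τ => mem_Ici.2 (le_max_right τ 0)).pow 2
  set ρ := ∑ i, r i
  have hρ : 0 ≤ ρ := Finset.sum_nonneg fun i _ => hr i
  have hrρ : ∀ i, r i ≤ ρ := fun i => Finset.single_le_sum (fun i _ => hr i) (Finset.mem_univ i)
  set V : Fin k → ℝ → ℝ := fun i t => ∫ τ in (0:ℝ)..t, v i τ with hV
  have hVd : ∀ i t, HasDerivAt (V i) (v i t) t := fun i t =>
    (hvc i).integral_hasStrictDerivAt 0 t |>.hasDerivAt
  have hVinc : ∀ i, ∀ t t', t ≤ t' → t' ≤ T → V i t' - V i t ∈ Icc (m * (t' - t)) (M * (t' - t)) := by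
    intro i t t' htt' ht'
    have e : V i t' - V i t = ∫ τ in t..t', v i τ := by
      simp only [hV]
      rw [intervalIntegral.integral_interval_sub_left] <;> exact (hvc i).intervalIntegrable _ _
    rw [e]
    have h1 := intervalIntegral.integral_mono_on htt' (intervalIntegrable_const (c := m) (μ := volume))
      ((hvc i).intervalIntegrable _ _) fun τ hτ => (hmM i τ (hτ.2.trans ht')).1
    have h2 := intervalIntegral.integral_mono_on htt' ((hvc i).intervalIntegrable _ _)
      (intervalIntegrable_const (c := M) (μ := volume)) fun τ hτ => (hmM i τ (hτ.2.trans ht')).2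
    simp only [intervalIntegral.integral_const, smul_eq_mul] at h1 h2
    constructor <;> linarith
  let Q : Fin k → ℝ → ℝ × ℝ := fun i t => (r i * min t T, V i (min t T))
  have hQlt : ∀ i t, t < T → HasDerivAt (Q i) (r i, v i t) t := by
    intro i t ht
    have h1 := ((hasDerivAt_id t).const_mul (r i)).prodMk (hVd i t)
    refine (h1.congr_deriv (by simp)).congr_of_eventuallyEq ?_
    filter_upwards [Iio_mem_nhds ht] with u hu
    simp [Q, min_eq_left (le_of_lt (mem_Iio.1 hu))]
  have hQge : ∀ i t, T ≤ t → Q i t = Q i T := by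
    intro i t ht
    simp only [Q, min_eq_right ht, min_self]
  have hQmono : ∀ i t t', t ≤ t' → Q i t' - Q i t ∈
      Icc 0 (ρ * (min t' T - min t T)) ×ˢ
        Icc (m * (min t' T - min t T)) (M * (min t' T - min t T)) := by
    intro i t t' h
    have h1 : min t T ≤ min t' T := min_le_min_right T h
    refine ⟨?_, hVinc i _ _ h1 (min_le_right _ _)⟩
    simp only [Q, Prod.fst_sub, ← mul_sub]
    exact ⟨mul_nonneg (hr i) (by linarith), mul_le_mul_of_nonneg_right (hrρ i) (by linarith)⟩
  let L : ℝ≥0 := ⟨ρ + M, by positivity⟩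
  have hlip' : ∀ i t t', t ≤ t' → dist (Q i t') (Q i t) ≤ (ρ + M) * (t' - t) := by
    intro i t t' h
    have h0 : min t T ≤ min t' T := min_le_min_right T h
    have h3 : min t' T - min t T ≤ t' - t := by
      rcases min_cases t' T with h | h <;> rcases min_cases t T with h' | h' <;> linarith
    obtain ⟨⟨h1, h2⟩, h4, h5⟩ := hQmono i t t' h
    have h6 : 0 ≤ m * (min t' T - min t T) := mul_nonneg hm.le (by linarith)
    have h7 : ρ * (min t' T - min t T) ≤ ρ * (t' - t) := mul_le_mul_of_nonneg_left h3 hρ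
    have h8 : M * (min t' T - min t T) ≤ M * (t' - t) := mul_le_mul_of_nonneg_left h3 hM
    have h9 : 0 ≤ ρ * (t' - t) := mul_nonneg hρ (by linarith)
    have h10 : 0 ≤ M * (t' - t) := mul_nonneg hM (by linarith)
    rw [dist_eq_norm, Prod.norm_def, Real.norm_eq_abs, Real.norm_eq_abs, abs_of_nonneg h1,
      abs_of_nonneg (h6.trans h4)]
    exact max_le (by linarith) (by linarith)
  refine ⟨{ T := T, T_pos := hT, c := c, c_pos := hc, n := jumpDens lam
            n_meas := fun i j => ?_, n_nonneg := fun i j w => ?_, n_sum_le := fun i w => ?_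
            n_cont := fun i j y hy => ?_, S := fun i y => exp (-cumRate lam i y)
            S_pos := fun i y => exp_pos _, S_zero := fun i => by simp [cumRate]
            S_cont := fun i => ?_, S_balance := fun i y hy => ?_
            S_deriv := fun i y hy => exp_neg_cumRate_hasDerivAt hmeas hnn hc hbound hdiff i hy
            Q := Q, L := L, Q_lip := fun i => ?_, Q_const := hQge
            Q_diff := fun i t ht => ?_, box := displacementBox T ρ m M
            box_zero := fun t ht => ?_, box_add := fun i t t' ζ ht hζ => ?_ }, rfl, ?_, ?_,
          ρ, m, M, hρ, hm, hM, rfl⟩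
  · have := cumRate_continuous hmeas hnn hc hbound i
    by_cases h : j ≠ i
    · rw [jumpDens_of_ne h]
      exact ((hmeas i j h.symm).indicator measurableSet_Ioi).mul (by fun_prop)
    · rw [jumpDens_of_not_ne h]
      exact measurable_const
  · by_cases h : j ≠ i
    · rw [jumpDens_of_ne h]
      exact mul_nonneg (indicator_nonneg (fun y hy => hnn i j h.symm y hy) w) (exp_pos _).le
    · rw [jumpDens_of_not_ne h]
  · rw [sum_jumpDens]
    by_cases hw : 0 < w
    · have h1 := exitRate_le hc hbound i w
      have h2 := cumRate_nonneg hnn i hw.le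
      have h3 := exitRate_nonneg hnn i w
      calc _ ≤ c * 1 := mul_le_mul h1 (exp_le_one_iff.2 (by linarith)) (exp_pos _).le hc.le
        _ = c := mul_one c
    · simp [exitRate, hw, hc.le]
  · have := (cumRate_continuous hmeas hnn hc hbound i).continuousAt (x := y)
    by_cases h : j ≠ i
    · have h1 : ContinuousAt (fun w => lam i j w * exp (-cumRate lam i w)) y :=
        (hdiff i j h.symm y hy).continuousAt.mul (by fun_prop)
      refine h1.congr ?_
      filter_upwards [Ioi_mem_nhds hy] with w hw
      rw [jumpDens_of_ne h]
      beta_reduce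
      rw [indicator_of_mem hw]
    · rw [jumpDens_of_not_ne h]
      exact continuousAt_const
  · have := cumRate_continuous hmeas hnn hc hbound i
    fun_prop
  · have hcc := cumRate_continuous hmeas hnn hc hbound i
    have h1 := intervalIntegral.integral_eq_sub_of_hasDerivAt_of_le hy.2
      (f := fun y => -exp (-cumRate lam i y)) (f' := fun y => ∑ j, jumpDens lam i j y)
      (by fun_prop) (fun w hw => ?_) ?_
    · rw [h1]; ring
    · refine (exp_neg_cumRate_hasDerivAt hmeas hnn hc hbound hdiff i
        (hy.1.trans_lt hw.1)).neg.congr_deriv (neg_neg _)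
    · have : (fun y => ∑ j, jumpDens lam i j y) =
          fun y => exitRate lam i y * exp (-cumRate lam i y) := funext fun y => sum_jumpDens i y
      rw [this]
      exact (exitRate_integrable hmeas hnn hc hbound i _ _).mul_continuousOn (by fun_prop)
  · refine LipschitzWith.of_dist_le_mul fun t t' => ?_
    change _ ≤ (ρ + M) * _
    rcases le_total t t' with h | h
    · rw [dist_comm, dist_comm t, Real.dist_eq, abs_of_nonneg (sub_nonneg.2 h)]
      exact hlip' i t t' h
    · rw [Real.dist_eq, abs_of_nonneg (sub_nonneg.2 h)]
      exact hlip' i t' t h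
  · rcases lt_or_gt_of_ne ht with h | h
    · exact (hQlt i t h).differentiableAt
    · have : Q i =ᶠ[𝓝 t] fun _ => Q i T := by
        filter_upwards [Ioi_mem_nhds h] with u hu
        exact hQge i u (le_of_lt hu)
      exact (differentiableAt_const _).congr_of_eventuallyEq this
  · simp [displacementBox, min_eq_right ht, Prod.zero_eq_mk]
  · obtain ⟨⟨h1, h2⟩, h3, h4⟩ := hQmono i t t' ht
    obtain ⟨⟨g1, g2⟩, g3, g4⟩ := hζ
    refine ⟨⟨?_, ?_⟩, ?_, ?_⟩ <;> simp only [Prod.fst_add, Prod.snd_add] <;> linarith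
  · intro i j y hy
    change jumpDens lam i j y / exp (-cumRate lam i y) = _
    by_cases h : j ≠ i
    · rw [if_pos h, jumpDens_of_ne h]
      beta_reduce
      rw [indicator_of_mem (mem_Ioi.2 hy), mul_div_cancel_right₀ _ (exp_ne_zero _)]
    · rw [if_neg h, jumpDens_of_not_ne h, zero_div]
  · intro i t ht
    have := (hQlt i t ht.2).deriv
    simpa [hv, max_eq_left ht.1.le] using this

namespace GaussKernel

/-- The unnormalised Gaussian kernel with a polynomial weight. -/
noncomputable def ker (κ : ℝ → ℝ) (n : ℕ) (p : ℝ × ℝ) (ξ : ℝ) : ℝ :=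
  κ ξ * ((ξ - p.1) ^ n * exp (-(ξ - p.1) ^ 2 / (2 * p.2)))

/-- Gaussian moments of `κ`. -/
noncomputable def mom (κ : ℝ → ℝ) (n : ℕ) (p : ℝ × ℝ) : ℝ := ∫ ξ, ker κ n p ξ

theorem weight_le (n : ℕ) {X b : ℝ} (hb : 0 < b) {x V ξ : ℝ} (hx : |x| ≤ X) (hV : 0 < V)
    (hVb : V ≤ b) :
    exp |ξ| * |(ξ - x) ^ n * exp (-(ξ - x) ^ 2 / (2 * V))| ≤
      n.factorial * exp (8 * b + X + X ^ 2 / (2 * b)) * exp (-(8 * b)⁻¹ * ξ ^ 2) := by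
  have h1 : |ξ - x| ^ n ≤ n.factorial * exp (|ξ| + X) := by
    have h := Real.pow_div_factorial_le_exp |ξ - x| (abs_nonneg _) n
    rw [div_le_iff₀ (by positivity)] at h
    rw [mul_comm]
    refine h.trans (mul_le_mul_of_nonneg_right (exp_le_exp.2 ?_) (by positivity))
    exact (abs_sub ξ x).trans (by linarith)
  have h2 : -(ξ - x) ^ 2 / (2 * V) ≤ X ^ 2 / (2 * b) - ξ ^ 2 / (4 * b) := by
    have e1 : (ξ - x) ^ 2 / (2 * b) ≤ (ξ - x) ^ 2 / (2 * V) := by gcongr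
    have e2 : x ^ 2 ≤ X ^ 2 := by rw [← sq_abs x]; gcongr
    have e3 : (ξ ^ 2 / 2 - X ^ 2) / (2 * b) ≤ (ξ - x) ^ 2 / (2 * b) := by
      gcongr
      nlinarith [sq_nonneg (ξ - 2 * x)]
    have e4 : (ξ ^ 2 / 2 - X ^ 2) / (2 * b) = ξ ^ 2 / (4 * b) - X ^ 2 / (2 * b) := by
      field_simp; ring
    rw [neg_div]
    linarith
  have h3 : 2 * |ξ| ≤ 8 * b + ξ ^ 2 / (8 * b) := by
    have e : 8 * b + ξ ^ 2 / (8 * b) - 2 * |ξ| = (8 * b - |ξ|) ^ 2 / (8 * b) := by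
      rw [← sq_abs ξ]; field_simp; ring
    have : 0 ≤ (8 * b - |ξ|) ^ 2 / (8 * b) := by positivity
    linarith
  rw [abs_mul, abs_pow, abs_of_pos (exp_pos _)]
  calc exp |ξ| * (|ξ - x| ^ n * exp (-(ξ - x) ^ 2 / (2 * V)))
      ≤ exp |ξ| * (n.factorial * exp (|ξ| + X) * exp (X ^ 2 / (2 * b) - ξ ^ 2 / (4 * b))) := by
        gcongr
    _ = n.factorial * exp (|ξ| + (|ξ| + X + (X ^ 2 / (2 * b) - ξ ^ 2 / (4 * b)))) := by
        rw [exp_add |ξ| (_ + _), exp_add (|ξ| + X)]; ring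
    _ ≤ n.factorial * exp (8 * b + X + X ^ 2 / (2 * b) + -(8 * b)⁻¹ * ξ ^ 2) := by
        refine mul_le_mul_of_nonneg_left (exp_le_exp.2 ?_) (by positivity)
        have e4 : ξ ^ 2 / (4 * b) = ξ ^ 2 / (8 * b) + ξ ^ 2 / (8 * b) := by field_simp; ring
        have e5 : (8 * b)⁻¹ * ξ ^ 2 = ξ ^ 2 / (8 * b) := by field_simp
        rw [neg_mul, e5]
        linarith
    _ = _ := by rw [exp_add]; ring

variable {κ : ℝ → ℝ} {C : ℝ} (hκ : Measurable κ) (hC : ∀ ξ, |κ ξ| ≤ C * exp |ξ|)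

include hC in
theorem C_nonneg : 0 ≤ C := by
  have := (abs_nonneg _).trans (hC 0)
  simpa using this

include hC in
theorem ker_le (n : ℕ) {X b : ℝ} (hb : 0 < b) {p : ℝ × ℝ} {ξ : ℝ} (hx : |p.1| ≤ X)
    (hV : 0 < p.2) (hVb : p.2 ≤ b) :
    |ker κ n p ξ| ≤ C * (n.factorial * exp (8 * b + X + X ^ 2 / (2 * b))) *
      exp (-(8 * b)⁻¹ * ξ ^ 2) := by
  have hC0 := C_nonneg hC
  unfold ker
  rw [abs_mul, mul_assoc]
  refine (mul_le_mul_of_nonneg_right (hC ξ) (abs_nonneg _)).trans ?_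
  rw [mul_assoc]
  exact mul_le_mul_of_nonneg_left (weight_le n hb hx hV hVb) hC0

include hκ in
theorem ker_measurable (n : ℕ) (p : ℝ × ℝ) : Measurable (ker κ n p) := by
  unfold ker
  fun_prop

include hκ hC in
theorem ker_integrable (n : ℕ) {p : ℝ × ℝ} (hp : 0 < p.2) : Integrable (ker κ n p) := by
  refine ((integrable_exp_neg_mul_sq (b := (8 * p.2)⁻¹) (by positivity)).const_mul
    (C * (n.factorial * exp (8 * p.2 + |p.1| + |p.1| ^ 2 / (2 * p.2))))).mono'
    (ker_measurable hκ n p).aestronglyMeasurable (ae_of_all _ fun ξ => ?_)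
  exact ker_le hC n hp le_rfl hp le_rfl

theorem ker_hasFDerivAt (n : ℕ) (ξ : ℝ) {p : ℝ × ℝ} (hp : 0 < p.2) :
    HasFDerivAt (fun p => ker κ n p ξ)
      ((ker κ (n + 1) p ξ / p.2 - n * ker κ (n - 1) p ξ) • ContinuousLinearMap.fst ℝ ℝ ℝ +
        (ker κ (n + 2) p ξ / (2 * p.2 ^ 2)) • ContinuousLinearMap.snd ℝ ℝ ℝ) p := by
  have h1 : HasFDerivAt (fun p : ℝ × ℝ => ξ - p.1) (-ContinuousLinearMap.fst ℝ ℝ ℝ) p :=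
    hasFDerivAt_fst.const_sub ξ
  have h2 : HasFDerivAt (fun p : ℝ × ℝ => (2 * p.2)⁻¹)
      ((-((2 * p.2) ^ 2)⁻¹) • ((2:ℝ) • ContinuousLinearMap.snd ℝ ℝ ℝ)) p :=
    HasDerivAt.comp_hasFDerivAt (f := fun p : ℝ × ℝ => 2 * p.2) p
      (hasDerivAt_inv (by positivity)) (hasFDerivAt_snd.const_mul 2)
  have h3 := (((h1.pow 2).neg.mul h2).exp)
  have h4 := ((h1.pow n).mul h3).const_mul (κ ξ)
  have e : (fun p => ker κ n p ξ) = fun p : ℝ × ℝ =>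
      κ ξ * (((fun p : ℝ × ℝ => ξ - p.1) ^ n) p *
        exp ((-(fun p : ℝ × ℝ => ξ - p.1) ^ 2 * fun p : ℝ × ℝ => (2 * p.2)⁻¹) p)) := by
    funext p
    simp [ker, div_eq_mul_inv]
  rw [e]
  refine h4.congr_fderiv ?_
  ext
  · cases n with
    | zero => simp [ker]; field_simp; try ring
    | succ n => simp [ker]; field_simp; try ring
  · simp [ker]; field_simp; try ring

include hκ hC in
theorem mom_hasFDerivAt (n : ℕ) {p : ℝ × ℝ} (hp : 0 < p.2) :
    HasFDerivAt (mom κ n)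
      ((mom κ (n + 1) p / p.2 - n * mom κ (n - 1) p) • ContinuousLinearMap.fst ℝ ℝ ℝ +
        (mom κ (n + 2) p / (2 * p.2 ^ 2)) • ContinuousLinearMap.snd ℝ ℝ ℝ) p := by
  have hC0 := C_nonneg hC
  set X := |p.1| + 1
  set a := p.2 / 2
  set b := p.2 + 1
  have ha : 0 < a := by positivity
  have hb : 0 < b := by positivity
  set E := fun n : ℕ => C * (n.factorial * exp (8 * b + X + X ^ 2 / (2 * b)))
  have hE : ∀ n, 0 ≤ E n := fun n => by positivity
  let s : Set (ℝ × ℝ) := {q | |q.1| < X ∧ a < q.2 ∧ q.2 < b}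
  have hs : s ∈ 𝓝 p := by
    refine IsOpen.mem_nhds ?_ ⟨by simp [X], half_lt_self hp, by simp [b]⟩
    exact (isOpen_lt (continuous_fst.abs) continuous_const).inter ((isOpen_lt continuous_const
      continuous_snd).inter (isOpen_lt continuous_snd continuous_const))
  have hi := fun n => ker_integrable hκ hC n hp
  have key := hasFDerivAt_integral_of_dominated_of_fderiv_le (𝕜 := ℝ) (μ := volume) (s := s)
    (F := fun p ξ => ker κ n p ξ) (x₀ := p)
    (F' := fun p ξ => (ker κ (n + 1) p ξ / p.2 - n * ker κ (n - 1) p ξ) •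
        ContinuousLinearMap.fst ℝ ℝ ℝ +
        (ker κ (n + 2) p ξ / (2 * p.2 ^ 2)) • ContinuousLinearMap.snd ℝ ℝ ℝ)
    (bound := fun ξ => (E (n + 1) / a + n * E (n - 1) + E (n + 2) / (2 * a ^ 2)) *
      exp (-(8 * b)⁻¹ * ξ ^ 2)) hs
    (Eventually.of_forall fun q => (ker_measurable hκ n q).aestronglyMeasurable) (hi n) ?_
    (ae_of_all _ fun ξ q hq => ?_)
    ((integrable_exp_neg_mul_sq (by positivity)).const_mul _)
    (ae_of_all _ fun ξ q hq => ker_hasFDerivAt n ξ (ha.trans hq.2.1))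
  · refine key.congr_fderiv ?_
    have i1 : Integrable (fun ξ => ker κ (n + 1) p ξ / p.2 - n * ker κ (n - 1) p ξ) :=
      ((hi (n + 1)).div_const p.2).sub ((hi (n - 1)).const_mul (n : ℝ))
    have i2 := (hi (n + 2)).div_const (2 * p.2 ^ 2)
    rw [integral_add (i1.smul_const _) (i2.smul_const _), integral_smul_const,
      integral_smul_const, integral_sub ((hi (n + 1)).div_const p.2) ((hi (n - 1)).const_mul _),
      integral_div, integral_div, integral_const_mul]
    rfl
  · have h1 := fun n => ker_measurable hκ n p
    refine Measurable.aestronglyMeasurable ?_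
    exact ((((h1 _).div_const _).sub ((h1 _).const_mul _)).smul_const _).add
      (((h1 _).div_const _).smul_const _)
  · have hq2 : 0 < q.2 := ha.trans hq.2.1
    have hk := fun m => ker_le hC m hb (ξ := ξ) hq.1.le hq2 hq.2.2.le
    refine (norm_add_le _ _).trans ?_
    rw [norm_smul, norm_smul]
    have n1 := ContinuousLinearMap.norm_fst_le ℝ ℝ ℝ
    have n2 := ContinuousLinearMap.norm_snd_le ℝ ℝ ℝ
    refine (add_le_add (mul_le_of_le_one_right (norm_nonneg _) n1)
      (mul_le_of_le_one_right (norm_nonneg _) n2)).trans ?_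
    refine (add_le_add_left (norm_sub_le _ _) _).trans ?_
    simp only [norm_div, norm_mul, Real.norm_eq_abs, abs_of_pos hq2, abs_two, abs_pow,
      Nat.abs_cast]
    rw [add_mul, add_mul]
    have haq := hq.2.1.le
    refine add_le_add (add_le_add ?_ ?_) ?_
    · rw [div_mul_eq_mul_div]
      exact div_le_div₀ (mul_nonneg (hE _) (exp_pos _).le) (hk _) ha haq
    · rw [mul_assoc]
      exact mul_le_mul_of_nonneg_left (hk _) (by positivity)
    · rw [div_mul_eq_mul_div]
      exact div_le_div₀ (mul_nonneg (hE _) (exp_pos _).le) (hk _) (by positivity) (by gcongr)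

theorem isOpen_halfPlane : IsOpen {p : ℝ × ℝ | 0 < p.2} := isOpen_lt continuous_const continuous_snd

include hκ hC in
theorem mom_contDiffOn (m n : ℕ) : ContDiffOn ℝ m (mom κ n) {p | 0 < p.2} := by
  induction m generalizing n with
  | zero =>
    exact contDiffOn_zero.2 fun p hp =>
      (mom_hasFDerivAt hκ hC n hp).continuousAt.continuousWithinAt
  | succ m ih =>
    push_cast
    refine (contDiffOn_succ_iff_hasFDerivWithinAt_of_uniqueDiffOn
      isOpen_halfPlane.uniqueDiffOn).2 ⟨by simp, _, ?_, fun p hp =>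
        (mom_hasFDerivAt hκ hC n hp).hasFDerivWithinAt⟩
    have h2 : ContDiffOn ℝ m (fun p : ℝ × ℝ => p.2) {p | 0 < p.2} := contDiff_snd.contDiffOn
    refine ContDiffOn.add (ContDiffOn.smul (ContDiffOn.sub (ContDiffOn.div (ih _) h2 ?_)
      (contDiffOn_const.mul (ih _))) contDiffOn_const)
      (ContDiffOn.smul (ContDiffOn.div (ih _) (contDiffOn_const.mul (h2.pow 2)) ?_)
        contDiffOn_const)
    · exact fun p hp => ne_of_gt hp
    · intro p hp
      have : 0 < p.2 := hp
      positivity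

end GaussKernel

namespace GaussKernel

/-- The Gaussian average of `κ` with mean `p.1` and variance `p.2`. -/
noncomputable def heat (κ : ℝ → ℝ) (p : ℝ × ℝ) : ℝ := (√(2 * π * p.2))⁻¹ * mom κ 0 p

/-- The space derivative of `heat`. -/
noncomputable def heat₁ (κ : ℝ → ℝ) (p : ℝ × ℝ) : ℝ := (√(2 * π * p.2))⁻¹ * (mom κ 1 p / p.2)

/-- The second space derivative of `heat`. -/
noncomputable def heat₂ (κ : ℝ → ℝ) (p : ℝ × ℝ) : ℝ :=
  (√(2 * π * p.2))⁻¹ * (mom κ 2 p / p.2 ^ 2 - mom κ 0 p / p.2)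

/-- Logarithmic coordinates. -/
noncomputable def logCoord (q : ℝ × ℝ × ℝ) : ℝ × ℝ := (log q.1 + q.2.1 - q.2.2 / 2, q.2.2)

/-- The Black-Scholes price with accumulated interest `q.2.1` and variance `q.2.2`. -/
noncomputable def price (κ : ℝ → ℝ) (q : ℝ × ℝ × ℝ) : ℝ := exp (-q.2.1) * heat κ (logCoord q)

/-- The first derivative of `price` in the asset variable. -/
noncomputable def price₁ (κ : ℝ → ℝ) (q : ℝ × ℝ × ℝ) : ℝ :=
  exp (-q.2.1) * (heat₁ κ (logCoord q) / q.1)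

/-- The second derivative of `price` in the asset variable. -/
noncomputable def price₂ (κ : ℝ → ℝ) (q : ℝ × ℝ × ℝ) : ℝ :=
  exp (-q.2.1) * ((heat₂ κ (logCoord q) - heat₁ κ (logCoord q)) / q.1 ^ 2)

theorem inv_sqrt_hasDerivAt {V : ℝ} (hV : 0 < V) :
    HasDerivAt (fun V => (√(2 * π * V))⁻¹) (-(√(2 * π * V))⁻¹ / (2 * V)) V := by
  have hpos : 0 < 2 * π * V := by positivity
  have h := (((hasDerivAt_id V).const_mul (2 * π)).sqrt hpos.ne').inv (sqrt_ne_zero'.2 hpos)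
  refine h.congr_deriv ?_
  simp only [id]
  rw [sq_sqrt hpos.le]
  have := sqrt_ne_zero'.2 hpos
  field_simp

variable {κ : ℝ → ℝ} {C : ℝ} (hκ : Measurable κ) (hC : ∀ ξ, |κ ξ| ≤ C * exp |ξ|)
include hκ hC

theorem heat_hasFDerivAt {p : ℝ × ℝ} (hp : 0 < p.2) :
    HasFDerivAt (heat κ) (heat₁ κ p • ContinuousLinearMap.fst ℝ ℝ ℝ +
      (heat₂ κ p / 2) • ContinuousLinearMap.snd ℝ ℝ ℝ) p := by
  have h1 : HasFDerivAt (fun p : ℝ × ℝ => (√(2 * π * p.2))⁻¹) _ p :=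
    (inv_sqrt_hasDerivAt hp).comp_hasFDerivAt (f := Prod.snd)
      (f' := ContinuousLinearMap.snd ℝ ℝ ℝ) p hasFDerivAt_snd
  refine (h1.mul (mom_hasFDerivAt hκ hC 0 hp)).congr_fderiv ?_
  ext
  · simp [heat₁]
  · simp [heat₂]; field_simp; ring

theorem heat₁_hasDerivAt {x V : ℝ} (hV : 0 < V) :
    HasDerivAt (fun x => heat₁ κ (x, V)) (heat₂ κ (x, V)) x := by
  have h1 : HasDerivAt (fun x => mom κ 1 (x, V)) _ x :=
    HasFDerivAt.comp_hasDerivAt (f := fun x : ℝ => (x, V)) (l := mom κ 1) x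
      (mom_hasFDerivAt hκ hC 1 (p := (x, V)) hV) ((hasDerivAt_id x).prodMk (hasDerivAt_const x V))
  refine ((h1.div_const V).const_mul (√(2 * π * V))⁻¹).congr_deriv ?_
  simp only [heat₂, add_apply, _root_.smul_apply, ContinuousLinearMap.coe_fst',
    ContinuousLinearMap.coe_snd', smul_eq_mul, mul_zero, mul_one, add_zero, Nat.cast_one, one_mul]
  norm_num
  left
  field_simp

theorem heat_contDiffOn (m : ℕ) : ContDiffOn ℝ m (heat κ) {p | 0 < p.2} ∧
    ContDiffOn ℝ m (heat₁ κ) {p | 0 < p.2} ∧ ContDiffOn ℝ m (heat₂ κ) {p | 0 < p.2} := by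
  have h2 : ContDiffOn ℝ m (fun p : ℝ × ℝ => p.2) {p | 0 < p.2} := contDiff_snd.contDiffOn
  have hne : ∀ p ∈ {p : ℝ × ℝ | 0 < p.2}, p.2 ≠ 0 := fun p hp => ne_of_gt hp
  have h3 : ContDiffOn ℝ m (fun p : ℝ × ℝ => (√(2 * π * p.2))⁻¹) {p | 0 < p.2} := by
    refine ContDiffOn.inv (ContDiffOn.sqrt (contDiffOn_const.mul h2) ?_) ?_
    · intro p hp
      have : 0 < p.2 := hp
      positivity
    · intro p hp
      have : 0 < p.2 := hp
      positivity
  have h4 := fun n => mom_contDiffOn hκ hC m n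
  refine ⟨h3.mul (h4 0), h3.mul ((h4 1).div h2 hne), h3.mul (((h4 2).div (h2.pow 2) ?_).sub
    ((h4 0).div h2 hne))⟩
  exact fun p hp => pow_ne_zero 2 (hne p hp)

theorem price_contDiffOn (m : ℕ) : ContDiffOn ℝ m (price κ) {q | 0 < q.1 ∧ 0 < q.2.2} ∧
    ContDiffOn ℝ m (price₁ κ) {q | 0 < q.1 ∧ 0 < q.2.2} ∧
    ContDiffOn ℝ m (price₂ κ) {q | 0 < q.1 ∧ 0 < q.2.2} := by
  obtain ⟨g0, g1, g2⟩ := heat_contDiffOn hκ hC m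
  set s : Set (ℝ × ℝ × ℝ) := {q | 0 < q.1 ∧ 0 < q.2.2}
  have h1 : ContDiffOn ℝ m (fun q : ℝ × ℝ × ℝ => q.1) s := contDiff_fst.contDiffOn
  have h2 : ContDiffOn ℝ m (fun q : ℝ × ℝ × ℝ => q.2.1) s := by fun_prop
  have h3 : ContDiffOn ℝ m (fun q : ℝ × ℝ × ℝ => q.2.2) s := by fun_prop
  have hne : ∀ q ∈ s, q.1 ≠ 0 := fun q hq => ne_of_gt hq.1
  have hl : ContDiffOn ℝ m logCoord s :=
    (((h1.log hne).add h2).sub (h3.div_const 2)).prodMk h3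
  have hm : MapsTo logCoord s {p | 0 < p.2} := fun q hq => hq.2
  have he : ContDiffOn ℝ m (fun q : ℝ × ℝ × ℝ => exp (-q.2.1)) s := h2.neg.exp
  refine ⟨he.mul (g0.comp hl hm), he.mul ((g1.comp hl hm).div h1 hne),
    he.mul (((g2.comp hl hm).sub (g1.comp hl hm)).div (h1.pow 2) ?_)⟩
  exact fun q hq => pow_ne_zero 2 (hne q hq)

theorem price_hasDerivAt {s : ℝ} (hs : 0 < s) {z : ℝ × ℝ} (hz : 0 < z.2) :
    HasDerivAt (fun s => price κ (s, z)) (price₁ κ (s, z)) s := by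
  have h1 : HasDerivAt (fun s => logCoord (s, z)) (s⁻¹, 0) s :=
    (((hasDerivAt_log hs.ne').add_const z.1).sub_const (z.2 / 2)).prodMk (hasDerivAt_const s z.2)
  have h2 : HasDerivAt (fun s => heat κ (logCoord (s, z))) _ s :=
    HasFDerivAt.comp_hasDerivAt (f := fun s => logCoord (s, z)) (l := heat κ) s
      (heat_hasFDerivAt hκ hC hz) h1
  refine (h2.const_mul (exp (-z.1))).congr_deriv ?_
  simp [price₁, div_eq_mul_inv]

theorem price₁_hasDerivAt {s : ℝ} (hs : 0 < s) {z : ℝ × ℝ} (hz : 0 < z.2) :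
    HasDerivAt (fun s => price₁ κ (s, z)) (price₂ κ (s, z)) s := by
  have h1 : HasDerivAt (fun s => log s + z.1 - z.2 / 2) s⁻¹ s :=
    (((hasDerivAt_log hs.ne').add_const z.1).sub_const (z.2 / 2))
  have h2 : HasDerivAt (fun s => heat₁ κ (logCoord (s, z))) _ s :=
    HasDerivAt.comp (h := fun s => log s + z.1 - z.2 / 2)
      (h₂ := fun x => heat₁ κ (x, z.2)) s (heat₁_hasDerivAt hκ hC hz) h1
  refine ((h2.div (hasDerivAt_id s) hs.ne').const_mul (exp (-z.1))).congr_deriv ?_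
  simp [price₂, logCoord]
  field_simp

theorem fderiv_price {s : ℝ} (hs : 0 < s) {z : ℝ × ℝ} (hz : 0 < z.2) (a q : ℝ) :
    fderiv ℝ (fun z => price κ (s, z)) z (a, q) =
      -a * price κ (s, z) + a * (s * price₁ κ (s, z)) + q / 2 * (s ^ 2 * price₂ κ (s, z)) := by
  have h1 : HasFDerivAt (fun z => logCoord (s, z)) _ z :=
    ((hasFDerivAt_fst.const_add (log s)).sub (hasFDerivAt_snd.mul_const (2:ℝ)⁻¹)).prodMk
      (hasFDerivAt_snd (𝕜 := ℝ) (p := z))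
  have h2 : HasFDerivAt (fun z => heat κ (logCoord (s, z))) _ z :=
    HasFDerivAt.comp (f := fun z => logCoord (s, z)) (g := heat κ) z
      (heat_hasFDerivAt hκ hC hz) h1
  have h3 : HasFDerivAt (fun z : ℝ × ℝ => exp (-z.1)) _ z := (hasFDerivAt_fst (𝕜 := ℝ)).neg.exp
  have h4 : HasFDerivAt (fun z => price κ (s, z)) _ z := h3.mul h2
  rw [h4.fderiv]
  simp [price, price₁, price₂]
  field_simp
  ring

end GaussKernel

namespace GaussKernel
open ProbabilityTheory

/-- The asset price with accumulated interest `q.2.1` and variance `q.2.2`, driven by `x`. -/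
noncomputable def asset (q : ℝ × ℝ × ℝ) (x : ℝ) : ℝ :=
  max q.1 0 * exp (max q.2.1 0) * exp (-max q.2.2 0 / 2 + √q.2.2 * x)

/-- The discounted expected payoff, as a continuous function on the whole space. -/
noncomputable def expPay (K : ℝ → ℝ) (q : ℝ × ℝ × ℝ) : ℝ :=
  exp (-max q.2.1 0) * ∫ x, K (asset q x) ∂gaussianReal 0 1

theorem asset_nonneg (q : ℝ × ℝ × ℝ) (x : ℝ) : 0 ≤ asset q x := by
  unfold asset; positivity

theorem asset_continuous : Continuous (Function.uncurry asset) := by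
  unfold asset Function.uncurry; fun_prop

theorem integrable_asset (q : ℝ × ℝ × ℝ) : Integrable (asset q) (gaussianReal 0 1) := by
  unfold asset
  simp only [exp_add]
  exact ((integrable_exp_mul_gaussianReal _).const_mul _).const_mul _

theorem integral_asset (q : ℝ × ℝ × ℝ) :
    ∫ x, asset q x ∂gaussianReal 0 1 = max q.1 0 * exp (max q.2.1 0) := by
  unfold asset
  simp only [exp_add, integral_const_mul]
  have h := mgf_gaussianReal (p := gaussianReal 0 1) (X := id) (μ := 0) (v := 1)
    Measure.map_id (√q.2.2)
  simp only [mgf, id] at h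
  rw [h, ← exp_add]
  have : √q.2.2 ^ 2 = max q.2.2 0 := by
    rcases le_total 0 q.2.2 with h | h
    · rw [sq_sqrt h, max_eq_left h]
    · rw [sqrt_eq_zero_of_nonpos h, max_eq_right h]; simp
  rw [this]
  simp only [zero_mul, NNReal.coe_one, one_mul, zero_add]
  rw [neg_div, neg_add_cancel, exp_zero, mul_one]

variable {K : ℝ → ℝ} (hKcont : ContinuousOn K (Set.Ici 0)) {k₁ k₂ : ℝ} (hk₁ : 0 < k₁)
  (hk₂ : 0 < k₂) (hK : ∀ s : ℝ, 0 ≤ s → 0 ≤ K s ∧ K s ≤ k₁ + k₂ * s)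

include hKcont in
theorem payoff_continuous : Continuous fun a : (ℝ × ℝ × ℝ) × ℝ => K (asset a.1 a.2) :=
  hKcont.comp_continuous (f := fun a : (ℝ × ℝ × ℝ) × ℝ => asset a.1 a.2) asset_continuous
    fun a => asset_nonneg a.1 a.2

include hKcont hk₂ hK in
theorem expPay_continuous : Continuous (expPay K) := by
  have hcont := payoff_continuous hKcont
  have hmean : Continuous fun q => ∫ x, K (asset q x) ∂gaussianReal 0 1 := by
    refine continuous_iff_continuousAt.2 fun q => ?_
    set c := max q.1 0 * exp (max q.2.1 0) + 1
    set m := √q.2.2 + 1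
    have hc : 0 ≤ c := by positivity
    refine continuousAt_of_dominated
      (bound := fun x => k₁ + k₂ * (c * (exp (m * x) + exp (-m * x))))
      (Eventually.of_forall fun q => ?_) ?_ ?_ (ae_of_all _ fun x => ?_)
    · exact (hcont.comp (f := fun x => (q, x)) (by fun_prop)).aestronglyMeasurable
    · have h1 : ∀ᶠ q' : ℝ × ℝ × ℝ in 𝓝 q, max q'.1 0 * exp (max q'.2.1 0) < c :=
        Tendsto.eventually_lt_const (lt_add_one _) (Continuous.tendsto (by fun_prop) q)
      have h2 : ∀ᶠ q' : ℝ × ℝ × ℝ in 𝓝 q, √q'.2.2 < m :=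
        Tendsto.eventually_lt_const (lt_add_one _) (Continuous.tendsto (by fun_prop) q)
      filter_upwards [h1, h2] with q' h1 h2
      refine ae_of_all _ fun x => ?_
      obtain ⟨h3, h4⟩ := hK _ (asset_nonneg q' x)
      rw [Real.norm_eq_abs, abs_of_nonneg h3]
      refine h4.trans ?_
      have h5 : exp (-max q'.2.2 0 / 2 + √q'.2.2 * x) ≤ exp (m * x) + exp (-m * x) := by
        have h0 : 0 ≤ max q'.2.2 0 := le_max_right _ _
        have h6 : √q'.2.2 * x ≤ m * |x| := (le_abs_self _).trans (by
          rw [abs_mul, abs_of_nonneg (sqrt_nonneg _)]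
          exact mul_le_mul_of_nonneg_right h2.le (abs_nonneg x))
        refine (exp_le_exp.2 (show _ ≤ m * |x| by linarith)).trans ?_
        rcases abs_cases x with ⟨h, _⟩ | ⟨h, _⟩ <;> rw [h]
        · linarith [exp_pos (-m * x)]
        · rw [mul_neg, ← neg_mul]; linarith [exp_pos (m * x)]
      unfold asset
      gcongr
    · exact (integrable_const _).add ((((integrable_exp_mul_gaussianReal m).add
        (integrable_exp_mul_gaussianReal (-m))).const_mul _).const_mul _)
    · exact (hcont.comp (f := fun q => (q, x)) (by fun_prop)).continuousAt
  unfold expPay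
  fun_prop

include hKcont hk₁ hK in
theorem abs_expPay_le (q : ℝ × ℝ × ℝ) : |expPay K q| ≤ k₁ + k₂ * max q.1 0 := by
  have hcont := payoff_continuous hKcont
  have h0 : 0 ≤ ∫ x, K (asset q x) ∂gaussianReal 0 1 :=
    integral_nonneg fun x => (hK _ (asset_nonneg q x)).1
  have hb : Integrable (fun x => k₁ + k₂ * asset q x) (gaussianReal 0 1) :=
    (integrable_const _).add ((integrable_asset q).const_mul _)
  have h1 : ∫ x, K (asset q x) ∂gaussianReal 0 1 ≤ ∫ x, (k₁ + k₂ * asset q x) ∂gaussianReal 0 1 := by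
    refine integral_mono (hb.mono' ?_ (ae_of_all _ fun x => ?_)) hb
      fun x => (hK _ (asset_nonneg q x)).2
    · exact (hcont.comp (f := fun x => (q, x)) (by fun_prop)).aestronglyMeasurable
    · obtain ⟨h3, h4⟩ := hK _ (asset_nonneg q x)
      rwa [Real.norm_eq_abs, abs_of_nonneg h3]
  rw [integral_add (integrable_const _) ((integrable_asset q).const_mul _), integral_const_mul,
    integral_asset] at h1
  simp only [integral_const, probReal_univ, one_smul] at h1
  unfold expPay
  rw [abs_of_nonneg (mul_nonneg (exp_pos _).le h0)]
  refine (mul_le_mul_of_nonneg_left h1 (exp_pos _).le).trans ?_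
  have h2 : exp (-max q.2.1 0) ≤ 1 := exp_le_one_iff.2 (by simp)
  have h3 : exp (-max q.2.1 0) * exp (max q.2.1 0) = 1 := by rw [← exp_add]; simp
  calc _ = exp (-max q.2.1 0) * k₁ +
        k₂ * max q.1 0 * (exp (-max q.2.1 0) * exp (max q.2.1 0)) := by ring
    _ ≤ 1 * k₁ + k₂ * max q.1 0 * 1 := by rw [h3]; gcongr
    _ = _ := by ring

theorem expPay_zero (K : ℝ → ℝ) {s : ℝ} (hs : 0 ≤ s) : expPay K (s, 0) = K s := by
  simp [expPay, asset, max_eq_left hs]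

theorem expPay_eq_price (K : ℝ → ℝ) {s : ℝ} (hs : 0 < s) {z : ℝ × ℝ} (hR : 0 ≤ z.1) (hV : 0 < z.2) :
    expPay K (s, z) = price (fun ξ => K (exp ξ)) (s, z) := by
  set m := log s + z.1 - z.2 / 2
  set v : ℝ≥0 := ⟨z.2, hV.le⟩
  have hv : v ≠ 0 := fun h => hV.ne' (congrArg NNReal.toReal h)
  have h1 : Measure.map (fun x => √z.2 * x + m) (gaussianReal 0 1) = gaussianReal m v := by
    have e1 := gaussianReal_map_const_mul (μ := 0) (v := 1) (√z.2)
    have e2 := gaussianReal_map_add_const (μ := √z.2 * 0)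
      (v := NNReal.mk (√z.2 ^ 2) (sq_nonneg _) * 1) m
    rw [← e1, Measure.map_map (by fun_prop) (by fun_prop)] at e2
    rw [mul_zero, zero_add] at e2
    refine Eq.trans e2 ?_
    congr 1
    ext
    simp [v, sq_sqrt hV.le]
    rfl
  have h2 : ∀ x, asset (s, z) x = exp (√z.2 * x + m) := by
    intro x
    simp only [asset, m]
    rw [max_eq_left hs.le, max_eq_left hR, max_eq_left hV.le]
    nth_rewrite 1 [← exp_log hs]
    rw [← exp_add, ← exp_add]
    congr 1
    ring
  have hem : MeasurableEmbedding fun x => √z.2 * x + m := by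
    exact ((Homeomorph.mulLeft₀ (√z.2) (sqrt_ne_zero'.2 hV)).trans
      (Homeomorph.addRight m)).measurableEmbedding
  unfold expPay price heat
  simp only [h2]
  rw [← hem.integral_map (fun y => K (exp y)) (μ := gaussianReal 0 1), h1,
    integral_gaussianReal_eq_integral_smul hv, max_eq_left hR]
  simp only [gaussianPDFReal, logCoord, mom, smul_eq_mul, mul_assoc, integral_const_mul]
  congr 2
  refine integral_congr_ae (ae_of_all _ fun ξ => ?_)
  simp only [ker, pow_zero, one_mul]
  exact mul_comm _ _

include hk₁ hk₂ hK in
theorem abs_payoff_exp_le (ξ : ℝ) : |K (exp ξ)| ≤ (k₁ + k₂) * exp |ξ| := by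
  obtain ⟨h1, h2⟩ := hK _ (exp_pos ξ).le
  rw [abs_of_nonneg h1]
  refine h2.trans ?_
  have h3 : exp ξ ≤ exp |ξ| := exp_le_exp.2 (le_abs_self ξ)
  have h4 : 1 ≤ exp |ξ| := one_le_exp (abs_nonneg ξ)
  nlinarith

include hKcont in
theorem payoff_exp_measurable : Measurable fun ξ => K (exp ξ) :=
  (hKcont.comp_continuous continuous_exp fun ξ => (exp_pos ξ).le).measurable

end GaussKernel

/-- A smooth cutoff equal to one near a compact rectangle in the open upper half plane. -/
theorem exists_cutoff {a v₁ v₂ : ℝ} (ha : 0 ≤ a) (hv₁ : 0 < v₁) (hv : v₁ ≤ v₂) :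
    ∃ ω : ℝ × ℝ → ℝ, ContDiff ℝ 1 ω ∧ HasCompactSupport ω ∧ tsupport ω ⊆ {z | 0 < z.2} ∧
      ∀ z ∈ Icc 0 a ×ˢ Icc v₁ v₂, ∀ᶠ z' in 𝓝 z, ω z' = 1 := by
  let b₁ : ContDiffBump (0:ℝ) := ⟨a + 1, a + 2, by linarith, by linarith⟩
  let b₂ : ContDiffBump ((v₁ + v₂) / 2) :=
    ⟨(v₂ - v₁) / 2 + v₁ / 4, (v₂ - v₁) / 2 + v₁ / 2, by linarith, by linarith⟩
  have hsub : tsupport (fun z : ℝ × ℝ => b₁ z.1 * b₂ z.2) ⊆ tsupport b₁ ×ˢ tsupport b₂ := by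
    refine closure_minimal (fun z hz => ?_)
      ((isClosed_tsupport b₁).prod (isClosed_tsupport b₂))
    exact ⟨subset_tsupport _ (left_ne_zero_of_mul hz), subset_tsupport _ (right_ne_zero_of_mul hz)⟩
  refine ⟨fun z => b₁ z.1 * b₂ z.2, (b₁.contDiff.comp contDiff_fst).mul
    (b₂.contDiff.comp contDiff_snd), ?_, fun z hz => ?_, fun z hz => ?_⟩
  · exact (b₁.hasCompactSupport.isCompact.prod b₂.hasCompactSupport.isCompact).of_isClosed_subset
      (isClosed_tsupport _) hsub
  · have h := (hsub hz).2
    rw [b₂.tsupport_eq, Real.closedBall_eq_Icc] at h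
    have h1 : (v₁ + v₂) / 2 - ((v₂ - v₁) / 2 + v₁ / 2) ≤ z.2 := h.1
    exact (show (0:ℝ) < z.2 by linarith)
  · have h1 : ∀ᶠ x in 𝓝 z.1, b₁ x = 1 := by
      have : z.1 ∈ Metric.ball 0 (a + 1) := by
        rw [Real.ball_eq_Ioo]; exact ⟨by linarith [hz.1.1], by linarith [hz.1.2]⟩
      exact b₁.eventuallyEq_one_of_mem_ball this
    have h2 : ∀ᶠ x in 𝓝 z.2, b₂ x = 1 := by
      have : z.2 ∈ Metric.ball ((v₁ + v₂) / 2) ((v₂ - v₁) / 2 + v₁ / 4) := by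
        rw [Real.ball_eq_Ioo]; exact ⟨by linarith [hz.2.1], by linarith [hz.2.2]⟩
      exact b₂.eventuallyEq_one_of_mem_ball this
    filter_upwards [(continuous_fst.tendsto z).eventually h1,
      (continuous_snd.tendsto z).eventually h2] with x hx1 hx2
    rw [hx1, hx2, one_mul]

section Cutoff

variable {ω : ℝ × ℝ → ℝ} (hω : ContDiff ℝ 1 ω) (hsupp : HasCompactSupport ω)
  (hpos : tsupport ω ⊆ {z | 0 < z.2}) {g : ℝ × ℝ × ℝ → ℝ}
  (hg : ContDiffOn ℝ 1 g {q | 0 < q.1 ∧ 0 < q.2.2})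

include hω hpos hg in
theorem contDiffAt_cutoff_mul {q : ℝ × ℝ × ℝ} (hq : 0 < q.1) :
    ContDiffAt ℝ 1 (fun q => ω q.2 * g q) q := by
  by_cases hz : q.2 ∈ tsupport ω
  · have hopen : IsOpen {q : ℝ × ℝ × ℝ | 0 < q.1 ∧ 0 < q.2.2} :=
      (isOpen_lt continuous_const continuous_fst).inter
        (isOpen_lt continuous_const (continuous_snd.comp continuous_snd))
    exact (hω.comp contDiff_snd).contDiffAt.mul
      (hg.contDiffAt (hopen.mem_nhds ⟨hq, hpos hz⟩))
  · have h0 : (fun q : ℝ × ℝ × ℝ => ω q.2 * g q) =ᶠ[𝓝 q] fun _ => 0 := by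
      filter_upwards [(continuous_snd.tendsto q).eventually
        (notMem_tsupport_iff_eventuallyEq.1 hz)] with x hx
      rw [hx]; simp
    exact contDiffAt_const.congr_of_eventuallyEq h0

include hω hpos hg in
theorem contDiff_cutoff_mul {s : ℝ} (hs : 0 < s) : ContDiff ℝ 1 fun z => ω z * g (s, z) :=
  contDiff_iff_contDiffAt.2 fun z =>
    ContDiffAt.comp (g := fun q : ℝ × ℝ × ℝ => ω q.2 * g q) (f := fun z => (s, z)) z
      (contDiffAt_cutoff_mul hω hpos hg (q := (s, z)) hs) (by fun_prop)

include hω hsupp hpos hg in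
theorem bounded_cutoff_mul {s : ℝ} (hs : 0 < s) : ∃ H, ∀ z, |ω z * g (s, z)| ≤ H :=
  (hsupp.mul_right (f' := fun z => g (s, z))).exists_bound_of_continuous
    (contDiff_cutoff_mul hω hpos hg hs).continuous

include hω hpos hg in
theorem continuousOn_cutoff_mul :
    ContinuousOn (fun q : ℝ × ℝ × ℝ => ω q.2 * g q) (Ioi 0 ×ˢ univ) := fun _ hq =>
  (contDiffAt_cutoff_mul hω hpos hg hq.1).continuousAt.continuousWithinAt

include hpos in
theorem hasDerivAt_cutoff_mul {g' : ℝ × ℝ × ℝ → ℝ}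
    (h : ∀ s z, 0 < s → 0 < z.2 → HasDerivAt (fun s => g (s, z)) (g' (s, z)) s) {s : ℝ}
    (hs : 0 < s) (z : ℝ × ℝ) :
    HasDerivAt (fun s => ω z * g (s, z)) (ω z * g' (s, z)) s := by
  by_cases hz : z ∈ tsupport ω
  · exact (h s z hs (hpos hz)).const_mul _
  · simp only [image_eq_zero_of_notMem_tsupport hz, zero_mul]
    exact hasDerivAt_const _ _

end Cutoff

open GaussKernel

/-- The candidate solution: the renewal solution started from the discounted expected payoff. -/
noncomputable def TransportData.value {k : ℕ} (d : TransportData k) (K : ℝ → ℝ)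
    (t s : ℝ) (i : Fin k) (y : ℝ) : ℝ := d.sol (fun z => expPay K (s, z)) i y (t, 0)

section Value

variable {k : ℕ} (d : TransportData k) {K : ℝ → ℝ} (hKcont : ContinuousOn K (Set.Ici 0))
  {k₁ k₂ : ℝ} (hk₁ : 0 < k₁) (hk₂ : 0 < k₂) (hK : ∀ s : ℝ, 0 ≤ s → 0 ≤ K s ∧ K s ≤ k₁ + k₂ * s)
  {ρ m M : ℝ} (hρ : 0 ≤ ρ) (hm : 0 < m) (hM : 0 ≤ M) (hbox : d.box = displacementBox d.T ρ m M)

theorem displacementBox_subset {T ρ m M t t₁ v₂ : ℝ} (hρ : 0 ≤ ρ) (hm : 0 ≤ m) (hM : 0 ≤ M)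
    (ht : 0 ≤ t) (htt : t ≤ t₁) (ht₁ : t₁ ≤ T) (hv₂ : M * T ≤ v₂) :
    displacementBox T ρ m M t ⊆ Icc 0 (ρ * T) ×ˢ Icc (m * (T - t₁)) v₂ := by
  rintro ζ ⟨⟨h1, h2⟩, h3, h4⟩
  rw [min_eq_left (htt.trans ht₁)] at h2 h3 h4
  exact ⟨⟨h1, h2.trans (by gcongr; linarith)⟩, le_trans (by gcongr) h3,
    h4.trans (le_trans (by gcongr; linarith) hv₂)⟩

include hKcont hk₁ hk₂ hK hρ hm hM hbox in

include hKcont hk₁ hk₂ hK hρ hm hM hbox in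
theorem TransportData.value_spec {i : Fin k} {t s y : ℝ} (ht : t ∈ Ioo 0 d.T) (hs : 0 < s)
    (hy : y ∈ Ioo 0 d.T) {r v : ℝ} (hQ : deriv (d.Q i) t = (r, v)) :
    ∃ (a b : ℝ) (φ₁ φ₂ : ℝ → ℝ),
      HasDerivAt (fun t => d.value K t s i y) a t ∧
      HasDerivAt (fun y => d.value K t s i y) b y ∧
      (∀ x, 0 < x → HasDerivAt (fun x => d.value K t x i y) (φ₁ x) x) ∧
      (∀ x, 0 < x → HasDerivAt φ₁ (φ₂ x) x) ∧
      a + b + (-r * d.value K t s i y + r * (s * φ₁ s) + v / 2 * (s ^ 2 * φ₂ s)) +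
        ∑ j, d.n i j y / d.S i y * (d.value K t s j 0 - d.value K t s i y) = 0 := by
  set κ : ℝ → ℝ := fun ξ => K (exp ξ) with hκdef
  have hκ : Measurable κ := payoff_exp_measurable hKcont
  have hC : ∀ ξ, |κ ξ| ≤ (k₁ + k₂) * exp |ξ| := abs_payoff_exp_le hk₁ hk₂ hK
  obtain ⟨g0, g1, g2⟩ := price_contDiffOn hκ hC 1
  simp only [Nat.cast_one] at g0 g1 g2
  have hT := d.T_pos
  set t₁ := (t + d.T) / 2 with ht₁
  have htt : t < t₁ := by linarith [ht.2]
  have ht₁T : t₁ < d.T := by linarith [ht.2]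
  have hv₁ : 0 < m * (d.T - t₁) := mul_pos hm (by linarith)
  set v₂ := max (m * (d.T - t₁)) (M * d.T)
  obtain ⟨ω, hω, hsupp, hpos, hone⟩ :=
    exists_cutoff (mul_nonneg hρ hT.le) hv₁ (le_max_left _ (M * d.T))
  set A := Icc 0 (ρ * d.T) ×ˢ Icc (m * (d.T - t₁)) v₂ with hA
  have hAc : IsCompact A := isCompact_Icc.prod isCompact_Icc
  have hsub : ∀ t, 0 ≤ t → t ≤ t₁ → ∀ ζ ∈ d.box t, (0 : ℝ × ℝ) + ζ ∈ A := by
    intro t h0 h1 ζ hζ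
    rw [zero_add]
    rw [hbox] at hζ
    exact displacementBox_subset hρ hm.le hM h0 h1 ht₁T.le (le_max_right _ _) hζ
  have hpayc : ∀ s, Continuous fun z => expPay K (s, z) := fun s =>
    (expPay_continuous hKcont hk₂ hK).comp (by fun_prop)
  have hval : ∀ t, 0 ≤ t → t ≤ t₁ → ∀ s, 0 < s → ∀ i, ∀ y ∈ Icc 0 d.T,
      d.value K t s i y = d.sol (fun z => ω z * price κ (s, z)) i y (t, 0) := by
    intro t h0 h1 s hs i y hy
    obtain ⟨H, hH⟩ := bounded_cutoff_mul hω hsupp hpos g0 hs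
    refine d.sol_congr_box (hpayc s) (contDiff_cutoff_mul hω hpos g0 hs).continuous
      (H := k₁ + k₂ * max s 0) (fun z => abs_expPay_le hKcont hk₁ hK (s, z)) hH hy fun ζ hζ => ?_
    have hζA := hsub t h0 h1 ζ hζ
    have hV : 0 < ((0 : ℝ × ℝ) + ζ).2 := hv₁.trans_le hζA.2.1
    rw [expPay_eq_price K hs hζA.1.1 hV, (hone _ hζA).self_of_nhds, one_mul]
  have hyI : y ∈ Icc 0 d.T := ⟨hy.1.le, hy.2.le⟩
  have hboxt := hsub t ht.1.le htt.le
  have hparam : ∀ g g' : ℝ × ℝ × ℝ → ℝ, ContDiffOn ℝ 1 g {q | 0 < q.1 ∧ 0 < q.2.2} →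
      ContDiffOn ℝ 1 g' {q | 0 < q.1 ∧ 0 < q.2.2} →
      (∀ s z, 0 < s → 0 < z.2 → HasDerivAt (fun s => g (s, z)) (g' (s, z)) s) →
      ∀ x, 0 < x → HasDerivAt (fun x => d.sol (fun z => ω z * g (x, z)) i y (t, 0))
        (d.sol (fun z => ω z * g' (x, z)) i y (t, 0)) x := by
    intro g g' hg hg' hgg x hx
    have hball : Metric.ball x x ⊆ Ioi 0 := fun u hu => by
      rw [Real.ball_eq_Ioo] at hu; simpa using hu.1
    refine d.sol_hasDerivAt_param (F := fun x z => ω z * g (x, z))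
      (F' := fun x z => ω z * g' (x, z)) hx
      (fun u hu => ⟨(contDiff_cutoff_mul hω hpos hg (hball hu)).continuous,
        bounded_cutoff_mul hω hsupp hpos hg (hball hu)⟩)
      ⟨(contDiff_cutoff_mul hω hpos hg' hx).continuous,
        bounded_cutoff_mul hω hsupp hpos hg' hx⟩
      ((continuousOn_cutoff_mul hω hpos hg').mono (prod_mono hball subset_rfl))
      (fun u hu z => hasDerivAt_cutoff_mul hpos hgg (hball hu) z) hyI hAc hboxt
  obtain ⟨B, hB⟩ := bounded_cutoff_mul hω hsupp hpos g0 hs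
  obtain ⟨B₁, hB₁⟩ := bounded_cutoff_mul hω hsupp hpos g1 hs
  obtain ⟨B₂, hB₂⟩ := bounded_cutoff_mul hω hsupp hpos g2 hs
  have c0 := contDiff_cutoff_mul hω hpos g0 hs
  have c1 := contDiff_cutoff_mul hω hpos g1 hs
  have c2 := contDiff_cutoff_mul hω hpos g2 hs
  have hbd : ∀ {f g : ℝ × ℝ → ℝ} {F G : ℝ} (a : ℝ), (∀ z, |f z| ≤ F) → (∀ z, |g z| ≤ G) →
      ∀ z, |f z + a * g z| ≤ F + |a| * G := fun a hf hg z =>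
    (abs_add_le _ _).trans (add_le_add (hf z) (by rw [abs_mul]; gcongr; exact hg z))
  have b0' := hbd (-r - 1) hB hB
  have b1' := hbd (r * s) b0' hB₁
  have b2' := hbd (v / 2 * s ^ 2) b1' hB₂
  have hcb : ∀ {f g : ℝ × ℝ → ℝ} (a : ℝ), Continuous f → Continuous g →
      Continuous fun z => f z + a * g z := fun a hf hg => by fun_prop
  have e0 := hcb (-r - 1) c0.continuous c0.continuous
  have e1 := hcb (r * s) e0 c1.continuous
  have e2 := hcb (v / 2 * s ^ 2) e1 c2.continuous
  have hsupp0 : HasCompactSupport fun z => ω z * price κ (s, z) := hsupp.mul_right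
  obtain ⟨L, hL⟩ := c0.lipschitzWith_of_hasCompactSupport hsupp0 one_ne_zero
  obtain ⟨a, b, ha, hb, heq⟩ := d.sol_equation c0 hB hL i hy.1 hy.2.le
    (p := (t, 0)) ht.2.ne hAc hboxt
  refine ⟨a, b, fun x => d.sol (fun z => ω z * price₁ κ (x, z)) i y (t, 0),
    fun x => d.sol (fun z => ω z * price₂ κ (x, z)) i y (t, 0), ?_, ?_, ?_, ?_, ?_⟩
  · refine ha.congr_of_eventuallyEq ?_
    filter_upwards [Ioo_mem_nhds ht.1 htt] with u hu
    exact hval u hu.1.le hu.2.le s hs i y hyI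
  · refine hb.congr_of_eventuallyEq ?_
    filter_upwards [Ioo_mem_nhds hy.1 hy.2] with u hu
    exact hval t ht.1.le htt.le s hs i u ⟨hu.1.le, hu.2.le⟩
  · intro x hx
    refine (hparam _ _ g0 g1 (fun s z hs hz => price_hasDerivAt hκ hC hs hz) x
      hx).congr_of_eventuallyEq ?_
    filter_upwards [lt_mem_nhds hx] with u hu
    exact hval t ht.1.le htt.le u hu i y hyI
  · exact hparam _ _ g1 g2 fun s z hs hz => price₁_hasDerivAt hκ hC hs hz
  · have hlin : d.sol (fun z => fderiv ℝ (fun z => ω z * price κ (s, z)) z (deriv (d.Q i) t)) i y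
        (t, 0) = d.sol (fun z => (ω z * price κ (s, z) + (-r - 1) * (ω z * price κ (s, z)) +
          r * s * (ω z * price₁ κ (s, z))) + v / 2 * s ^ 2 * (ω z * price₂ κ (s, z))) i y
          (t, 0) := by
      refine d.sol_congr_box (H := L * ‖deriv (d.Q i) t‖) ?_ e2 (fun z => ?_) b2' hyI
        fun ζ hζ => ?_
      · exact (c0.continuous_fderiv one_ne_zero).clm_apply continuous_const
      · rw [← Real.norm_eq_abs]
        refine (ContinuousLinearMap.le_opNorm _ _).trans ?_
        gcongr
        exact norm_fderiv_le_of_lipschitz ℝ hL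
      · have hζA := hboxt ζ hζ
        have hV : 0 < ((0 : ℝ × ℝ) + ζ).2 := hv₁.trans_le hζA.2.1
        have he : (fun z => ω z * price κ (s, z)) =ᶠ[𝓝 ((0 : ℝ × ℝ) + ζ)]
            fun z => price κ (s, z) := by
          filter_upwards [hone _ hζA] with z hz
          rw [hz, one_mul]
        simp only [he.fderiv_eq, hQ, fderiv_price hκ hC hs hV, (hone _ hζA).self_of_nhds]
        ring
    rw [hlin, d.sol_add_mul e1 c2.continuous b1' hB₂, d.sol_add_mul e0 c1.continuous b0' hB₁,
      d.sol_add_mul c0.continuous c0.continuous hB hB] at heq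
    have h0I : (0:ℝ) ∈ Icc 0 d.T := ⟨le_rfl, hT.le⟩
    simp only [hval t ht.1.le htt.le s hs _ _ hyI, hval t ht.1.le htt.le s hs _ _ h0I]
    linear_combination heq

end Value

section Existence

variable {k : ℕ} (d : TransportData k) {K : ℝ → ℝ} (hKcont : ContinuousOn K (Set.Ici 0))
  {k₁ k₂ : ℝ} (hk₁ : 0 < k₁) (hk₂ : 0 < k₂) (hK : ∀ s : ℝ, 0 ≤ s → 0 ≤ K s ∧ K s ≤ k₁ + k₂ * s)
  {ρ m M : ℝ} (hρ : 0 ≤ ρ) (hm : 0 < m) (hM : 0 ≤ M) (hbox : d.box = displacementBox d.T ρ m M)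

include hKcont hk₁ hk₂ hK in
theorem TransportData.value_growth : linGrowth d.T (d.value K) := by
  refine ⟨k₁ + k₂, fun t s y h i => ?_⟩
  have hs : 0 ≤ s := h.2.1
  have hle : ∀ z, |expPay K (s, z)| ≤ k₁ + k₂ * s := fun z => by
    simpa only [max_eq_left hs] using abs_expPay_le hKcont hk₁ hK (s, z)
  have hc : Continuous fun z => expPay K (s, z) :=
    (expPay_continuous hKcont hk₂ hK).comp (by fun_prop)
  refine (d.sol_abs_le_box hc hle i ⟨h.2.2.1, h.2.2.2.trans h.1.2⟩ (t, 0) fun ζ _ => hle _).trans ?_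
  nlinarith

include hKcont hk₁ hk₂ hK hρ hm hM hbox in
theorem TransportData.value_continuousOn (i : Fin k) :
    ContinuousOn (fun p : ℝ × ℝ × ℝ => d.value K p.1 p.2.1 i p.2.2)
      {p : ℝ × ℝ × ℝ | memDbar d.T p.1 p.2.1 p.2.2} := by
  have hpay := expPay_continuous hKcont hk₂ hK
  have hc : ∀ s, Continuous fun z => expPay K (s, z) := fun s => hpay.comp (by fun_prop)
  have hle : ∀ s z, |expPay K (s, z)| ≤ k₁ + k₂ * max s 0 := fun s z =>
    abs_expPay_le hKcont hk₁ hK (s, z)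
  rintro ⟨t₀, s₀, y₀⟩ -
  refine Metric.continuousWithinAt_iff'.2 fun ε hε => ?_
  set A := Icc 0 (ρ * d.T) ×ˢ Icc (m * (d.T - d.T)) (M * d.T)
  have hev : ∀ᶠ s in 𝓝 s₀, ∀ z ∈ A, |expPay K (s, z) - expPay K (s₀, z)| < ε / 2 := by
    refine (isCompact_Icc.prod isCompact_Icc).eventually_forall_of_forall_eventually fun z _ => ?_
    have h2 : Continuous (fun q : ℝ × ℝ × ℝ => |expPay K (q.1, q.2) - expPay K (s₀, q.2)|) := by
      fun_prop
    exact (h2.tendsto (s₀, z)).eventually_lt_const (by simpa using hε)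
  have h1 : ∀ᶠ p : ℝ × ℝ × ℝ in 𝓝 (t₀, s₀, y₀), ∀ z ∈ A,
      |expPay K (p.2.1, z) - expPay K (s₀, z)| < ε / 2 :=
    (show Tendsto (fun p : ℝ × ℝ × ℝ => p.2.1) (𝓝 (t₀, s₀, y₀)) (𝓝 s₀) from
      Continuous.tendsto (by fun_prop) _).eventually hev
  have hsol : Continuous fun p : ℝ × ℝ × ℝ => d.value K p.1 s₀ i p.2.2 :=
    (d.sol_continuous (hc s₀) (hle s₀) i).comp
      (f := fun p : ℝ × ℝ × ℝ => (p.2.2, p.1, (0 : ℝ × ℝ))) (by fun_prop)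
  have h2 := Metric.continuousAt_iff'.1 (hsol.continuousAt (x := (t₀, s₀, y₀))) (ε / 2)
    (half_pos hε)
  filter_upwards [nhdsWithin_le_nhds h1, nhdsWithin_le_nhds h2, self_mem_nhdsWithin] with p h1 h2 hp
  have hp' : memDbar d.T p.1 p.2.1 p.2.2 := hp
  have h3 : |d.value K p.1 p.2.1 i p.2.2 - d.value K p.1 s₀ i p.2.2| ≤ ε / 2 := by
    refine d.sol_sub_abs_le (hc _) (hc _) (hle _) (hle _)
      ⟨hp'.2.2.1, hp'.2.2.2.trans hp'.1.2⟩ fun ζ hζ => ?_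
    rw [hbox] at hζ
    have := displacementBox_subset hρ hm.le hM hp'.1.1 hp'.1.2 le_rfl le_rfl hζ
    simpa using (h1 ζ this).le
  rw [← Real.dist_eq] at h3
  refine (dist_triangle _ (d.value K p.1 s₀ i p.2.2) _).trans_lt ?_
  linarith

include hKcont hk₁ hk₂ hK hρ hm hM hbox in
theorem TransportData.value_isPSolution {lam : Fin k → Fin k → ℝ → ℝ} {r : Fin k → ℝ}
    {σ : ℝ → Fin k → ℝ}
    (hrate : ∀ i j y, 0 < y → d.n i j y / d.S i y = if j ≠ i then lam i j y else 0)
    (hdrift : ∀ i, ∀ t ∈ Ioo 0 d.T, deriv (d.Q i) t = (r i, σ t i ^ 2)) :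
    isPSolution lam r σ K d.T (d.value K) := by
  refine ⟨d.value_continuousOn hKcont hk₁ hk₂ hK hρ hm hM hbox, fun i t s y h => ?_,
    fun i t s y h => ?_, fun i s hs y hy => ?_⟩
  · obtain ⟨ht, hs, hy⟩ := h
    obtain ⟨a, b, φ₁, φ₂, ha, hb, h1, h2, -⟩ := d.value_spec hKcont hk₁ hk₂ hK hρ hm hM hbox ht hs
      ⟨hy.1, hy.2.trans ht.2⟩ (hdrift i t ht)
    refine ⟨ha.differentiableAt, (h1 s hs).differentiableAt, ?_, hb.differentiableAt⟩
    refine (h2 s hs).differentiableAt.congr_of_eventuallyEq ?_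
    filter_upwards [lt_mem_nhds hs] with x hx using (h1 x hx).deriv
  · obtain ⟨ht, hs, hy⟩ := h
    obtain ⟨a, b, φ₁, φ₂, ha, hb, h1, h2, heq⟩ := d.value_spec hKcont hk₁ hk₂ hK hρ hm hM hbox ht
      hs ⟨hy.1, hy.2.trans ht.2⟩ (hdrift i t ht)
    have h3 : deriv (deriv fun x => d.value K t x i y) s = φ₂ s := by
      rw [← (h2 s hs).deriv]
      refine EventuallyEq.deriv_eq ?_
      filter_upwards [lt_mem_nhds hs] with x hx using (h1 x hx).deriv
    rw [ha.deriv, hb.deriv, (h1 s hs).deriv, h3, Finset.sum_filter]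
    simp only [hrate i _ y hy.1, ite_mul, zero_mul] at heq
    linear_combination heq
  · have h0 : d.value K d.T s i y = _ := d.sol_of_ge _ i (p := (d.T, 0)) le_rfl hy
    rw [h0, expPay_zero K (le_of_lt hs)]

end Existence

theorem isPSolution.eq_of_linGrowth {k : ℕ} {lam : Fin k → Fin k → ℝ → ℝ}
    (hnn : ∀ i j : Fin k, i ≠ j → ∀ y : ℝ, 0 < y → 0 ≤ lam i j y)
    {c : ℝ} (hc : 0 < c) (hbound : ∀ i : Fin k, ∀ y : ℝ, 0 < y → sumLam lam i y ≤ c)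
    {r : Fin k → ℝ} (hr : ∀ i : Fin k, 0 ≤ r i)
    {σ : ℝ → Fin k → ℝ} (hσcont : ∀ i : Fin k, ContinuousOn (fun u => σ u i) (Set.Ici 0))
    {T : ℝ} (hT : 0 < T) {K : ℝ → ℝ} {φ ψ : ℝ → ℝ → Fin k → ℝ → ℝ}
    (hφ : isPSolution lam r σ K T φ) (hφg : linGrowth T φ)
    (hψ : isPSolution lam r σ K T ψ) (hψg : linGrowth T ψ)
    {t s y : ℝ} (hp : memDbar T t s y) (i : Fin k) : φ t s i y = ψ t s i y :=
  le_antisymm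
    (sub_nonpos.1 (maximum_principle hnn hc hbound hr hσcont hT (hφ.sub hψ) (hφg.sub hψg) hp i))
    (sub_nonpos.1 (maximum_principle hnn hc hbound hr hσcont hT (hψ.sub hφ) (hψg.sub hφg) hp i))

end

theorem stmt_14 {k : ℕ} (lam : Fin k → Fin k → ℝ → ℝ)
    (hmeas : ∀ i j : Fin k, i ≠ j → Measurable (lam i j))
    (hnn : ∀ i j : Fin k, i ≠ j → ∀ y : ℝ, 0 < y → 0 ≤ lam i j y)
    (c : ℝ) (hc : 0 < c)
    (hbound : ∀ i : Fin k, ∀ y : ℝ, 0 < y → sumLam lam i y ≤ c)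
    (hinf : ∀ i : Fin k, Tendsto (Lambda lam i) atTop atTop)
    (hdiff : ∀ i j : Fin k, i ≠ j → ∀ y : ℝ, 0 < y → DifferentiableAt ℝ (lam i j) y)
    (hirr : ∀ i j : Fin k, ∃ n : ℕ, 1 ≤ n ∧ 0 < (ptilde lam ^ n) i j)
    (r : Fin k → ℝ) (hr : ∀ i : Fin k, 0 ≤ r i)
    (σ : ℝ → Fin k → ℝ)
    (hσpos : ∀ u : ℝ, 0 ≤ u → ∀ i : Fin k, 0 < σ u i)
    (hσcont : ∀ i : Fin k, ContinuousOn (fun u => σ u i) (Set.Ici 0))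
    (T : ℝ) (hT : 0 < T)
    (K : ℝ → ℝ) (hKcont : ContinuousOn K (Set.Ici 0))
    (k₁ k₂ : ℝ) (hk₁ : 0 < k₁) (hk₂ : 0 < k₂)
    (hK : ∀ s : ℝ, 0 ≤ s → 0 ≤ K s ∧ K s ≤ k₁ + k₂ * s) :
    ∃ φ : ℝ → ℝ → Fin k → ℝ → ℝ,
      (isPSolution lam r σ K T φ ∧ linGrowth T φ) ∧
      ∀ ψ : ℝ → ℝ → Fin k → ℝ → ℝ,
        isPSolution lam r σ K T ψ → linGrowth T ψ →
        ∀ t s y : ℝ, memDbar T t s y → ∀ i : Fin k, φ t s i y = ψ t s i y := by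
  obtain ⟨d, rfl, hrate, hdrift, ρ, m, M, hρ, hm, hM, hbox⟩ :=
    exists_transportData hmeas hnn hc hbound hdiff hr hσpos hσcont hT
  have hsol := d.value_isPSolution hKcont hk₁ hk₂ hK hρ hm hM hbox hrate hdrift
  have hgrowth := d.value_growth hKcont hk₁ hk₂ hK
  exact ⟨d.value K, ⟨hsol, hgrowth⟩, fun ψ hψ hψg t s y hp i =>
    hsol.eq_of_linGrowth hnn hc hbound hr hσcont hT hgrowth hψ hψg hp i⟩
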